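/- arXiv:2403.19312 — 2 statements merged into one kernel-verified Lean document; each statement's English description precedes it below -/
import Mathlib

section
/- If D is a 4-anti-traceable oriented graph, then for every integer k with 2 ≤ k ≤ |V(D)|/2, the digraph D is 2k-anti-traceable. -/
variable {V : Type*}

/-- An oriented graph: no 2-cycles (and hence no loops). -/
def Oriented (A : V → V → Prop) : Prop := ∀ u v, A u v → ¬ A v u

/-- `AltPath A b l` : the consecutive vertices of `l` are joined by arcs whose
directions alternate, the first arc being forward iff `b = true`. -/
def AltPath (A : V → V → Prop) : Bool → List V → Prop
  | _, [] => True
  | _, [_] => True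
  | b, x :: y :: rest => (if b then A x y else A y x) ∧ AltPath A (!b) (y :: rest)

/-- An anti-directed path: distinct vertices with alternating arcs. -/
def IsAntiPath (A : V → V → Prop) (l : List V) : Prop :=
  l.Nodup ∧ ∃ b : Bool, AltPath A b l

/-- The induced subdigraph on the vertex set `S` has a hamiltonian anti-directed path. -/
def AntiTraceableOn [DecidableEq V] (A : V → V → Prop) (S : Finset V) : Prop :=
  ∃ l : List V, l.Nodup ∧ l.toFinset = S ∧ ∃ b : Bool, AltPath A b l

/-- The digraph has a hamiltonian anti-directed path. -/
def AntiTraceable [Fintype V] [DecidableEq V] (A : V → V → Prop) : Prop :=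
  AntiTraceableOn A Finset.univ

/-- `k`-anti-traceable: order at least `k` and every induced subdigraph on `k`
vertices has a hamiltonian anti-directed path. -/
def KAntiTraceable [Fintype V] [DecidableEq V] (k : ℕ) (A : V → V → Prop) : Prop :=
  k ≤ Fintype.card V ∧ ∀ S : Finset V, S.card = k → AntiTraceableOn A S

/-- An anti-directed cycle: a cyclic sequence of distinct vertices, of even
length at least 4, in which even-indexed vertices are sources and odd-indexed
vertices are sinks of the two incident arcs. -/
def AltCycle (A : V → V → Prop) (l : List V) : Prop :=
  l.Nodup ∧ 4 ≤ l.length ∧ l.length % 2 = 0 ∧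
  ∀ i : Fin l.length,
    if i.1 % 2 = 0 then
      A (l.get i) (l.get ⟨(i.1 + 1) % l.length, Nat.mod_lt _ (Nat.zero_lt_of_lt i.2)⟩)
    else
      A (l.get ⟨(i.1 + 1) % l.length, Nat.mod_lt _ (Nat.zero_lt_of_lt i.2)⟩) (l.get i)

/-- The arcs among `{a,b,c}` form a subset of the arcs of a directed triangle. -/
def SubDirTriangle (A : V → V → Prop) (a b c : V) : Prop :=
  (¬ A b a ∧ ¬ A c b ∧ ¬ A a c) ∨ (¬ A a b ∧ ¬ A b c ∧ ¬ A c a)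

/-- `AltSegment A s t m`: there is an anti-directed path of even order with vertex multiset `m`
that leaves its first vertex `s` by a forward arc and enters its last vertex `t`. -/
inductive AltSegment (A : V → V → Prop) : V → V → Multiset V → Prop
  | arc {s t : V} : A s t → AltSegment A s t ({s} + {t})
  | cons {s b x t : V} {m : Multiset V} :
      A s b → A x b → AltSegment A x t m → AltSegment A s t ({s} + {b} + m)

namespace AltSegment

variable {A : V → V → Prop} {s t x y : V} {m n : Multiset V}

theorem join (h : AltSegment A s t m) (hxt : A x t) (h' : AltSegment A x y n) :
    AltSegment A s y (m + n) := by
  induction h with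
  | arc hst => exact .cons hst hxt h'
  | cons hsb hx _ ih =>
    have := cons hsb hx (ih hxt)
    rwa [← add_assoc] at this

/-- A segment can be traversed backwards between two new end vertices. -/
theorem wrap (h : AltSegment A s t m) (hxt : A x t) (hsy : A s y) :
    AltSegment A x y ({x} + m + {y}) := by
  induction h generalizing y with
  | arc hst =>
    convert cons hxt hst (arc hsy) using 1
    abel
  | cons hsb hx _ ih =>
    convert (ih hxt hx).join hsb (arc hsy) using 1
    abel

theorem eq_arc_or_snoc (h : AltSegment A s t m) :
    (A s t ∧ m = {s} + {t}) ∨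
      ∃ y x m', AltSegment A s y m' ∧ A x y ∧ A x t ∧ m = m' + ({x} + {t}) := by
  induction h with
  | arc h => exact .inl ⟨h, rfl⟩
  | cons hsb hx h ih =>
    right
    obtain ⟨hxt, rfl⟩ | ⟨y, z, m', h', hzy, hzt, rfl⟩ := ih
    · exact ⟨_, _, _, .arc hsb, hx, hxt, rfl⟩
    · exact ⟨_, _, _, .cons hsb hx h', hzy, hzt, by rw [← add_assoc]⟩

/-- The vertices of a segment can be listed along the anti-directed path. -/
theorem exists_list (h : AltSegment A s t m) :
    ∃ l : List V, AltPath A true (s :: l) ∧ (↑(s :: l) : Multiset V) = m := by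
  induction h with
  | @arc s t hst => exact ⟨[t], by simpa [AltPath] using hst, rfl⟩
  | @cons s b x t m hsb hx _ ih =>
    obtain ⟨l, hl, rfl⟩ := ih
    exact ⟨b :: x :: l, by simpa [AltPath] using ⟨hsb, hx, hl⟩, rfl⟩

end AltSegment

/-- The arcs among `a, b, c, d` contain an anti-directed path on these four vertices. -/
def HasAltPathFour (A : V → V → Prop) (a b c d : V) : Prop :=
  (A a b ∧ A c d ∧ (A a d ∨ A c b)) ∨ (A a b ∧ A d c ∧ (A a c ∨ A d b)) ∨
  (A b a ∧ A c d ∧ (A b d ∨ A c a)) ∨ (A b a ∧ A d c ∧ (A b c ∨ A d a)) ∨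
  (A a c ∧ A b d ∧ (A a d ∨ A b c)) ∨ (A a c ∧ A d b ∧ (A a b ∨ A d c)) ∨
  (A c a ∧ A b d ∧ (A c d ∨ A b a)) ∨ (A c a ∧ A d b ∧ (A c b ∨ A d a)) ∨
  (A a d ∧ A c b ∧ (A a b ∨ A c d)) ∨ (A a d ∧ A b c ∧ (A a c ∨ A b d)) ∨
  (A d a ∧ A c b ∧ (A d b ∨ A c a)) ∨ (A d a ∧ A b c ∧ (A d c ∨ A b a))

theorem exists_alternating_of_antiTraceableOn [DecidableEq V] {A : V → V → Prop} {S : Finset V}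
    (hS : S.card = 4) (h : AntiTraceableOn A S) :
    ∃ p q r s, ({p, q, r, s} : Finset V) = S ∧ A p q ∧ A r q ∧ A r s := by
  obtain ⟨l, hl, rfl, b, hb⟩ := h
  rw [List.toFinset_card_of_nodup hl] at hS
  obtain ⟨p, q, r, s, rfl⟩ : ∃ p q r s, l = [p, q, r, s] := by
    match l, hS with
    | [p, q, r, s], _ => exact ⟨p, q, r, s, rfl⟩
  cases b
  · refine ⟨s, r, q, p, by ext; simp; tauto, ?_⟩
    simp only [AltPath] at hb
    grind
  · refine ⟨p, q, r, s, by ext; simp, ?_⟩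
    simp only [AltPath] at hb
    grind

theorem hasAltPathFour_of_antiTraceableOn [DecidableEq V] {A : V → V → Prop} {a b c d : V}
    (hn : [a, b, c, d].Nodup) (h : AntiTraceableOn A {a, b, c, d}) :
    HasAltPathFour A a b c d := by
  have hcard : ({a, b, c, d} : Finset V).card = 4 := by
    simpa using List.toFinset_card_of_nodup hn
  obtain ⟨p, q, r, s, hS, hpq, hrq, hrs⟩ := exists_alternating_of_antiTraceableOn hcard h
  have hperm : [p, q, r, s].Perm [a, b, c, d] := by
    refine (List.perm_of_nodup_nodup_toFinset_eq hn ?_ (by simpa using hS.symm)).symm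
    rw [← Multiset.coe_nodup, ← Multiset.toFinset_card_eq_card_iff_nodup]
    simpa [← hS] using hcard
  have hp : p ∈ [a, b, c, d] := hperm.subset (by simp)
  have hq : q ∈ [a, b, c, d] := hperm.subset (by simp)
  have hr : r ∈ [a, b, c, d] := hperm.subset (by simp)
  have hs : s ∈ [a, b, c, d] := hperm.subset (by simp)
  have hpn : [p, q, r, s].Nodup := hperm.nodup_iff.2 hn
  unfold HasAltPathFour
  simp only [List.mem_cons, List.not_mem_nil, or_false] at hp hq hr hs
  rcases hp with rfl | rfl | rfl | rfl <;> rcases hq with rfl | rfl | rfl | rfl <;>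
    (try (simp at hpn; done)) <;>
    rcases hr with rfl | rfl | rfl | rfl <;> (try (simp at hpn; done)) <;>
    rcases hs with rfl | rfl | rfl | rfl <;> first | (simp at hpn; done) | (simp only [*]; simp)

theorem HasAltPathFour.exists_altSegment {A : V → V → Prop} {a b c d : V}
    (h : HasAltPathFour A a b c d) : ∃ s t, AltSegment A s t ({a} + {b} + {c} + {d}) := by
  have key {p q r s : V} (hpq : A p q) (hrs : A r s) (h : A r q ∨ A p s)
      (heq : ({p} + {q} + {r} + {s} : Multiset V) = {a} + {b} + {c} + {d}) :
      ∃ s t, AltSegment A s t ({a} + {b} + {c} + {d}) := by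
    rw [← heq]
    obtain h | h := h
    · exact ⟨p, s, by simpa only [add_assoc] using AltSegment.cons hpq h (.arc hrs)⟩
    · refine ⟨r, q, ?_⟩
      convert AltSegment.cons hrs h (.arc hpq) using 1
      abel
  rcases h with ⟨h₁, h₂, h⟩ | ⟨h₁, h₂, h⟩ | ⟨h₁, h₂, h⟩ | ⟨h₁, h₂, h⟩ | ⟨h₁, h₂, h⟩ |
    ⟨h₁, h₂, h⟩ | ⟨h₁, h₂, h⟩ | ⟨h₁, h₂, h⟩ | ⟨h₁, h₂, h⟩ | ⟨h₁, h₂, h⟩ | ⟨h₁, h₂, h⟩ |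
    ⟨h₁, h₂, h⟩ <;> exact key h₁ h₂ (by tauto) (by abel)

/-- The path `a → b ← c → d` and the arc `u → v` combine to a hamiltonian anti-directed path. -/
theorem exists_altSegment_six {A : V → V → Prop} (hA : Oriented A)
    (hF : ∀ a b c d, [a, b, c, d].Nodup → HasAltPathFour A a b c d)
    {u v a b c d : V} (huv : A u v) (hab : A a b) (hcb : A c b) (hcd : A c d)
    (hn : [u, v, a, b, c, d].Nodup) :
    ∃ x y, AltSegment A x y ({u} + {v} + {a} + {b} + {c} + {d}) := by
  by_contra! hno
  have no : ∀ {x y m}, AltSegment A x y m → m ≠ {u} + {v} + {a} + {b} + {c} + {d} :=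
    fun h hm => hno _ _ (hm ▸ h)
  have nva_uc_ub_db_da : ¬ (A v a ∧ A u c ∧ A u b ∧ A d b ∧ A d a) :=
    fun ⟨hva, huc, hub, hdb, hda⟩ =>
    no (.cons hva hda (.cons hdb hub (.arc huc))) (by abel)
  have nbv_cu_au_bd : ¬ (A b v ∧ A c u ∧ A a u ∧ A b d) := fun ⟨hbv, hcu, hau, hbd⟩ =>
    no (.cons hau hcu (.cons hcd hbd (.arc hbv))) (by abel)
  have ndb_cu_cv_dv : ¬ (A d b ∧ A c u ∧ A c v ∧ A d v) := fun ⟨hdb, hcu, hcv, hdv⟩ =>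
    no (.cons hab hdb (.cons hdv hcv (.arc hcu))) (by abel)
  have ndb_va_du_ca : ¬ (A d b ∧ A v a ∧ A d u ∧ A c a) := fun ⟨hdb, hva, hdu, hca⟩ =>
    no (.cons hva hca (.cons hcb hdb (.arc hdu))) (by abel)
  have nac_uc_dv : ¬ (A a c ∧ A u c ∧ A d v) := fun ⟨hac, huc, hdv⟩ =>
    no (.cons hdv huv (.cons huc hac (.arc hab))) (by abel)
  have ndu_au_dv : ¬ (A d u ∧ A a u ∧ A d v) := fun ⟨hdu, hau, hdv⟩ =>
    no (.cons hcb hab (.cons hau hdu (.arc hdv))) (by abel)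
  have nua_va_vb : ¬ (A u a ∧ A v a ∧ A v b) := fun ⟨hua, hva, hvb⟩ =>
    no (.cons hua hva (.cons hvb hcb (.arc hcd))) (by abel)
  have nua_cv_bd : ¬ (A u a ∧ A c v ∧ A b d) := fun ⟨hua, hcv, hbd⟩ =>
    no (.cons hbd hcd (.cons hcv huv (.arc hua))) (by abel)
  have nbv_ua_ca : ¬ (A b v ∧ A u a ∧ A c a) := fun ⟨hbv, hua, hca⟩ =>
    no (.cons hbv huv (.cons hua hca (.arc hcd))) (by abel)
  have ndb_uc_dv : ¬ (A d b ∧ A u c ∧ A d v) := fun ⟨hdb, huc, hdv⟩ =>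
    no (.cons hab hdb (.cons hdv huv (.arc huc))) (by abel)
  have nua_cv_da : ¬ (A u a ∧ A c v ∧ A d a) := fun ⟨hua, hcv, hda⟩ =>
    no (.cons hda hua (.cons huv hcv (.arc hcb))) (by abel)
  have nua_va_vd : ¬ (A u a ∧ A v a ∧ A v d) := fun ⟨hua, hva, hvd⟩ =>
    no (.cons hua hva (.cons hvd hcd (.arc hcb))) (by abel)
  have nud : ¬ A u d := fun hud =>
    no (.cons hab hcb (.cons hcd hud (.arc huv))) (by abel)
  have nua_ub_vd : ¬ (A u a ∧ A u b ∧ A v d) := fun ⟨hua, hub, hvd⟩ =>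
    no (.cons hvd hcd (.cons hcb hub (.arc hua))) (by abel)
  have ncu_du_dv : ¬ (A c u ∧ A d u ∧ A d v) := fun ⟨hcu, hdu, hdv⟩ =>
    no (.cons hab hcb (.cons hcu hdu (.arc hdv))) (by abel)
  have ndb_ua_dv : ¬ (A d b ∧ A u a ∧ A d v) := fun ⟨hdb, hua, hdv⟩ =>
    no (.cons hcb hdb (.cons hdv huv (.arc hua))) (by abel)
  have nau_vd : ¬ (A a u ∧ A v d) := fun ⟨hau, hvd⟩ =>
    no (.cons hvd hcd (.cons hcb hab (.arc hau))) (by abel)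
  have ndv_ca_da : ¬ (A d v ∧ A c a ∧ A d a) := fun ⟨hdv, hca, hda⟩ =>
    no (.cons huv hdv (.cons hda hca (.arc hcb))) (by abel)
  have nad_ub : ¬ (A a d ∧ A u b) := fun ⟨had, hub⟩ =>
    no (.cons had hcd (.cons hcb hub (.arc huv))) (by abel)
  have nav : ¬ A a v := fun hav =>
    no (.cons huv hav (.cons hab hcb (.arc hcd))) (by abel)
  have f1 := hF v a b c (by grind)
  have f2 := hF u v a b (by grind)
  have f3 := hF u v a c (by grind)
  have f4 := hF u a b d (by grind)
  have f5 := hF u v c d (by grind)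
  have f6 := hF v a c d (by grind)
  have f7 := hF v a b d (by grind)
  have f8 := hF u v a d (by grind)
  have f9 := hF u v b d (by grind)
  clear no hno hF hn
  unfold Oriented HasAltPathFour at *
  grind (splits := 40)

/-- The path `a → b ← s ⋯ t ← c → d`, where `s ⋯ t` is an arbitrary segment, and the arc `u → v`
combine to a hamiltonian anti-directed path. -/
theorem exists_altSegment_of_middle {A : V → V → Prop} (hA : Oriented A)
    (hF : ∀ a b c d, [a, b, c, d].Nodup → HasAltPathFour A a b c d)
    {u v a b c d s t : V} {m : Multiset V} (huv : A u v) (hab : A a b) (hsb : A s b)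
    (hM : AltSegment A s t m) (hct : A c t) (hcd : A c d)
    (hn : [u, v, a, b, c, d].Nodup) :
    ∃ x y, AltSegment A x y ({u} + {v} + {a} + {b} + m + {c} + {d}) := by
  by_contra! hno
  have no : ∀ {x y n}, AltSegment A x y n → n ≠ {u} + {v} + {a} + {b} + m + {c} + {d} :=
    fun h hm => hno _ _ (hm ▸ h)
  have hW : AltSegment A c b ({c} + m + {b}) := hM.wrap hct hsb
  have ncv_ua_da : ¬ (A c v ∧ A u a ∧ A d a) := fun ⟨hcv, hua, hda⟩ =>
    no (.cons hda hua (.cons huv hcv hW)) (by abel)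
  have ndu_dv_cu : ¬ (A d u ∧ A d v ∧ A c u) := fun ⟨hdu, hdv, hcu⟩ =>
    no (.cons hab hsb (hM.join hct (.cons hcu hdu (.arc hdv)))) (by abel)
  have nua_da_db : ¬ (A u a ∧ A d a ∧ A d b) := fun ⟨hua, hda, hdb⟩ =>
    no (hW.join hdb (.cons hda hua (.arc huv))) (by abel)
  have ncv_du_au : ¬ (A c v ∧ A d u ∧ A a u) := fun ⟨hcv, hdu, hau⟩ =>
    no (.cons hdu hau (.cons hab hsb (hM.join hct (.arc hcv)))) (by abel)
  have ndv_ac_uc : ¬ (A d v ∧ A a c ∧ A u c) := fun ⟨hdv, hac, huc⟩ =>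
    no (.cons hdv huv (.cons huc hac (.cons hab hsb hM))) (by abel)
  have ndu_au_dv : ¬ (A d u ∧ A a u ∧ A d v) := fun ⟨hdu, hau, hdv⟩ =>
    no (hW.join hab (.cons hau hdu (.arc hdv))) (by abel)
  have nvd_ub_ua : ¬ (A v d ∧ A u b ∧ A u a) := fun ⟨hvd, hub, hua⟩ =>
    no (.cons hvd hcd (hW.join hub (.arc hua))) (by abel)
  have nau_cv_dv : ¬ (A a u ∧ A c v ∧ A d v) := fun ⟨hau, hcv, hdv⟩ =>
    no (.cons hdv hcv (hW.join hab (.arc hau))) (by abel)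
  have ncv_ad : ¬ (A c v ∧ A a d) := fun ⟨hcv, had⟩ =>
    no (.cons huv hcv (hW.join hab (.arc had))) (by abel)
  have nub_dv_da : ¬ (A u b ∧ A d v ∧ A d a) := fun ⟨hub, hdv, hda⟩ =>
    no (hW.join hub (.cons huv hdv (.arc hda))) (by abel)
  have nua_va_vd : ¬ (A u a ∧ A v a ∧ A v d) := fun ⟨hua, hva, hvd⟩ =>
    no (.cons hua hva (.cons hvd hcd hW)) (by abel)
  have nbv_bd_ua : ¬ (A b v ∧ A b d ∧ A u a) := fun ⟨hbv, hbd, hua⟩ =>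
    no (hM.join hct (.cons hcd hbd (.cons hbv huv (.arc hua)))) (by abel)
  have nvd_au : ¬ (A v d ∧ A a u) := fun ⟨hvd, hau⟩ =>
    no (.cons hvd hcd (hW.join hab (.arc hau))) (by abel)
  have nua_va_vb : ¬ (A u a ∧ A v a ∧ A v b) := fun ⟨hua, hva, hvb⟩ =>
    no (.cons hua hva (.cons hvb hsb (hM.join hct (.arc hcd)))) (by abel)
  have nca_ub_da : ¬ (A c a ∧ A u b ∧ A d a) := fun ⟨hca, hub, hda⟩ =>
    no (.cons hda hca (hW.join hub (.arc huv))) (by abel)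
  have nua_dv_ca : ¬ (A u a ∧ A d v ∧ A c a) := fun ⟨hua, hdv, hca⟩ =>
    no (.cons hdv huv (.cons hua hca hW)) (by abel)
  have nav : ¬ A a v := fun hav =>
    no (.cons huv hav (.cons hab hsb (hM.join hct (.arc hcd)))) (by abel)
  have nud : ¬ A u d := fun hud =>
    no (.cons hab hsb (hM.join hct (.cons hcd hud (.arc huv)))) (by abel)
  have f1 := hF a b c d (by grind)
  have f2 := hF u a c d (by grind)
  have f3 := hF u v c d (by grind)
  have f4 := hF v a b c (by grind)
  have f5 := hF u v a b (by grind)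
  have f6 := hF u v a d (by grind)
  have f7 := hF u v a c (by grind)
  have f8 := hF u b c d (by grind)
  clear no hno hF hn hW hM hsb hct
  unfold Oriented HasAltPathFour at *
  grind (splits := 40)

theorem exists_altSegment_of_card_eq {A : V → V → Prop} (hA : Oriented A)
    (hF : ∀ a b c d, [a, b, c, d].Nodup → HasAltPathFour A a b c d) (n : ℕ) (m : Multiset V)
    (hm : m.Nodup) (hcard : m.card = 2 * (n + 2)) : ∃ s t, AltSegment A s t m := by
  have four (m : Multiset V) (hm : m.Nodup) (h4 : 4 ≤ m.card) :
      ∃ s t m₁ m₂, AltSegment A s t m₁ ∧ m₁.card = 4 ∧ m = m₁ + m₂ := by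
    induction m using Quotient.inductionOn with | _ l
    match l, hm, h4 with
    | a :: b :: c :: d :: l, hm, _ =>
      have hn : [a, b, c, d].Nodup :=
        (Multiset.coe_nodup.1 hm).sublist (List.sublist_append_left [a, b, c, d] l)
      obtain ⟨s, t, h⟩ := (hF a b c d hn).exists_altSegment
      exact ⟨s, t, _, l, h, rfl, rfl⟩
  induction n generalizing m with
  | zero =>
    obtain ⟨s, t, m₁, m₂, h, h₁, rfl⟩ := four m hm (by lia)
    obtain rfl : m₂ = 0 := by
      rw [← Multiset.card_eq_zero]
      rw [Multiset.card_add] at hcard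
      lia
    exact ⟨s, t, by simpa using h⟩
  | succ n ih =>
    obtain ⟨p, q, m₁, m₂, h, -, rfl⟩ := four m hm (by lia)
    obtain ⟨u, v, m', huv, hm'⟩ : ∃ u v m', A u v ∧ m₁ + m₂ = {u} + {v} + m' := by
      cases h with
      | arc h => exact ⟨_, _, _, h, rfl⟩
      | cons h => exact ⟨_, _, _, h, add_assoc _ _ _⟩
    rw [hm'] at hm hcard ⊢
    obtain ⟨a, d, h'⟩ :=
      ih m' (Multiset.nodup_of_le (Multiset.le_add_left _ _) hm) (by simp at hcard; lia)
    cases h' with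
    | arc => simp at hcard; lia
    | @cons _ b s _ m' hab hsb h' =>
      obtain ⟨hsd, rfl⟩ | ⟨t, c, m', hM, hct, hcd, rfl⟩ := h'.eq_arc_or_snoc
      · have := exists_altSegment_six hA hF huv hab hsb hsd hm
        simpa only [add_assoc] using this
      · have heq : {u} + {v} + ({a} + {b} + (m' + ({c} + {d}))) =
            ({u} + {v} + {a} + {b} + m' + {c} + {d} : Multiset V) := by abel
        have heq' : {u} + {v} + ({a} + {b} + (m' + ({c} + {d}))) =
            ([u, v, a, b, c, d] : Multiset V) + m' := by
          rw [heq, show ([u, v, a, b, c, d] : Multiset V) =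
            {u} + ({v} + ({a} + ({b} + ({c} + {d})))) from rfl]
          abel
        rw [heq]
        rw [heq'] at hm
        exact exists_altSegment_of_middle hA hF huv hab hsb hM hct hcd
          (Multiset.nodup_of_le (Multiset.le_add_right _ _) hm)

theorem stmt11 [Fintype V] [DecidableEq V] (A : V → V → Prop)
    (hA : Oriented A) (h4 : KAntiTraceable 4 A)
    (k : ℕ) (hk2 : 2 ≤ k) (hk : 2 * k ≤ Fintype.card V) :
    KAntiTraceable (2 * k) A := by
  have hF : ∀ a b c d, [a, b, c, d].Nodup → HasAltPathFour A a b c d := fun a b c d hn =>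
    hasAltPathFour_of_antiTraceableOn hn
      (h4.2 _ (by simpa using List.toFinset_card_of_nodup hn))
  refine ⟨hk, fun S hS => ?_⟩
  obtain ⟨n, rfl⟩ := Nat.exists_eq_add_of_le' hk2
  obtain ⟨s, t, h⟩ := exists_altSegment_of_card_eq hA hF n S.val S.nodup hS
  obtain ⟨l, hl, hlS⟩ := h.exists_list
  refine ⟨s :: l, ?_, ?_, true, hl⟩
  · rw [← Multiset.coe_nodup, hlS]
    exact S.nodup
  · rw [← Finset.val_toFinset S, ← hlS]
    rfl
end

section
/- Every 4-anti-traceable oriented graph of order at least 8 is anti-traceable (i.e., f(4) = 8). -/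
variable {V : Type*}

/-! ### A checker for refutations by reverse unit propagation

An atom `10 * i + j` stands for an arc from the vertex with index `i` to the vertex with index `j`.
A clause is a pair of bit masks: the atoms occurring positively and those occurring negatively. -/

namespace AntiPathSearch

/-- Some literal of the clause `c` is true under the valuation `w`. -/
def Holds (w : ℕ → Prop) (c : ℕ × ℕ) : Prop :=
  ∃ e, (c.1.testBit e = true ∧ w e) ∨ (c.2.testBit e = true ∧ ¬ w e)

/-- The value `f n`. In the kernel, `n` is evaluated before it is passed on. -/
def force {α : Type} (n : ℕ) (f : ℕ → α) : α :=
  match n with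
  | 0 => f 0
  | m + 1 => f m.succ

theorem force_eq {α : Type} (n : ℕ) (f : ℕ → α) : force n f = f n := by
  cases n <;> rfl

/-- The atom of the reversed arc. -/
def swap (e : ℕ) : ℕ := ((e.mod 10).mul 10).add (e.div 10)

/-- The mask with the single bit `e`. -/
def bit (e : ℕ) : ℕ := Nat.shiftLeft 1 e

/-- Clauses indexed by natural numbers, stored in a binary tree. -/
inductive Table
  | nil : Table
  | node : ℕ × ℕ → Table → Table → Table

namespace Table

/-- The clause with index `k`, or a tautology. -/
def get : Table → ℕ → ℕ × ℕ
  | nil, _ => (1, 1)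
  | node c l r, k =>
    bif k.beq 0 then c
    else bif (k.mod 2).beq 1 then l.get (k.div 2) else r.get ((k.div 2).sub 1)

/-- Store the clause `d` under the unused index `k`, and pass the table on. -/
def insert : Table → ℕ → ℕ × ℕ → (Table → Bool) → Bool
  | nil, _, d, f => f (node d nil nil)
  | node c l r, k, d, f =>
    bif (k.mod 2).beq 1 then l.insert (k.div 2) d fun t => f (node c t r)
    else r.insert ((k.div 2).sub 1) d fun t => f (node c l t)

/-- Every stored clause is true under `w`. -/
def Valid (w : ℕ → Prop) : Table → Prop
  | nil => True
  | node c l r => Holds w c ∧ l.Valid w ∧ r.Valid w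

theorem Valid.get {w : ℕ → Prop} : ∀ {t : Table}, t.Valid w → ∀ k, Holds w (t.get k)
  | nil, _, k => by
    refine ⟨0, ?_⟩
    by_cases h : w 0
    · exact Or.inl ⟨by simp [Table.get], h⟩
    · exact Or.inr ⟨by simp [Table.get], h⟩
  | node c l r, h, k => by
    obtain ⟨hc, hl, hr⟩ := h
    unfold Table.get
    cases k.beq 0 <;> cases (k.mod 2).beq 1
    · exact hr.get _
    · exact hl.get _
    · exact hc
    · exact hc

theorem Valid.insert {w : ℕ → Prop} {d : ℕ × ℕ} (hd : Holds w d) :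
    ∀ {t : Table} {k : ℕ} {f : Table → Bool}, t.Valid w → (∀ t', t'.Valid w → f t' ≠ true) →
      t.insert k d f ≠ true
  | nil, _, _, _, hf => hf _ ⟨hd, trivial, trivial⟩
  | node c l r, k, f, ⟨hc, hl, hr⟩, hf => by
    unfold Table.insert
    cases (k.mod 2).beq 1
    · exact Valid.insert hd hr fun t ht => hf _ ⟨hc, hl, ht⟩
    · exact Valid.insert hd hl fun t ht => hf _ ⟨hc, ht, hr⟩

end Table

/-- Run one derivation, given by the base-4096 digits of `s`. Digits below 256 are the literals of
the derived clause, which is accumulated in `p` and `q`; a larger digit refers to a clause of `t`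
that has become unit or false. The masks `a` and `b` hold the atoms known to be true and false when
the derived clause is assumed to fail. The result is the derived clause. -/
def derive (t : Table) : ℕ → ℕ → ℕ → ℕ → ℕ → ℕ → Option (ℕ × ℕ)
  | 0, _, _, _, _, _ => none
  | fuel + 1, s, a, b, p, q =>
    force (s.mod 4096) fun d => force (s.div 4096) fun s =>
    bif d.blt 256 then
      force (d.div 2) fun e =>
      bif (d.mod 2).beq 0 then
        derive t fuel s a (b.lor (bit e)) (p.lor (bit e)) q
      else
        derive t fuel s (a.lor (bit e)) (b.lor (bit (swap e))) p (q.lor (bit e))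
    else
      match t.get (d.sub 256) with
      | (x, y) =>
        force (x.xor (x.land b)) fun x => force (y.xor (y.land a)) fun y =>
        bif y.beq 0 then
          bif x.beq 0 then some (p, q) else
          bif x.beq (bit x.log2) then
            force (a.lor x) fun a => force (b.lor (bit (swap x.log2))) fun b =>
            derive t fuel s a b p q
          else none
        else
          bif x.beq 0 && y.beq (bit y.log2) then
            force (b.lor y) fun b => derive t fuel s a b p q
          else none

theorem testBit_bit (e i : ℕ) : (bit e).testBit i = true ↔ e = i := by
  change (1 <<< e).testBit i = true ↔ e = i
  rw [Nat.one_shiftLeft, Nat.testBit_two_pow]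
  simp

theorem testBit_lor_bit (m e i : ℕ) :
    (m.lor (bit e)).testBit i = true ↔ m.testBit i = true ∨ e = i := by
  change (m ||| bit e).testBit i = true ↔ _
  rw [Nat.testBit_or, Bool.or_eq_true, testBit_bit]

theorem testBit_diff (x b i : ℕ) :
    (x.xor (x.land b)).testBit i = true ↔ x.testBit i = true ∧ b.testBit i = false := by
  change (x ^^^ x &&& b).testBit i = true ↔ _
  rw [Nat.testBit_xor, Nat.testBit_and]
  cases x.testBit i <;> cases b.testBit i <;> simp

/-- The atoms in `a` are true and those in `b` are false. -/
def Known (w : ℕ → Prop) (a b : ℕ) : Prop :=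
  (∀ e, a.testBit e = true → w e) ∧ (∀ e, b.testBit e = true → ¬ w e)

section Soundness

variable {w : ℕ → Prop}

theorem Known.setFalse {a b e : ℕ} (h : Known w a b) (he : ¬ w e) : Known w a (b.lor (bit e)) := by
  refine ⟨h.1, fun i hi => ?_⟩
  rcases (testBit_lor_bit b e i).1 hi with hi | rfl
  exacts [h.2 i hi, he]

theorem Known.setTrue (hw : ∀ e, w e → ¬ w (swap e)) {a b e : ℕ} (h : Known w a b) (he : w e) :
    Known w (a.lor (bit e)) (b.lor (bit (swap e))) := by
  refine ⟨fun i hi => ?_, (h.setFalse (hw e he)).2⟩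
  rcases (testBit_lor_bit a e i).1 hi with hi | rfl
  exacts [h.1 i hi, he]

theorem Known.unresolved {a b x y : ℕ} (h : Known w a b) (hc : Holds w (x, y)) :
    Holds w (x.xor (x.land b), y.xor (y.land a)) := by
  obtain ⟨e, ⟨h1, h2⟩ | ⟨h1, h2⟩⟩ := hc
  · refine ⟨e, Or.inl ⟨(testBit_diff _ _ _).2 ⟨h1, ?_⟩, h2⟩⟩
    by_contra hb
    exact h.2 e (by simpa using hb) h2
  · refine ⟨e, Or.inr ⟨(testBit_diff _ _ _).2 ⟨h1, ?_⟩, h2⟩⟩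
    by_contra ha
    exact h2 (h.1 e (by simpa using ha))

theorem not_holds_zero : ¬ Holds w (0, 0) := by
  rintro ⟨e, ⟨h, -⟩ | ⟨h, -⟩⟩ <;> simp at h

theorem derive_sound (hw : ∀ e, w e → ¬ w (swap e)) {t : Table} (ht : t.Valid w) (c : ℕ × ℕ) :
    ∀ fuel s a b p q, derive t fuel s a b p q = some c →
      (∀ e, p.testBit e = true → c.1.testBit e = true) ∧
      (∀ e, q.testBit e = true → c.2.testBit e = true) ∧
      ((¬ Holds w c → Known w a b) → Holds w c) := by
  intro fuel
  induction fuel with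
  | zero => intro s a b p q h; simp [derive] at h
  | succ fuel ih =>
    intro s a b p q h
    rw [derive] at h
    simp only [force_eq] at h
    generalize (s.mod 4096).div 2 = e at h
    cases h1 : (s.mod 4096).blt 256
    · rw [h1, cond_false] at h
      have hc := ht.get ((s.mod 4096).sub 256)
      generalize t.get ((s.mod 4096).sub 256) = d at h hc
      obtain ⟨x, y⟩ := d
      have key : Known w a b → Holds w (x.xor (x.land b), y.xor (y.land a)) :=
        fun hk => hk.unresolved hc
      dsimp only at h
      generalize x.xor (x.land b) = x' at h key
      generalize y.xor (y.land a) = y' at h key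
      cases h2 : y'.beq 0
      · rw [h2, cond_false] at h
        cases h3 : (x'.beq 0 && y'.beq (bit y'.log2))
        · rw [h3, cond_false] at h
          cases h
        · rw [h3, cond_true] at h
          obtain ⟨h4, h5⟩ := Bool.and_eq_true_iff.1 h3
          obtain rfl := Nat.eq_of_beq_eq_true h4
          have h5 := Nat.eq_of_beq_eq_true h5
          generalize y'.log2 = i at h5
          subst h5
          obtain ⟨i1, i2, i3⟩ := ih _ _ _ _ _ h
          refine ⟨i1, i2, fun hk => i3 fun hn => (hk hn).setFalse ?_⟩
          obtain ⟨e', ⟨h6, -⟩ | ⟨h6, h7⟩⟩ := key (hk hn)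
          · simp at h6
          · rwa [(testBit_bit _ _).1 h6]
      · rw [h2, cond_true] at h
        obtain rfl := Nat.eq_of_beq_eq_true h2
        cases h3 : x'.beq 0
        · rw [h3, cond_false] at h
          cases h4 : x'.beq (bit x'.log2)
          · rw [h4, cond_false] at h
            cases h
          · rw [h4, cond_true] at h
            have h5 := Nat.eq_of_beq_eq_true h4
            generalize x'.log2 = i at h h5
            subst h5
            obtain ⟨i1, i2, i3⟩ := ih _ _ _ _ _ h
            refine ⟨i1, i2, fun hk => i3 fun hn => (hk hn).setTrue hw ?_⟩
            obtain ⟨e', ⟨h6, h7⟩ | ⟨h6, -⟩⟩ := key (hk hn)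
            · rwa [(testBit_bit _ _).1 h6]
            · simp at h6
        · obtain rfl := Nat.eq_of_beq_eq_true h3
          rw [h3, cond_true] at h
          obtain rfl := Option.some.inj h
          refine ⟨fun _ => id, fun _ => id, fun hk => ?_⟩
          by_contra hn
          exact not_holds_zero (key (hk hn))
    · rw [h1, cond_true] at h
      cases h2 : ((s.mod 4096).mod 2).beq 0
      · rw [h2, cond_false] at h
        obtain ⟨i1, i2, i3⟩ := ih _ _ _ _ _ h
        refine ⟨i1, fun i hi => i2 i ((testBit_lor_bit _ _ _).2 (Or.inl hi)),
          fun hk => i3 fun hn => (hk hn).setTrue hw ?_⟩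
        by_contra he
        exact hn ⟨e, Or.inr ⟨i2 e ((testBit_lor_bit _ _ _).2 (Or.inr rfl)), he⟩⟩
      · rw [h2, cond_true] at h
        obtain ⟨i1, i2, i3⟩ := ih _ _ _ _ _ h
        refine ⟨fun i hi => i1 i ((testBit_lor_bit _ _ _).2 (Or.inl hi)), i2,
          fun hk => i3 fun hn => (hk hn).setFalse fun he => ?_⟩
        exact hn ⟨e, Or.inl ⟨i1 e ((testBit_lor_bit _ _ _).2 (Or.inr rfl)), he⟩⟩

/-- Perform the derivations in a list and look for the empty clause. -/
def refutes : List ℕ → Table → ℕ → Bool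
  | [], _, _ => false
  | s :: ss, t, k =>
    match derive t 500 s 0 0 0 0 with
    | none => false
    | some (p, q) =>
      force p fun p => force q fun q => (p.beq 0 && q.beq 0) ||
        force (k.add 1) fun k' => t.insert k (p, q) fun t => refutes ss t k'

theorem refutes_sound (hw : ∀ e, w e → ¬ w (swap e)) :
    ∀ (ss : List ℕ) (t : Table) (k : ℕ), t.Valid w → refutes ss t k ≠ true
  | [], _, _, _ => by simp [refutes]
  | s :: ss, t, k, ht => by
    rw [refutes]
    rcases hd : derive t 500 s 0 0 0 0 with _ | ⟨p, q⟩
    · simp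
    · have hc : Holds w (p, q) :=
        (derive_sound hw ht (p, q) _ _ _ _ _ _ hd).2.2 fun _ => by simp [Known]
      simp only [force_eq]
      intro h
      rcases Bool.or_eq_true_iff.1 h with h | h
      · obtain ⟨h1, h2⟩ := Bool.and_eq_true_iff.1 h
        rw [Nat.eq_of_beq_eq_true h1, Nat.eq_of_beq_eq_true h2] at hc
        exact not_holds_zero hc
      · exact ht.insert hc (fun t' ht' => refutes_sound hw ss t' _ ht') h

/-- Add the clauses of a list to a table, with indices starting from `k`, and then perform the
derivations `ss`. -/
def refutesFrom (ss : List ℕ) : List (ℕ × ℕ) → Table → ℕ → Bool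
  | [], t, k => refutes ss t k
  | (x, y) :: cs, t, k =>
    force x fun x => force y fun y => force (k.add 1) fun k' =>
      t.insert k (x, y) fun t => refutesFrom ss cs t k'

theorem refutesFrom_sound (hw : ∀ e, w e → ¬ w (swap e)) (ss : List ℕ) :
    ∀ (cs : List (ℕ × ℕ)) (t : Table) (k : ℕ), (∀ c ∈ cs, Holds w c) → t.Valid w →
      refutesFrom ss cs t k ≠ true
  | [], t, k, _, ht => refutes_sound hw ss t k ht
  | (x, y) :: cs, t, k, hcs, ht => by
    rw [refutesFrom]
    simp only [force_eq]
    exact ht.insert (hcs _ List.mem_cons_self) fun t' ht' =>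
      refutesFrom_sound hw ss cs t' _ (fun d hd => hcs d (List.mem_cons_of_mem _ hd)) ht'

/-- The mask of a list of atoms. -/
def mask : List ℕ → ℕ
  | [] => 0
  | e :: l => (mask l).lor (bit e)

theorem testBit_mask (l : List ℕ) (i : ℕ) : (mask l).testBit i = true ↔ i ∈ l := by
  induction l with
  | nil => simp [mask]
  | cons e l ih => rw [mask, testBit_lor_bit, ih, List.mem_cons, or_comm, eq_comm]

theorem holds_mask_pos {l : List ℕ} (h : ∃ e ∈ l, w e) : Holds w (mask l, 0) := by
  obtain ⟨e, he, hwe⟩ := h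
  exact ⟨e, Or.inl ⟨(testBit_mask l e).2 he, hwe⟩⟩

theorem holds_mask_neg {l : List ℕ} (h : ∃ e ∈ l, ¬ w e) : Holds w (0, mask l) := by
  obtain ⟨e, he, hwe⟩ := h
  exact ⟨e, Or.inr ⟨(testBit_mask l e).2 he, hwe⟩⟩

end Soundness

/-! ### Clauses about anti-directed paths -/

/-- The `k` lowest decimal digits, lowest first. -/
def digits : ℕ → ℕ → List ℕ
  | 0, _ => []
  | k + 1, c => (c % 10) :: digits k (c / 10)

/-- The base-100 digits, lowest first (at most `k` of them). -/
def atoms : ℕ → ℕ → List ℕ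
  | 0, _ => []
  | k + 1, c => bif c.beq 0 then [] else (c % 100) :: atoms k (c / 100)

/-- The atoms of the arcs that an anti-directed path through the given indices uses. -/
def pathAtoms : Bool → List ℕ → List ℕ
  | b, x :: y :: l => (bif b then 10 * x + y else 10 * y + x) :: pathAtoms (!b) (y :: l)
  | _, _ => []

/-- The 24 orderings of four indices. -/
def orders (a b c d : ℕ) : List (ℕ × ℕ × ℕ × ℕ) :=
  [(a, b, c, d), (b, a, c, d), (b, c, a, d), (b, c, d, a), (a, c, b, d), (c, a, b, d),
   (c, b, a, d), (c, b, d, a), (a, c, d, b), (c, a, d, b), (c, d, a, b), (c, d, b, a),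
   (a, b, d, c), (b, a, d, c), (b, d, a, c), (b, d, c, a), (a, d, b, c), (d, a, b, c),
   (d, b, a, c), (d, b, c, a), (a, d, c, b), (d, a, c, b), (d, c, a, b), (d, c, b, a)]

/-- The mask `m` meets the arcs of every anti-directed path on the indices `a, b, c, d`. -/
def meetsAll (m a b c d : ℕ) : Bool :=
  (orders a b c d).all fun (x, y, z, u) =>
    m.testBit (10 * x + y) || m.testBit (10 * z + y) || m.testBit (10 * z + u)

/-- The code `s` consists of four increasing indices below `n`, followed by a set of (at most 8)
arcs that meets all anti-directed paths on the four vertices. -/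
def validFour (n s : ℕ) : Bool :=
  match digits 4 s with
  | [a, b, c, d] => a.blt b && b.blt c && c.blt d && d.blt n &&
      meetsAll (mask (atoms 8 (s / 10000))) a b c d
  | _ => false

/-- The indices in `l` are distinct and less than `n`. -/
def validPath (n : ℕ) : List ℕ → Bool
  | [] => true
  | x :: l => x.blt n && l.all (fun y => !(x.beq y)) && validPath n l

theorem validPath_iff {n : ℕ} : ∀ {l : List ℕ}, validPath n l = true →
    l.Nodup ∧ ∀ x ∈ l, x < n
  | [], _ => by simp
  | x :: l, h => by
    simp only [validPath, Bool.and_eq_true, List.all_eq_true, Bool.not_eq_true'] at h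
    obtain ⟨⟨h1, h2⟩, h3⟩ := h
    obtain ⟨h4, h5⟩ := validPath_iff h3
    refine ⟨List.nodup_cons.2 ⟨fun hx => ?_, h4⟩, ?_⟩
    · have := h2 x hx
      simp at this
    · simpa using ⟨by simpa [Nat.blt_eq] using h1, h5⟩

/-- A complete certificate: the clauses `inits`, the codes of clauses about four vertices and of
hamiltonian anti-directed paths starting with `pre`, and the derivation of a contradiction. -/
def check (n : ℕ) (pre : List ℕ) (inits : List (List ℕ)) (fours paths steps : List ℕ) : Bool :=
  fours.all (validFour n) &&
  paths.all (fun s => validPath n (pre ++ digits (n - pre.length) s)) &&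
  refutesFrom steps
    (inits.map (fun l => (mask l, 0)) ++ fours.map (fun s => (mask (atoms 8 (s / 10000)), 0)) ++
      paths.map (fun s => (0, mask (pathAtoms true (pre ++ digits (n - pre.length) s)))))
    Table.nil 0

theorem length_digits (k s : ℕ) : (digits k s).length = k := by
  induction k generalizing s with
  | zero => rfl
  | succ k ih => simp [digits, ih]

theorem altPath_of_pathAtoms {A : V → V → Prop} {f : ℕ → V} :
    ∀ {b : Bool} {l : List ℕ}, (∀ x ∈ l, x < 10) →
      (∀ e ∈ pathAtoms b l, A (f (e / 10)) (f (e % 10))) → AltPath A b (l.map f)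
  | _, [], _, _ => trivial
  | _, [_], _, _ => trivial
  | b, x :: y :: l, hl, h => by
    have hx := hl x (by simp)
    have hy := hl y (by simp)
    refine ⟨?_, altPath_of_pathAtoms (fun z hz => hl z (List.mem_cons_of_mem _ hz))
      fun e he => h e (by rw [pathAtoms]; exact List.mem_cons_of_mem _ he)⟩
    have := h (bif b then 10 * x + y else 10 * y + x) (by rw [pathAtoms]; exact List.mem_cons_self)
    cases b
    · simpa [show (10 * y + x) / 10 = y by lia, show (10 * y + x) % 10 = x by lia] using this
    · simpa [show (10 * x + y) / 10 = x by lia, show (10 * x + y) % 10 = y by lia] using this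

theorem lt_of_mem_atoms {e : ℕ} : ∀ {k c : ℕ}, e ∈ atoms k c → e < 100
  | 0, _, h => by simp [atoms] at h
  | k + 1, c, h => by
    rw [atoms] at h
    cases h0 : c.beq 0
    · rw [h0, cond_false, List.mem_cons] at h
      rcases h with rfl | h
      · exact Nat.mod_lt _ (by norm_num)
      · exact lt_of_mem_atoms h
    · simp [h0] at h

theorem lt_of_mem_pathAtoms {e : ℕ} :
    ∀ {b : Bool} {l : List ℕ}, (∀ x ∈ l, x < 10) → e ∈ pathAtoms b l → e < 100
  | _, [], _, h => by simp [pathAtoms] at h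
  | _, [_], _, h => by simp [pathAtoms] at h
  | b, x :: y :: l, hl, h => by
    have hx := hl x (by simp)
    have hy := hl y (by simp)
    rw [pathAtoms, List.mem_cons] at h
    rcases h with rfl | h
    · cases b
      · simpa using show 10 * y + x < 100 by lia
      · simpa using show 10 * x + y < 100 by lia
    · exact lt_of_mem_pathAtoms (fun z hz => hl z (List.mem_cons_of_mem _ hz)) h

theorem mem_orders_lt {n a b c d : ℕ} (hab : a < b) (hbc : b < c) (hcd : c < d) (hd : d < n)
    {q : ℕ × ℕ × ℕ × ℕ} (hq : q ∈ orders a b c d) :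
    q.1 < n ∧ q.2.1 < n ∧ q.2.2.1 < n ∧ q.2.2.2 < n := by
  simp only [orders, List.mem_cons, List.not_mem_nil, or_false] at hq
  rcases hq with rfl | rfl | rfl | rfl | rfl | rfl | rfl | rfl | rfl | rfl | rfl | rfl | rfl | rfl |
    rfl | rfl | rfl | rfl | rfl | rfl | rfl | rfl | rfl | rfl <;>
  refine ⟨?_, ?_, ?_, ?_⟩ <;> dsimp only <;> lia

theorem check_sound {n : ℕ} {pre : List ℕ} {inits : List (List ℕ)} {fours paths steps : List ℕ}
    (hcheck : check n pre inits fours paths steps = true) (hn : n ≤ 10) (hpre : pre.length ≤ n)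
    {A : V → V → Prop} (hA : Oriented A) {f : ℕ → V}
    (hfour : ∀ a b c d, a < b → b < c → c < d → d < n → ∃ q ∈ orders a b c d,
      A (f q.1) (f q.2.1) ∧ A (f q.2.2.1) (f q.2.1) ∧ A (f q.2.2.1) (f q.2.2.2))
    (hinit : ∀ l ∈ inits, ∃ e ∈ l, e < 100 ∧ A (f (e / 10)) (f (e % 10))) :
    ∃ p : List ℕ, p.Nodup ∧ p.length = n ∧ (∀ x ∈ p, x < n) ∧ pre <+: p ∧
      AltPath A true (p.map f) := by
  by_contra hno
  obtain ⟨h12, h3⟩ := Bool.and_eq_true_iff.1 hcheck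
  obtain ⟨h1, h2⟩ := Bool.and_eq_true_iff.1 h12
  rw [List.all_eq_true] at h1 h2
  refine refutesFrom_sound (w := fun e => e < 100 ∧ A (f (e / 10)) (f (e % 10))) ?_ steps _
    Table.nil 0 ?_ trivial h3
  · rintro e ⟨he, h⟩ ⟨-, h'⟩
    rw [show swap e = e % 10 * 10 + e / 10 from rfl,
      show (e % 10 * 10 + e / 10) / 10 = e % 10 by lia,
      show (e % 10 * 10 + e / 10) % 10 = e / 10 by lia] at h'
    exact hA _ _ h h'
  · have arc {x y : ℕ} (hx : x < n) (hy : y < n) (h : A (f x) (f y)) :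
        10 * x + y < 100 ∧ A (f ((10 * x + y) / 10)) (f ((10 * x + y) % 10)) := by
      refine ⟨by lia, ?_⟩
      rwa [show (10 * x + y) / 10 = x by lia, show (10 * x + y) % 10 = y by lia]
    intro c hc
    rw [List.mem_append, List.mem_append, List.mem_map, List.mem_map, List.mem_map] at hc
    rcases hc with (⟨l, hl, rfl⟩ | ⟨s, hs, rfl⟩) | ⟨s, hs, rfl⟩
    · exact holds_mask_pos (hinit l hl)
    · refine holds_mask_pos ?_
      have hv := h1 s hs
      simp only [validFour, digits] at hv
      generalize s % 10 = a at hv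
      generalize s / 10 % 10 = b at hv
      generalize s / 10 / 10 % 10 = c at hv
      generalize s / 10 / 10 / 10 % 10 = d at hv
      simp only [Bool.and_eq_true, Nat.blt_eq, meetsAll, List.all_eq_true] at hv
      obtain ⟨⟨⟨⟨hab, hbc⟩, hcd⟩, hdn⟩, hm⟩ := hv
      obtain ⟨q, hq, q1, q2, q3⟩ := hfour a b c d hab hbc hcd hdn
      obtain ⟨l1, l2, l3, l4⟩ := mem_orders_lt hab hbc hcd hdn hq
      have := hm q hq
      simp only [Bool.or_eq_true, testBit_mask] at this
      rcases this with (h | h) | h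
      exacts [⟨_, h, arc l1 l2 q1⟩, ⟨_, h, arc l3 l2 q2⟩, ⟨_, h, arc l3 l4 q3⟩]
    · obtain ⟨hnd, hlt⟩ := validPath_iff (h2 s hs)
      have hlt' : ∀ x ∈ pre ++ digits (n - pre.length) s, x < 10 :=
        fun x hx => (hlt x hx).trans_le hn
      refine holds_mask_neg ?_
      by_contra hall
      push Not at hall
      refine hno ⟨_, hnd, by simp [length_digits, hpre], hlt, List.prefix_append _ _,
        altPath_of_pathAtoms hlt' fun e he => ?_⟩
      exact (hall e he).2

/-! ### The certificates -/

/-- The four-vertex clauses of the certificate on six vertices. -/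
def sixFours : List ℕ :=
  [5453454335345432, 5150451005045410, 545345433225245432, 545043353005045430, 5443423225245432,
   5453433531155431, 5452454335245432, 5350453005045430, 535135312513125321, 434032302404034320,
   5441401005045410, 545145401005045410, 4341343224134321, 434032242004034320, 545345433532245432,
   4341311410044310, 4340343224034320, 5250452005045420, 535245433532245432, 535145433531145431,
   544340353405045430, 534540343005045430, 5045403404035430, 535045433534045430,
   545045433534035430, 434134311004034310, 535235322005035320, 5450454005045410,
   545345433432255432, 5445434034045430, 5352322520055320, 5345433432245432, 5345433430045430,
   5150351005035310, 514540141005045410, 535032302505035320, 545343403534055430,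
   545343403430055430, 545345433005045430, 5350353225035320, 5443403534035430, 535250323025055320,
   5352453225245432, 412420121004024210, 545343423432255432, 5443403005045430, 434031141004034310,
   533230252005025320, 5032252003025320, 4140341004034310, 5453454034055430, 5453433532255432,
   5453433530055430, 545043403505045430, 545041151005045410, 5450454335045430, 512520121005025210]

/-- The hamiltonian paths of the certificate on six vertices. -/
def sixPaths : List ℕ :=
  [45132, 120453, 421035, 453210, 530412, 423510, 321504, 102453, 103245, 430215, 123504, 254130,
   524310, 120543, 102543, 435012, 35412, 45213, 301254, 43512, 325410, 401235, 501243, 501234,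
   401253, 125304, 254310, 451203, 534210, 321405, 421053, 43215, 534012, 321045, 543210, 324510,
   41235, 321054, 451032, 125403, 251403, 51234, 435210, 53214, 521304, 124503, 301425, 521043,
   21543, 514203, 123405]

/-- The derivations of the certificate on six vertices. -/
def sixSteps : List ℕ :=
  [408206277717012803631, 412817960986124431403, 373618625568481415277, 407053351950791782491,
   418582567271738150981, 1048597, 372465703927073321031, 381689080361739399211,
   395524422641314336829, 400136106735327965287, 402441961769778843757,
   5901314819224789535988678662, 1052697, 411665333944978927703, 367854598178776469611,
   370160441115797794919, 1270745501096582133620744, 5224316385611064674009260040, 1056833,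
   1294357327318480570138632, 378230314610599415871, 383995205670899232831,
   5495115743834837496128110598, 404748086254003212391, 409359476710665687101,
   1365207818172096298778634, 5669201080308340794872340488, 389759543812242477125,
   390912465320993140823, 396677354247147507761, 1407709116517648563380230,
   5804662167485084610855116810, 398983197255991865415, 1421876215966532712472624,
   401288758859317661705, 5920719046155700676342095876, 413971458360449871955,
   417429642744145727593, 29692730105601259542563847546452778389276473884773,
   114895593204811063959652991928110019051804343360974917,
   34351556566126986223252827056696105025674538291303, 2172737566858339446715545868743687951921220,
   141083727988563022881381270449460740041102331228275765718288012195303524,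
   1715460552415519575569439717188739518599237, 8052153756968431309778174751637503413015973974,
   115262066145106427104607903233317585760799680012669033,
   28140152867457613742145679336935175958380111216727, 1965857850825223061585670633550612489719876,
   33712238731946263112063047539927542708951457386597, 84405730557420689637097055715610673,
   119444781686407676047293930753413189, 8364282490040360578227580901405715553053581421,
   29784520185260979164127555088764641872906847191126,
   8565555506483176754762508113620484025963950181,
   30606569960875591151494483234970862379656108404843,
   5800186945048687043348737046105471059598090327,
   522692126643686964681778715966454651579933592144163741802,
   7271584130820802314875023650785607946716160086, 29144138399834,
   499702823813005991615460542017105109615373445599944970347,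
   2118433305786248031876358425945052090150993,
   35814100010391065059431002855595604575780421423106886258053097996337,
   27043915010488279832915561488224446611145135398992,
   43233337250392785729437255946173688612302089089086758094903522774623364061276829663338,
   33285653815896381581365816236051649183337729584729586834965951152196, 1765463,
   447605829076377894293264258000585266034336614325361750097,
   2194649897505093844800133079656396241678346, 101928148665249097103296856977309803,
   1486850637870714777532670892503802183688203, 24214753086455116404703698197520929851696182718534,
   1638832489650305425662424736261678350411033533449063039827976,
   100632529305282779815057308966195209, 7350218832,
   125741213721397274958002153383907328919261043606499398,
   42556400661434020969359912483508290789448407416901836437800929468499,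
   31812464815423779053009327534050960475940427273682615353910761287751, 1464415653349823822409778,
   1469138019832694323261500, 1818729, 415177015691390468159, 1822727, 110086959914537051,
   5360013960140587501855957040, 5514756477729733427523739688, 1247186795137821115674654,
   445149328349557682204, 420943607008363028931]

set_option maxRecDepth 100000 in
theorem check_six : check 6 [] [[1], [21], [23]]
    sixFours sixPaths sixSteps = true := by
  decide +kernel

/-- The four-vertex clauses of the certificate on eight vertices. -/
def eightFours : List ℕ :=
  [767065605707067650, 656054464006056540, 7675676557567651, 757157511007057510, 7157511510057510,
   7675676056077650, 7670676007067640, 767567655754467654, 7574544740077540, 7170571007057510,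
   767567655447467654, 656056544006056540, 7665605007067650, 767167611007067610,
   716760161007067610, 767061171007067610, 757151501510077510, 7567655650067650,
   767062272007067620, 757067655756067650, 7671611710077610, 757457544007057540, 6564544640066540,
   7054474005047540, 757051171007057510, 656156511510066510, 6560565446056540, 757054474007057540,
   7670676557067650, 7570575447057540, 7570675007067650, 767565605650077650, 7170671007067610,
   7675655750077650, 767567655654477654, 7661601007067610, 757165615756157651, 7567655654467654,
   757354534735347543, 7470674007067640, 6160561006056510, 767065575007067650, 6460564006056540,
   767565605756077650, 757067655750067650, 6551501006056510, 757467655754467654, 7675706757077650,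
   7675655754477654, 614640141006046410, 7067605606057650, 734740343007047430, 767570656057077650,
   5441401005045410, 756760565007067650, 767565645654477654, 767567655650077650,
   757052272007057520, 757054504705047540, 7571511710077510, 755450474007047540,
   656054504606056540]

/-- The hamiltonian paths of the certificate on eight vertices. -/
def eightPaths : List ℕ :=
  [54321067, 75601234, 60123475, 12340576, 5671234, 7123456, 67123405, 75061234, 54321706,
   67035412, 12370456, 54321607, 7543216, 5123476, 54673210, 32104675, 32104765, 60123457,
   34762510, 12346705, 67543210, 76543210, 54321076, 67321054, 12340765, 6123457, 12345706,
   32105467, 64321075, 12370654, 76105432, 6543217, 65073214, 12346507, 5761234, 12347605,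
   65071234, 6715432, 6751234, 7651234, 12340675, 12347506, 54320617, 65743210, 75643210, 56473210,
   12345607, 65701234, 47653210, 76051234, 70123456, 12340567, 54327610, 70123465]

/-- The derivations of the certificate on eight vertices. -/
def eightSteps : List ℕ :=
  [7080678655795389248959606827, 6519737050123739747793956907, 1048597,
   6539079812494943967146176627, 6558422625608778034277093489, 6790536436021563556272074867,
   1421869302942204579332106, 7216078234585650768197824643, 6693822439644571997309022299,
   5359749182407246246618193934, 5533834477367693943333052428, 7100021471214503237576224811,
   6829222110682065509416267823, 6597108297967951709181743207, 7274106673927152968583729265,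
   5998061982867893059999285256, 1483260063276248416165896, 7254763948447738150347370619,
   6423027778415690044502552659, 5514491687317355829919801354, 7003312157999035266749362263,
   1251864115187984401293322, 5301720745371589254838280204, 6403689807558103365543579769,
   6287623484189134460411048051, 7022655105986105825361948787, 6326313833892022269965299799,
   6674489191198223945772888199, 7158050074311674338616602711, 6809884161750823712384888923,
   6577765680896645462340513943, 6364999460134329162821603429, 5321063546953955512168800268,
   6268280671075307403438248023, 1060933, 6635808288490253001232576603,
   6771203256767388782258671769, 7138711984717524609490456717, 1065069,
   6172317338381097271755317256, 6655155825123772987704111235, 6964640834945108708549603359,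
   6500399151961001091970494599, 7177402332157913669288005739, 5340406371598693612365340684,
   1275475947604119535017994, 6248956749733257585002336409, 6384342273277997653237928059,
   6945283853579185452862722191, 1511594273999538847096846, 6713170096213174452967018609,
   5108292611927404202946519050, 9617562351071442696023581524546937215139292867386111414782980237,
   38008031845827518469398130129918476478592714326129,
   9103649718167218652362353295815812680737853585079649767015395471,
   31393478286613036014448860995075939946382964756506967669320725356684,
   10526029753918621415737358546344567657085244723408342369217823391695482627606261890,
   1902525936114264257569070896494345031949014927142463405117587,
   34993818163968223775886190976614144169915340869763,
   31245798728127346108952548577470711921676250566768,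
   41397888433130475608280079911231216851853258189222067584506029232269,
   1546740348403969843655287243171553159352421, 2205435246656004663604396212582399133438065,
   35082240488009341174254051391565492554453207306340,
   456826629431983646027974047843336916860246374754449707023,
   37274715962385269727953678100734423797317910499477,
   9100337783262178106190688708069216994145132684,
   10620574099000991002999591466766364301889682059669256400370503694,
   28051284463236848266259093375086166431034837143665,
   34899998738401104212047849852561908583187426066585,
   34899998645789802046906547563063888157293093646448,
   24488874222289276562497973917240052927576937160719,
   32524389707628238759016557040856357197623002075250, 1475980205810629928505573725755467356463217,
   136217531154384571531211940926600952390621740787064962,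
   109662139064701934760575275138456908689202999718338672, 127257620754555014,
   2241517007643900711794708051934194650011765000846892797059187,
   2297977481847862916396278182215565110198414,
   37528496845960332294483652349845317664392646361915975943278196165757179486335477977228,
   44028175851604688381513230009493225593248561351961460688870149914745,
   8127196309497362187256520227434795401742285658672826706358263920,
   547203076562478140428620056799942348832502443972049207411,
   160172093952699455503291263512047393614152151801094264,
   32707991666829182255700489212077762186233684516978,
   169134184130477780130796803695919883051408853907753536931037894549713046, 1892467,
   114578186932379661, 41923859203616686402072081650123014833149348250470842565927360798841,
   125365424020804757546070496882502826320107398836527224, 32031077621890,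
   125362775829362757257652232290068568432490009625419896,
   36454093440054104442354603982582779271070586036238, 113733762002276487, 1921165,
   1813688561369944529129603, 1365278247176596352754135]

set_option maxRecDepth 100000 in
theorem check_eight : check 8 [] [[1], [21], [23], [43], [45]]
    eightFours eightPaths eightSteps = true := by
  decide +kernel

/-- The four-vertex clauses of the certificate on nine vertices. -/
def nineFours : List ℕ :=
  [8581585118158521, 8331301813018310, 8482422821188421, 8681615818158651, 868268622118168621,
   8553513118158531, 656451464516146541, 747243423724237432, 7473433731177431, 6552512116156521,
   706762272606027620, 7170671716017610, 868168611008068610, 828128211008028210,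
   878670686708068760, 747170471704017410, 434131301413044310, 8684686146188641,
   858382583825238532, 7471674117167641, 8784744843388743, 8664634338368643, 757150171507017510,
   7471474337147431, 8773723837238732, 705751171505017510, 8781715818158751, 706761171606017610,
   8258522521158521, 868568655008068650, 727021171007027210, 7257524525247542, 838258523528238532,
   8258522520058520, 8783733831188731, 656150161506016510, 8442412118148421, 8551501815018510,
   868464634643388643, 826861262118168621, 646243423624236432, 515025211510025210,
   8168611610068610, 5143353114135431, 8681613818138631, 835851353118158531, 878372383728238732,
   838230282308028320, 717067611710067610, 848258454225248542, 8682686558268652,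
   656151501510066510, 424124211004024210, 6462423626236432, 747167644741167641, 7470674746047640,
   858158511008058510, 656252512521166521, 866561585118158651, 8685655850088650,
   737037302723027320, 747142272117147421, 8785755851188751, 727147422721147421, 7271672117167621,
   656152262116156521, 8685655852288652, 8771701008078710, 8664624846248642, 848243423824238432,
   8552512118158521, 877573585338358753, 8281482118148421, 8771701817018710, 8248422420048420,
   6563533631166531, 848148411008048410, 8381383118138631, 747167464116147641, 878373713731188731,
   8482484338248432, 7571575015077510, 878175715818178751, 7551501715017510, 7170571715017510,
   525125211005025210, 878475745847458754, 8258523525238532, 826863383626238632, 7473433730077430,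
   858258512118158521, 723731232117137321, 868163383118168631, 8683633830088630,
   878671686718168761, 848140181408018410, 5250252115025210, 8365585336358653, 878374484338378743,
   6562523626236532, 757167655751167651, 7571675117167651, 5150451514015410, 727167622721167621,
   878570585708058750, 8673676338368763, 8584585045088540, 747157514517147541, 7257522521157521,
   8783733830088730, 868262602620088620, 8782722821188721, 878575725752288752, 8482484124188421,
   7467644643367643, 7372573735237532, 7472422721177421, 8782726828268762, 603631161303016310,
   5352353123155321, 747157454115147541, 868468644338368643, 757450474507047540,
   848248433828238432, 8581511810088510, 8685655853388653, 7470474117047410, 858150181508018510,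
   8581514818148541, 746763464337367643, 525145422521145421, 858482584825248542,
   745753454337357543, 8674676448468764, 7271472117147421, 868581656158188651, 757153373117157531,
   656450464506046540, 7271211710077210, 8281382118138321, 7572522721177521, 757252512521177521,
   716765511716157651, 7574575145177541, 7270272117027210, 6561511610066510, 6562522621166521,
   824841242118148421, 7270672726027620, 868362383628238632, 8268622621168621, 8681686558168651,
   878571585718158751, 8775735338378753, 6451454116146541, 845851454118158541, 747140171407017410,
   6260262116026210, 8483433830088430, 877571585118158751, 757157514745147541, 7470474337047430,
   7165575116157651, 823831232118138321, 8782723828238732, 878173383118178731, 7571511710077510,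
   7552512117157521, 636230262306026320, 868468655848458654, 7267622621167621, 8774714118178741,
   6553513116156531, 844341383118138431, 8681686118168621, 757367575336357653, 878573585738358753,
   6561514616146541, 757057502725027520, 8371373118138731, 878274724827248742, 8158514515148541,
   8665635338368653, 858250282508028520, 7574575045077540, 8671676118168761, 535135311005035310,
   6553523635236532, 636046433630046430, 523531232115135321, 878173383118138731,
   868268612118168621, 8663623836238632, 7473674337367643, 5251452115145421, 4331301413014310,
   747167614617147641, 868168622118168621, 757267655752267652, 535145433531145431,
   8281582118158521, 846863464338368643, 8483684338368643, 858151501510088510, 828158522821158521,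
   646346413116146431, 8672676228268762, 757451474517147541, 8268623626238632, 8663613836138631,
   7265575226257652, 8281211810088210, 6246422421146421, 717027211710027210, 8775705857058750,
   848248422118148421, 7367633630067630, 655351353116136531, 8661601816018610, 727157522721157521,
   878371383718138731, 838238312821188321, 8682622821188621, 5245422420045420, 8781711810088710,
   737157535135157531, 6443413116146431, 626126211006026210, 858450484508048540, 8775745857458754,
   656352363526236532, 8483433831188431, 313023211310023210, 8571575118158751, 858258522118158521,
   8382383123188321, 8482423828238432, 877472484228248742, 8441401814018410, 868168655818158651,
   8774704847048740, 825853383525238532, 878172282118178721, 878571511817158751,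
   878175585118178751, 8381583118158531, 8481584845148541, 845853454338358543, 848242412421188421,
   7471674746147641, 7372673736237632, 858351383518138531, 7164474116147641, 8772712118178721,
   757257512117157521, 757257522117157521, 878371383118138731, 828138282318138321,
   8665625228268652, 8774724228278742, 535045433530045430, 7471574745147541, 8248422421148421,
   7451454117147541, 6362363023066320, 877371383118138731, 8581585338158531, 878571585118158751,
   8773713837138731, 878273723827238732, 8775715118178751, 7267623626237632, 7570575117057510,
   8684644842288642, 8468644643368643, 848158514518148541, 727127211007027210, 7170371713017310,
   878474734743388743, 4341311410044310, 745751454117157541, 6551501615016510, 868262612621188621,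
   8785755853388753, 878170181708018710, 757067655750067650, 5145411410045410, 858158511510088510,
   878270282708028720, 848158514518158541, 858268655852268652, 878272702720088720,
   8775715857158751, 623631232116136321, 868162282118168621, 848281424128188421,
   848248422008048420, 8781713818138731, 656353513531166531, 5245422421145421, 747143373117147431,
   848158454118148541, 878370383708038730, 757057501715017510, 8685816858188651,
   434230242304024320, 5250352523025320, 8382383023088320, 8784744842288742, 8774734338378743,
   5135311310035310, 434130141304014310, 646142262116146421, 656350363506036530, 8785755850088750,
   868165585118168651, 8582522821188521, 6462464336246432, 8158511510058510, 8684645848458654,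
   8581513818138531, 8382683836238632, 8665615118168651, 504541151404015410, 8773713118178731,
   8165585116158651, 858451484518148541, 524541242115145421, 7571575227157521, 6553513635136531,
   878272712721188721, 8584585145188541, 8481684118168641, 8483584338358543, 838281382321188321,
   8784745848458754, 8451454118148541, 848240282408028420, 858252512521188521, 8481413818138431,
   848158454115148541, 8781716818168761, 8682686126188621, 716764474616147641, 8662612118168621,
   868160181608018610, 868165615816158651, 8443413118148431, 878474714741188741, 7371673117167631,
   8381683118168631, 725753373525237532, 747143413717147431, 515045411510045410, 7157514515147541,
   8482584845248542, 6463433630066430, 8685655851188651, 848142282118148421, 8281682118168621,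
   8382583835238532, 8452454228248542, 8581685118168651, 868465645846458654, 8774724847248742,
   757151501510077510, 8684826848288642, 8581585015088510, 866563585338358653, 7167611610067610,
   868268612821188621, 8781714818148741, 878373703730088730, 8148411410048410, 8663613118168631,
   7143373114137431, 868265585228268652, 8265585226258652, 8682622820088620, 7470574745047540,
   825851252118158521, 8681611810088610, 8684644843388643, 878171701710088710, 757353503735077530,
   5352353023055320]

/-- The hamiltonian paths of the certificate on nine vertices. -/
def ninePaths : List ℕ :=
  [68245317, 27548316, 28145673, 71643285, 32567841, 78623451, 12467853, 15823476, 74326185,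
   76851234, 75861432, 41687532, 12837654, 28345671, 42367581, 84327615, 34687512, 75123486,
   52367841, 48567312, 76123485, 34287615, 17568432, 25186473, 54286317, 46782513, 81345672,
   48763512, 26547813, 54271863, 15768234, 17284653, 64275183, 12765483, 12684753, 82345716,
   16758432, 83124756, 78423156, 34128576, 54328671, 12687354, 47321586, 27548361, 68271435,
   81543276, 14327685, 78613452, 34567812, 85347216, 24568173, 48761532, 84563217, 24567381,
   24518673, 48127653, 42358176, 34867512, 61823475, 42817653, 68713254, 76853214, 48763215,
   54271386, 41867235, 85162734, 42387651, 62345871, 85743216, 85172634, 64372815, 12837456,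
   56813247, 81567234, 48321657, 82346175, 46751283, 61785432, 27418356, 28465713, 53784261,
   54372861, 58764132, 64321857, 71823456, 28736154, 78543162, 71623485, 48721356, 48721653,
   86123457, 56843271, 26471583, 76158432, 76143285, 86723451, 16783425, 62348571, 34257681,
   56471283, 81623457, 38415627, 75861234, 12357684, 81765432, 46758312, 85324716, 62175483,
   84372651, 28765413, 12387456, 13782654, 13782456, 57486213, 24318576, 86513427, 28765314,
   54321876, 28731654, 42167835, 68243715, 48123657, 34285671, 28731456, 34562871, 24367815,
   41562873, 12745683, 34152876, 12687453, 86751432, 83165724, 63172854, 17286354, 82173456,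
   12345678, 34768512, 83574216, 48751236, 54327861, 76853241, 76158234, 76543182, 74328156,
   68571234, 75816234, 26785134, 85167234, 46582713, 34865172, 46781235, 31567842, 17568234,
   32416875, 81327654, 46758132, 17542683, 57486132, 12687534, 72346185, 42538671, 51682734,
   46123857, 68275431, 34851276, 78623415, 57123846, 46587312, 54328176, 76341285, 54318672,
   83561724, 12475683, 34587261, 47568213, 24538176, 86543712, 47328156, 75324861, 78346215,
   46721583, 32864175, 61543827, 85342716, 82347651, 85123476, 75843261, 68341527, 83547612,
   27345186, 24187653, 27138654, 42186375, 13865724, 85167432, 85321476, 42138657, 32175684,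
   47128653, 76514283, 78621354, 32714685, 27543186, 76538142, 68271354, 76248513, 61823754,
   28765134, 68271534, 13765824, 16782435, 28745316, 12783456, 57413286, 48321675, 12367854,
   15836427, 78631254, 32157846, 76243185, 61542837, 32765481, 84321756, 82167453, 34158627,
   32418576, 57286134, 68713425, 83561427, 56487312, 48716235, 32167584, 63821754, 15324876,
   83172654, 56781234, 42137685, 46271583, 34267815, 76823415, 28613457, 86751234, 28617354,
   32817654, 34572861, 38614725, 17286435, 24567183, 51687234, 32184675, 63851247, 28761354,
   12835476, 62347815, 38615427, 28735461, 76413285, 24567813, 12768534, 64582713, 27138456,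
   56843712, 46321875, 28645713, 32467185, 76518432, 34561827, 28716435, 86542713, 82173654,
   62531847, 28615437, 78245613, 13862754, 12835674, 24638517, 18635427, 86743215, 85374216,
   62347581, 32164875, 76541283, 32471586, 27486153, 46758213, 51768234, 46785213, 82341756,
   81365742, 86743512, 18762435, 42157683, 25348176, 56782431, 51867234, 27546183, 12547683,
   68471235, 57283461, 83561247, 56784231, 57483216, 78421653, 61782453, 32548671, 54867312,
   15287634, 17543286, 26785431, 12375486, 56817234, 71865432, 31572846, 73642581, 74321586,
   84325671, 42158673, 24316875, 34617825, 64328517, 76815432, 57481263, 56421873, 35174862,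
   61784235, 42187653, 61758234, 78416235, 86715432, 32487615, 34267185, 32851746, 41328576,
   12375684, 85174632, 86571432, 28417653, 76843512, 28467315, 68471532, 76843251, 24518376,
   17283456, 51324876, 85123647, 74538216, 78321456, 28715634, 48761235, 78345612, 34287651,
   76851432, 64327815, 75823461, 81562734, 32167854, 56718234, 16785432, 12487653, 56784213,
   34516827, 28614753, 13642875, 56137842, 76823451, 42357861, 28567134, 28713456, 42367185,
   83765412, 12348657, 86574213, 76418532, 76523841, 28715436, 47123586, 16782453, 28716354,
   34851672, 75843216, 42367815, 63174825, 24138576, 32684715, 28345176, 64328175, 32487651,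
   76821435, 47126385, 76548231, 82175463, 26718354, 32185647, 48623715, 78345216, 48621753,
   76815234, 15782463, 27165384, 81765234, 83145672, 78643215, 46783215, 46571283, 82345671,
   48123675, 85123674, 76145382, 32514876, 81645732, 68543712, 25867413, 48765213, 86543217,
   48623175, 54326871, 12738456, 12348675, 32567184, 68723451, 46738512, 46718253, 54287361,
   24157863, 56783241, 86571234, 64328157, 32814756, 48172653, 83172456, 71843256, 48753216,
   27386415, 14328675, 12384756, 16348527, 78324156, 32418675, 42167385, 76548312, 63784215,
   15836247, 12863457, 32614875, 12865437, 48765132, 34286157, 76543281, 76328451, 78615234,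
   76183425, 32768154, 12845673, 47538216, 48321576, 48621375, 42165873, 78516234, 56321847,
   54386217, 28415673, 42175386, 32174685, 12345876, 12386457, 64572813, 76418235, 86543271,
   54681237, 34782651, 26543817, 86514237, 32857641, 42681573, 12347685, 61823457, 58716234,
   26783451, 34287156, 28715463, 85761234, 48762513, 24587613, 27518634, 13682754, 12768354,
   32165847, 27186435, 34761285, 32157684, 32475681, 42683715, 85361742, 64782513, 84562713,
   76128453, 12543876, 24387651, 24571683, 84536217, 74358216, 25768134, 31782654, 27561384,
   28765431, 82317654, 31682754, 78543261, 48723516, 86517234, 68273451, 85267431, 28763451,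
   71345682, 52347681, 12387654, 41867532, 56723481, 32487156, 32417685, 76423185, 53784216,
   48125673, 34562817, 25863471, 85321674, 28615734, 31865427, 48765312, 54287613, 17265483,
   52348176, 34627815, 32467581, 76548132, 85174236, 13865427, 42837651, 76548213, 35174826,
   81567432, 28631754, 24516837, 48753261, 24387615, 32184657, 27548163, 81564273, 82345617,
   34275681, 34865712, 48271356, 32758146, 32158674, 28761534, 78243516, 32687154, 41768235,
   32764185, 68723415, 26471385, 76814235, 12485673, 46123875, 36752841, 58761234, 15286437,
   84321576, 32547861, 12348576, 48736215, 68543271, 32865741, 83546217, 83162754, 85761432,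
   12487635, 16782534, 32158647, 24358176, 46718235, 78615432, 28345617, 32845176, 32471685,
   34582671, 81573264, 76845312, 72345681, 68345712, 84321657, 68473215, 86321457, 81764235,
   27345681, 64321875, 61542873, 75342861, 32617854, 42736185, 12853476, 14562873, 16543827,
   25843671, 86123475, 47265813, 73542861, 54123876, 68743215, 25786134, 13867524, 31546827,
   76518234, 76421583, 12346875, 28745613, 34126875, 12346857, 26548173, 48321756, 56784132,
   34768215, 68751432, 28543671, 56124873, 68123457, 82137654, 41728653, 68342715, 56823147,
   76523481, 82345176, 34275186, 53786142, 15768432, 76813452, 48761253, 47128356, 12357846,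
   24587163, 15867432, 68543217, 68421573, 34821756, 32815647, 81324756, 17523486, 34517826,
   16823457, 72613485, 13542876, 81365247, 68345217, 48265713, 26548317, 85371246, 54326817,
   83542716, 15786432, 42517683, 68751234, 32814675, 34518627, 76128435, 27165483, 86541237,
   68731254, 32467815, 47125683, 24586173, 18762453, 26715483, 57486312, 17482653, 68123475,
   46831527, 83542617, 42157863, 34851726, 12843756, 34587612, 76342581, 78643512, 12738654,
   76843215, 48275613, 24317685, 85143276, 61857432, 32815476, 81723456, 32815746, 71682534,
   64327185, 46713285, 83127654, 76348512, 76483215, 85347612, 61584237, 26781435, 41823576,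
   42138675, 54381627, 56123847, 82165437, 31542876, 83567241, 46287315]

/-- The derivations of the certificate on nine vertices. -/
def nineSteps : List ℕ :=
  [81293162920372836349795331313669, 81530847653478674089097629397003,
   82323128797006823667398229979147, 82402357365536202206635773743109,
   84224604876750662415444825501699, 89770576347127302396962174218247,
   91592823952865185081780920119303, 94445037652173038590634515419145,
   95554232324033071504419742396423, 102130150488855651220517147660297,
   104190101641427550425652853592077, 98644130454369833664987206758403,
   98723339085130196735919764631565, 99674096907086407715800876322821,
   100783291144444908116082472611851, 101892485051394583014870790459401,
   102288625741085205758946688200715, 102763976492613882500905211006981,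
   103239345009528442896856002252809, 103556257414114687549067110264835,
   104031646430914394491141820428295, 107993034212640529818617786314763, 1048619,
   108864544977854979167885803515915, 109260589099963321030769113657355,
   109577617806873718500553130217485, 54197111780570074599503488962573,
   54830937732253137800792264273931, 54989297258169689591596303699981,
   55147850793188375597456243666949, 56256948377989678673826822123527,
   57445467534619541293045047775237, 57524598553119596043563950018573,
   57683171360069756999330355744773, 1545837200670430324736028, 60376927922249654512304108523529,
   63942176440377532540786097524741, 64734458065543245608286912065539,
   64892914107158303614923579215877, 67428118508553526477415187066887,
   68695885949497158567124951019527, 68854225386496698600281235615755, 1885847580683707292524574,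
   69725832020526149956538869305349, 69884288062145820775778883842055, 1923626513674625609850914,
   75350935543950457663473414918153, 76777138191467421306146372775949,
   77490095242289364068897661259789, 77569440127538287957798593933319,
   79312459074830398933677990244363, 79708600538998364003421791580171,
   80976134553493599062582225932301, 9329885211224570692248944672,
   81768416707717673678964540231689, 81926969751270133624720945582085,
   82006101199981685887007724056583, 83036066892205881361754950316039,
   84620726289907360500487639453705, 84858431078827544087935418765325,
   85016867669185701670145006784521, 86205289530780198902259727314951,
   87076818935006787381499800301571, 87156046814155996998748145709063,
   10122940422041122340161536004, 107438340908884916132644494184461,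
   58396224237177734997634493894665, 58871593797769896015539288305667,
   89532775850033274976751772110861, 90166601102831493376111803027469,
   90404285495975385628653360984079, 2613092024673894903513116, 91672033712349560984071185911817,
   93652660427558604210725185835017, 93969572661987470409330631921673,
   94365713890117809648053854547971, 94761854702666076846166794481675,
   96821786904369780914242275717135, 97059470962214120853105379782671,
   105140840706033411547048729350157, 106725403956330212310194772684807,
   97772602230568822127060903555083, 97851753040791564113217850093579,
   11670365547258121048169775132, 98406446892585004097948455555081,
   98802587681361147890776760512523, 99040155691746159442892588986383,
   99832457103671252377032515448845, 99911684434968273501377637560331,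
   100149447101378156021362567786501, 100624816081174571995298133209099,
   100862519278664185274163356315655, 101179316523600632842394010210317,
   102367854054812054212653665595399, 103001660012076161588164817383427,
   103635408904355912434024953999373, 103793961216184838471797885456389,
   12560134996622607304162951196, 104744602716646104348277195870221,
   104823830274757416424509442543629, 105616112249302150777756956373007,
   106170787452300835546049573842955, 106408491282776641153068970725385,
   106487622754981266475838408355851, 12792248758600868648607514660,
   107042200530734408372925713969163, 107279885041829080198599951249415,
   107755253464469307143806607872009, 108547554356777266556024952369163,
   108626860495034565584863351189515, 109102229493685837325902962520075,
   54514044840593602003079031713797, 55227078955887083728865552150539, 1418333294938275514023966,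
   5886864467738166316608061444, 56732317352987619024988245946381,
   57286933833354477619650287546379, 59505322360220447564336783110159,
   59980787345796648520958377177091, 60614613349485736600866373701645,
   61565254146441226907284415131663, 62278404785850994242929182224391,
   62595200689607668605435573809159, 62833001923450844605946517377033,
   63308350649019712952522192252931, 63862851984058369893731762876423,
   66160468696972035684081338699785, 66319020900184199188434985218051,
   66715181867852568312008551821323, 67745050765825484269831091367939,
   67824376138260711506698194513931, 67982735319599008287094496391179,
   69171138036542235183019169624079, 69567298475402374922372196773899,
   70438789472765351450091886940173, 70914177762464731286326942748685,
   71310299255722938731441944965127, 71468774923472361595039228981261,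
   71785784264015440313742025404421, 72102600228511742320445606989837,
   72261133924787025340606991061001, 72340265368316139710803243347979,
   72894881848821375908714341912585, 73291119356497308442840984211465,
   73370250800405774515361140011019, 73607915968636642236415380901901,
   74004153499862144357914787295239, 2036963309826447383945250, 75667847768886131037623516532749,
   76539454672127377786237553340421, 76856367350449432846480909266947,
   77173183262856769990443040796683, 79153887349297539601932233551879,
   80025397113298810078313845526537, 80580090965077231115878044954627,
   82085426076555762668711088074759, 82640022245910227957609002192905,
   82798402163012159054791723102219, 82956839126319688244018234732559,
   83194620327978760952339696529411, 83590760252809766039258393022469,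
   83669911927133354759609378803725, 9755427065134513987625500676,
   84303814598525287371255675383819, 84779105451460630854271779336203,
   84937542433676045692644635357191, 85492237064670322357384742301707,
   85729824814540280713131944669195, 86601334073160729006055428132877,
   86918343961403771734409496096773, 87393634965468694049421634514959,
   88186013909149017251546797641741, 109656826182723150977760202403843,
   61406874748677367163764746104835, 89057504354034323059613241061379,
   89295187783679392868042023317515, 89849805321994690270494223257609, 2570590729146117371609122,
   90008144891178948926964597141519, 90325058240368811379157908279309,
   91513595846910930971677172371469, 93177271675137636706631448408079,
   93256499743158444396572980678669, 93890441610199124876046859636749,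
   94207354279099511031380889202691, 94524247567483989915224900923397,
   94603475730032836824260546277379, 94682626544874182932091395051533,
   94841160217552554518038021058571, 94920407718173724561676920033293,
   95871048977865780387775899119619, 96425723467918550845216698683397,
   96742655479546745336986014445579, 99594849968408431106071288115211,
   101813257861808870908194686365707, 102922452136871377907996191641605,
   106329147068147555903594660409359, 97693296720462355879829407453193,
   98960946862676369917867932856323, 1069191, 99515620823614247949832374775821,
   100387054217663853859137340780559, 101258659647339976227586851811335,
   101417096733518950588823439470595, 3000326078522930407555104, 102446967128440508296583401009163,
   102843204626743234037963435405323, 103080792428605352666684910546951,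
   104427690505854455104281486962703, 104586126605024244642639956611085,
   104903155311890792263110667489293, 105536865036763786306266417451021,
   105774665987262684389161390329861, 105853873994802102520064242249735,
   107596893513405999772549652295683, 108230642330183270472686097747981,
   109022923303567845131063224741903, 53880122288110257629218594271243,
   54355569168230215428840379142153, 54672480878328787539669115531267,
   54910185648426417995962470494213, 58316976486312692142711878627335, 1508058267683772648595486,
   58950725250987075653951772225539, 59426171573757105189031606767625,
   59663856056496840718784335081479, 61486006404960928500418785996807,
   61802919735232443449367975333897, 62040623159245781620349680619533,
   6737948205536841349764161568, 63466826316930546510252196032515,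
   63625282708065288416586675859463, 63783739873635828066004005785613,
   64338220935688956008445862416401, 64576021475383407419001724506125,
   64655152951995661219087463723011, 65209827460783416822162891493385,
   65685117992710835912245302808585, 66239715649717969502012789403659,
   66794293973462760039902966304781, 7395603867534024049307033626, 7454468200358229361886904352,
   67903584957980330139663146315783, 70518036283847212253122520600589,
   70597265112406539586710308220939, 1914385847814102354059336, 72578046551136531893028923764747,
   73211870868924616548984933740551, 2008629109240242045591580, 73845715549674586272745409458179,
   74320968732364005742424682016773, 75192594312304094267607405932551,
   75826323838349120776090891677707, 8478801424973355705891438620,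
   77093955119195081477593546518535, 77410964488215319672196601999363,
   77648667662030836582741336043527, 77965483182421807106197883113485,
   78123921212956465975793845719053, 78282396342549802856136097157125,
   78599309549852993440208782946307, 79946188312496334245177122713613,
   80817698105080839721384008880141, 81213935626989642838775028805643, 2291971086950672843792412,
   2320305302740512922550302, 2348843570994609203150900, 2376973689271138696495132,
   84382945286513864376603703422987, 84462270928206991486059639205891,
   85096114503923191264564298117127, 85254552553407290503525331914761, 2424197367615582504189988,
   85809052977054565879461448339465, 85967528668508022230663064588301,
   86284538027902515409866287329287, 86839135146475715690269591891971,
   86997571354229949942942293995527, 87235256639984097532421662388227,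
   10161626172813591180541575198, 87948232726374776269726185779211,
   88265145376496401164870580006923, 10316368682335388706717974562,
   88661266393008880934480494669839, 107517685581725350003362041565189,
   54117787990239425492440404373511, 60139244398196442553626166292485,
   63070570354351295636387030921227, 89215980021903639627962817728521,
   89928936765716398818706072137743, 10548482412026212787303882782,
   90087469522228008814312755376135, 90245849415683534488019967586315,
   91038131064587911469985140387843, 91196568028024512133485388541963,
   91434349253004901304291180310531, 91830509403662367667934137004039,
   92147325316023577815453381554191, 92702018568082177151896328974343,
   93335824157040930856549189177353, 11148945477421411984967352332,
   95237223654342769407038436495369, 95475004879557178570717419122693,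
   95950354492775320437123478450181, 96267267138110011304628042444807,
   108785316815317648525224744972293, 54593156965213201216713678835721,
   97614164303840890544695023898637, 98168646347966333467484349870087,
   98327198499331612400843799998467, 99198709155927039538326902427653,
   99357165504408271002816315936777, 100307806150268795452788104638469,
   101020879546061454118108814299145, 101496229154777408789643577094155,
   102209379326656771429169074171911, 3024141970726480595001376, 105299180388667448721181205737487,
   106566830790507873272334503276551, 106804611793901358134196653682695,
   107676141883004865490901740417029, 55068545283223717005754536112131,
   55860922640007916942072907673607, 56573860584008234014648413130765,
   56653205228494869318034052812813, 57207705670994714331347623153677,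
   6158499682517934557685137410, 58079215458561685164580202409997,
   58158520968698153264703946747909, 58475433623693174545070373851145,
   58554681147911194927051760070667, 58713118111036509322942934708235,
   6389777608690538239913771040, 60852200447752182185590180605955, 6680755645820462358218481696,
   1635766225325617953751048, 61723691572591385895274828550153, 61882244611699310913429933674501,
   62357516872833448422738737172493, 62516088168463777432906928427021,
   63229026660300112823785909334031, 63704395106540624955134574227463,
   7144983160552477487202959388, 65526740111074556643781365755915,
   65605968273366263785214771023877, 65764347227167695768424360275979,
   66477381323380337853477822083087, 66635837667270700631087947255821,
   66873638188107998583724087291909, 67032075170300342603806256312331,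
   67111302638622120593902210191365, 67665822338863331100088894689293,
   7570525051362672577790500896, 68220420260479753532459754876931,
   68537410258179750341063039127557, 69012779237992293138191465336837,
   69329594408803651495989610983431, 69488167551129453642028035788809,
   70201200589534320112684643848201, 70676473936830103016204390551561,
   71231090412414577624850639556621, 71627327377059879376030271746059,
   71944143875149015316489602502665, 72023352085556552055123601707017,
   72498818412114163481107817951243, 8131466629353511294203109448, 2032240947285463893426202,
   8382923192916951721129934878, 75905629371944076533466521038855, 2084186978595244089753632,
   75984779355660443547989892059149, 76222542026711980731709085995017,
   76380920545991106217833528758285, 2164467204861178992009246, 77807105272281825848087053185029,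
   78044789788094239512729428946947, 78203168038376070434811686440969,
   78520081363703838253090607910925, 78837089844720889254426378973195,
   79629353014906051748742652252165, 79866959696736335628368978759693,
   9291199506571776511065579546, 80896906901066374609636921045007,
   81055479283071597561941902954509, 81451600752734139389744366505989,
   81847741565236277915209580171273, 82560717680191731962480102453251,
   82719269751267568009555814584333, 83273866888867429634457798479885,
   83432304839041139146377180655623, 83511551376410228277975552806921,
   83907672808258044198546223755277, 2372251334052077677658128, 9794112721344899527492124700,
   85413028221356153024956699111435, 86363669452643690181219405934607,
   10026226427970537152581779460, 86522125805932618393531204562947,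
   88423679049197841882867224915973, 88502926554541371646691996987403,
   55702447491568930211503083687941, 61327569479386262176117562077187,
   64813686624577180087581447311369, 2556627688922523359281198, 90721199052763698926895570923535,
   91355140409765723943770626740233, 91751281241203427795427506892807,
   92385009803829213852674021822473, 92860456149904426830334861422599,
   10974024293612466154661535748, 93018931841376321470090791251971,
   93573528978985407592379713843203, 93811213447707908835310429515779,
   11322194961948915796470284320, 96663427298198378380672335589379, 2787819567651160856920092,
   3071161573516786847072288, 106883743535081433320226675601413, 97455612204742131460035224096777,
   97534937104698601948698688901129, 97931077898472722953364402466827,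
   98247874491795197848241778028555, 1056855, 11652911627685590330261929986,
   98564825827471612634863067820045, 2868099816442378865311780, 99277840628091311482399633993739,
   99436316267333607360447084097551, 11960507716286508602774118428, 12018536236353349536100605988,
   100466282380141232594142783205387, 100703986224569693135010492198915, 2948841214690193259675718,
   1060955, 102684670930494511552955708542989, 103714655408414787819251373363213,
   12445967041468691032668512284, 103952398911606729570598177378309,
   104110757752565695699142987681805, 104269272894684895904377826963463,
   104665374563691870194669789245455, 106012253779783869018692209176587,
   106646116764327169471388460855303, 108151433491544231339160909729797,
   108705991962564118406291440209929, 108943715135729681451615472717829,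
   109181380280259902964690833731597, 109419045406134667259270444478479,
   109498273578260875332444808851471, 109736073338533135893355795968011,
   53800933368385347220625215270919, 53959351008024016282193699876867, 1385276740258359979245604,
   5772696517196501075682852910, 55306249118300821650267720249355,
   55385477256942711894670993690629, 55623219796603531941455794909191,
   56019360585753245951860354469897, 56415424031795669423105807355917,
   56890773682957596288593496027145, 56970021159761682355247743946765,
   57920797819117887990010525331463, 57999967953248132479038391758855,
   58237671769466951303618720526347, 58792287838927926113312228814857,
   6585146637072905238044942384, 60456157038809919857704745553925,
   60693841512000000938872335151111, 61248419335306525205245112561675,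
   6641234086921456005184258052, 61961472769410506518617869365253, 6815319478749829874254487580,
   62991458239034649880046065881097, 63387599051605971568013718523917,
   63545978015063099199730831454219, 6854005100365812677115863068,
   64258992777894725005302976417805, 64972084921300143872198626971661,
   65289055599922212848553050050569, 66002069328394102908108357136391,
   66398191119282479739252859252745, 67348929806303073583729346064387, 1852995084100709159936032,
   68299629061398713849142340833293, 7628554941079991348344610848,
   68378895909415817920992776794115, 69091930024635538001168865775629, 455725721265913873, 1065091,
   69408920064652330252727325716487, 69963439826300439750331628728329, 1900014688580002174435364,
   70835046314012607189250644283401, 71151862273617115046330168389635,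
   7997171973625700332207136776, 1352756240020184158461956, 8151915928899240900279083036,
   73687163459908742526349636399115, 74400216913092379586530307043339, 1319699674077146688544770,
   74637978790772528344998152409093, 74796454448937668579313242632203,
   74954794726765143546170699976713, 75588716731497814232211933753355, 2117243532715231818153988,
   76618702201164555173840428494859, 76935595489519051343578914164745,
   77331716954449977974655868596239, 2178838725514373189812256, 1357478606503191242629124,
   77886352801392782886349966708745, 8983603517133934257326145562,
   78916241523787608859118772826127, 79074658492574650818020768215047,
   78995527724334700434583787565061, 79391571837011012003715789271047,
   79470819323289788148227261485065, 79787751330241717256638467584011,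
   9177338604422587058688827396, 80263178329053514054342797602823,
   80421633695487762445672374202379, 81134707459755261569487981547529, 2287453267210640961085512,
   81372314585493848109214412992515, 82164596196287191882788539428879, 2297154610210548947722242,
   9445942089907012143100870688, 1052719, 9486570494922956301612081180,
   83749140113387401585116905074699, 84066072096811679001290616664077,
   84145300249729055139744797257739, 9834998898854998394496221210, 9910169597722059544291672100,
   85333742044575419678533983211525, 85888377862816226285855462543365,
   86046795492923700582927326031877, 86126023660267557043143320940549,
   86680562764708040170709480730635, 87789873096784071895275811246093,
   88027441527452787956464115724301, 88106707317567617378811602235407,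
   88344354196197537593548880916491, 10299410652753238304753999922,
   88740514356350481786985998020619, 88819723166761428811148901527567, 1366923339468930566619140,
   62119832394577426305281780510727, 1678267878330191099076640, 6894892806661651075554213918,
   88899067390877895271368393748485, 65843575385161404428797895839753,
   65922880899846089881164645134341, 10567825225140046854132736030,
   90642048271118444226767651139587, 90800465924690120118168810057731,
   90879732758661179812054151868431, 2594739822417287407960116, 92068077834568601329231135682569,
   92305801007734164361910684397579, 92464237985030047948859949854723,
   92939587612779656094134770651149, 93415072649467388506840989126665,
   94128106759736460269088466530307, 11130962733530953621931433986, 11227421784392518319265169438,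
   95791840162937733920106186141707, 11305238368909210972143616026,
   96108791484336333320408487129103, 11363076483979993322935713800,
   107913786933972905512918826725383, 108072205329189072411380150767629,
   11459535541758527120473210908, 11479133369581092724824907782, 97376383517918405564349781757965,
   59346924068441273117478958264335, 59743103576181580229983093608453,
   60772953622543601214943184498703, 98089514880729648036163134713867, 2826181222808402300026940,
   2873283339702393247137840, 98881757825065268317209678639107, 99119441882607510164995886755849,
   2911138373954254080704542, 99753248274634864923306537136143, 2930027824122171389927450,
   99990932762178827744716324925443, 100545510542796174745883992600591, 1267753643328393072099330,
   12173278736652333302585434148, 101733971666134086699103717478413,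
   101971693757777394808622869057545, 1333866774088843050115074, 12330221866649304388063068190,
   103160020567675021825015363874831, 103397743173951326653858181148683,
   103873170749090119419725938855941, 12659051588449019522124824668,
   105378485733516446146975500447751, 105933122307829436959342857416713,
   12833130287549477813886427196, 107200714459154710823505175392271,
   107834578874803399632784657084427, 3161422647442889341370408, 3166082749407461340733448,
   108309870478638837290300229619725, 12985676880502324143153365022,
   54038675865709815521420362805251, 54276282981874447035323353051147, 1073327,
   1427982098390502697205762, 55781695459910745433602516971525, 56494729565560046101736576421893,
   57366258696032402763813189226501, 58633850280611471039370910945293,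
   6256762714281272840296882232, 59029972732853682841701761290253,
   59267618544219591150356138643469, 59822292089518879214887741337613,
   60059958192865888097463303647235, 60218395170567636075821341814799,
   6564698760219365566528438284, 61010734828873113336322244382725,
   61089962991387377673778248724491, 6720801338965098726015713290,
   62436861106390022374941020868617, 62674468227160623152557265088525, 1706397661652322940502046,
   1715842392933197999652892, 64417487802713117538604040712197, 64496676835526909938620153597965,
   65447453910575890024138279555077, 7224290599408946609775591458, 7279546942742039938539233284,
   7301663762260283110376030302, 66081259183048413293618269515781,
   67269662962680874760046178365447, 67507405483343873965003960283149,
   67586652979467521705570210033669, 172220900656127944371475249168787026150284352069779,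
   674401951856803206055197456799376370465329309828454782191531209922269192,
   3736825766984215465994978440555148307499805668770050129042969360512912763961493,
   53428581806011751052208112209728763883959216298602663839030935707083140860453912545605075464740286615,
   500681743676622891066923491792218575763254846586181605047191195708128043156,
   3259782197887285603150969362863168352681208332381504738698046300946758233014282,
   2305703633390851476800847446485041624131294290525911435761469632494457636119314033757743739449356,
   33003766043790609939134290168751505412694958317959693556906229030923,
   2746354616240254520267843453972952600912566694207596484132939697633800806548,
   11580005723187492924561173111103715528770450850773604467160535203,
   8083777166691025847321583483617491799165161621,
   15869605366200931486981815539703439203839159796973452460455990499518966504991842317,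
   119267576915866225400622184061096752487968278043038531594967763493330980,
   7105819433004238384283006135678932081703287588128913168896946178,
   762571825605394289729752548555058161826327366742368399, 367362254452056130451684496294228795429,
   434440183692949676632903750440323512885664825627392925698,
   42994257413151054318003474464277997705077738617951478250870832961514650058920869902,
   10546305020393939375819263317095026137238613517994021291184278,
   252238871781573636655056397392400250415379331017666563,
   1722264994032119925220622169056746582938784820235114322632719,
   627090775254062056212172238774919205, 2806640265749244485798408304996463537176718,
   591870025616779373446643101702550690604221931727455481642552407033580016479168220579393701,
   29189180900017952985557137757533730759235142071330126905881567223959,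
   425163651295382178480926617270379416822399040191004196874,
   394297531762805286553454471729040413823170995552602303704864222521318385170254605992251743498964058835178300222238744723382284,
   33442100907409326450981648218334914325183952332487499419204041998215902485057263771662,
   154529317847812456754274654887972,
   1027337861200530056095383282042874996805280997049181854802418807558209761905057251725877798668205063486501351427,
   3435399539335898056019315291979339403680912971586790914474287566743115000005030950059278758050,
   2233266955991900548394592341683817881750,
   349977880575032968116288994628658016496722446115088476694504181374320102230867577193016226916791217641596969493269677262264305874827788511408130,
   4525865418809362808348311529690375921913193646747254475567432406060832852825777638772906917726468725176697253903,
   492575752181474581020023847964635975597096141468857843715,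
   1248736185655240499315532961052671802923722393015065259226647310727895089481194444471359605680241380548843425316150530305776455561452511585176468291586490997735434,
   52201780250334354333657192420450885915337500953140544769942381435386937739562252326721859948000997389,
   23519475776392186872525693309972190005647573093620303426115017261095968803878403893980706711086042600212375692692735079665694301822431106546419559248016,
   82000614625074584643839462898735812759313587833678539782977080173307787688779857879155,
   235444479985531795532945440605428753389199858597300890967651134496875805770377127280790,
   103813780865980037401640937840400293798605560941125636,
   2474056758451267704985531937796193646161925, 40480581028738801494241956178449688057398464547,
   17235870783524502545808711602638428956411599121103896716667523346541628967917174957140583396090352923275528134080491671,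
   2247948169526348445692600366007864605663896511507074470222628114246494376040170799449055858562238515996352662259047580136262298935397516085764857868,
   28385971876950547875609932216362027521674567501797523039209749679916234200263747626649061434371585809182701646648496162,
   53808421075022007773047420409586447724181871841634975627727500408420036774776627213,
   72479013463642401561818641297415734149524929828443371332966775365058759782013896954287077477420216201348848834732265639,
   4980058140462103423794202353865130618666801546058084127153169282710701316081735351988878285636047803915552889773523183522742943908,
   3235098355218837501400961150644148145417895216338769056645156,
   12080279988950213858599605958961885756431246787012176489107621,
   271173508497578829019177738440153463880089027992334984341636494506983434033691450988205734344583554258600220502685829054602442328646306770948,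
   759231075791760725439541474657491057846514198948524346817713428777423011,
   18438028676687159680296028306755059889006683639547105761982844931,
   39753243907044557858844551093212681952330971027853258741735104655,
   662296098618280560592113861040722752277866683417907362,
   43725901444739096248994349585749651300287121069662397947889867346842544950989180959,
   11659629284458224342410940023904498942478255096494215050574188709,
   11659629284385244166937164693282069173224115771971956388822798366,
   3301264622447151681383713410764037867559383627297993983765936045740295622661,
   919426677908741069252732352441471359110866450189665777911496101537472221215,
   14223762123312639642657201939138907452570039597292287206933105737230560713597042,
   50532954250304543983328810961511930351708235051843643645821509781,
   11541123468193347318538199963103043082036667785459325900957870684960580048129703946,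
   18060547245773117710362883911673398288968159178747559612760317919031540285293942115512074986568975923497171077722125,
   67167055744918047050422889662191260351536009821745879284462079536585496504549189862066404406235644054,
   3472455394022218307274344750449091913468547284918342683073326309568892539044,
   42153953140670962955887070858654677460410906471440310013522543157260,
   8926447430379780392295051997434530609976623111,
   178985670937927853408129217732341403346991847612492,
   3689401159625775640915442047685826816830734096017416860400584573834750496778,
   2258126384198085704113099537573737336865039637762863173645,
   694013856105600023579996108580998685014699244571135047818138755123350822068563173215744169,
   185041746357504515501850817697031762923479279818394632707671054561294,
   838926276440749627546130341298702124543584870895996286579216354516875393083212004976079116875698356663402646,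
   2564606630424310975276605576445324519256900832485182742378820764279845302539212540992827486171259,
   67390128881176060750928479676970827100861397616612402855716569795174390119683864758082385814225716464649783542079097071112558481288261775,
   158587871205905564933309841104402663646753407616073113587366899144899332799986806079503,
   10096317317973737315595090379863114541419966043775596412652629358810028033720332,
   35869324641075520335500759218620843329469189275647021735232499721,
   105299474077308972829748495943480501387398052167922556883700079983882851239786336070361593293086147387847153815264411922535,
   5179452929972055629555489529956501323458982207912151129047101253652184865979178068169195258307059818604419151327395,
   1259894132603656977205152590691508158227106963540085825006283301095203467504786590771086759908124905126689300631,
   2497112237914678559172334802024896089122667457324738015240,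
   118301799000509033003939338336808220449473566325672712305444531461002200663100884530794381151605385969678,
   19578318533776270240986107800857208619730147925530357530842157071,
   12350377624705661127358900262270078921426158605653962311181466702966649691549094045428536373979630332521299243182370820,
   11927448208986787276185801807785623806846005443746547722375197,
   647328136509199192623643873159479580413306757265342546,
   1728258869133117110630957227691881707622503, 2243845397729600629850346726839472775238,
   60337402509074604882777817746900097703095684135232390961655207148543330983192716190940967574651828169086653005755401178646967709468492078164950379766638190603,
   11167904083051337677588166512514408422839592227296955784420921775550177377582889697871767225093133663965574027490214036,
   795359544550605173733590504859407225613934287772474380806787999329409445916,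
   9955771943026976373434140147725060095936057373,
   792489627661125460825968815936240922104415327099035653, 146084489908616008049078642761916558,
   25067714304806137619664818207564397234220647985295, 684755941272747801320110381147897864,
   47302311642265914998485917065948566166991954083, 2594013106378058589853580613593187106918,
   8161420766857148900774477075166572150365615618587990451420811266,
   202294394543821733277919913234384977753752087326196993118532809292528506001427471065118,
   51643404333129607494991245193679089098391696998551,
   62432210690997684282024941492383634847533320965621028946558462016172060068393402174793975647744394703644586086335426725,
   3566405165754115097361181789889177498970029416047197620417397282769096550045314346596361750705922483139301065774501835783753752831731692779543814164,
   2711882799895661433726992449450033553445,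
   223422913365821619246239823749744699106884941179877287008962098772904897349195015446678,
   286802005503185742568916965986763415798428865395901253691464253690448886722572645099359421053052638068180128402446152687630,
   58202286666347111920454472612424357240032776688695619888405640727234212812603138190,
   4971580134434760581891073343587623606959645658020612049120964901689252475832608043990054617483893084106250292125754156327985246237,
   100105186871667090450909295381018320842294810574982263945508341716915328617195252525431079440118311940335524436067527920387782036611869525591402495487397890,
   3931545540338021796656221194966530956163860823370159148950470755592637884349966078218834156775207663180106934660884213118961213664419505302893169708411887972182587411167209509597356047,
   353365508013553644102934712648558684113625077197667746181316948800175588655478273192434763469753562717377781727828576541105350707732352655397,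
   70022550640991245772412690803453060101340565349402021979741992831017439466532865337427287808439241796675226815093059746,
   72412829893233086782592373224181974069822491509427152366879704113644647188301586428055,
   341959956838832031829230301620156401569973527237867709839132702214623996103815719089536517316385022914097295,
   81388051754120714296300281882205352651219726393485938157528094021844460134343387793345855796211630338638989224289417618044634177367451922582,
   267286363660842471886287114725586112473147685495555316270601479481805155009016555565043921126414318691557402492458632269828,
   35957618719555418401932467606492712977103000803340101766729095047956088755670212934558702013410975757,
   3304244392520032663315664875869282543322927092873105135554449025920709716181713081693782585461089126580319493902341236393309584363680626651414192130,
   2880345927087070509055657658449108926771051485005688900093390363210949400765637529308300610643156362058304335877,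
   24385358511382525441860647688992042429180243788914296841442918471200088131892157934250666340294027295105547777103310304051105138643862978316926603334733146855844857569292,
   1140618418706293407332096266795095982416051153176100167293252095623499795137402066858292915236080996859438263345530214836920470,
   917603804704601988945511680808317305064164051581166726503290680528895501357764607074598860391772362539731096557128510114672654,
   237420536937677827211031938471033320757264954740355728316111187565900060449205189803778811118497966876021496501149294964739,
   820929016220144778235468380985221839234379085745369199934891029594161299,
   680663063375365192024806276258627609344690157484763168022765502532860716699412388625561593971650409804204068035370580643373139740890310159888460,
   57621635781838861916144906360093221655723734714126931919080797309406914818969481675005014686702592012888903932268736589,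
   53495285423677264501133364645093002331621052004649230333396797568117913404129303552997080253710457935805968643362471850128,
   755502615198557199217951326043469021709249718252547340159866485479343065401889846361976843,
   25072626887637523851435532483552002397120561213585,
   18867429864957680425803303810591143012772632676633953223967246673086971399594209834191797801429900790567356896207132146813623840880729731578287126611554306,
   58177624535852098059398229858131742192817785472242671793374424030108731069872750528299731225079106214703168436244834533516,
   552275100468822510570686413290070638685679736343172091911,
   1225072519973718153395139092245640644191115459202961973493943534592497832414599839580974855835418923164069669158885128363653460116,
   261393331110511817259033842410746577443327593667898989672826395394821998780270412349633589306930760125826171556228566952207804040098796991706345145830305838694543,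
   43739490636838149412258512325968069890157045955268153105404310343714032278176340193284,
   5741650434100782137122355811149839937414763053610988177772449358863282026087967089802107469822482122703715126443201231394407632655587217652383514627,
   665658878466170658132261501210365938921575416483365947955268370529200021751695787695960305730227243458597519365,
   9369987110201202929324580654802602566826460103055829261240381512,
   23946200984456721183348416840402669881802085831354335583338312757471834006095586018753133307739103797674424427680284383782340223049732,
   51358162610659115672709409125194550929768737652279461124422381573,
   18720647429074440328676853999644283209143365823370500542759415323166990048587618245027465632952188844346315899486291,
   197955822177101588664127356977513676686558768431564562470151161127153715763002035315130091441011068567143744973652259697733780,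
   64400013508114477654332091254517128095596975948185743684353193399500604673821075609492663617742154571179090733833515171,
   768281182072119006440538852617889331979629046513287204,
   4810889008758575177019843440794200457959978049424910508372673027419720412445108598560703398168414298795740382075782958361492717145908079447519653892,
   12633760599957516487229498888064425469800001567,
   823527415702522272463454865977971139462187787545549957721852574312042506,
   49093622983335570268902463935228192525276233223780819250222338051,
   59857011511042440099858171890162322783783104976615618675571052015701,
   84367507067126518874100136613994592871304560633245812652046341270199928447065831116980049303219529898527717653884432590914819676990742556,
   1341097100336553000063990885140113989963962460674840850149105867408288337042858549796434253796943076271294561446331507380115349506,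
   41375452760695267059853313261323143511147941991,
   1076287887225423281881864052387142405961533228180439213340429954808969605282,
   168788511853355652205107492726995237795822471043337360813571539641914984144379157311491,
   818447049238306937709725453268764544748396934305931356215882496616726538,
   67477877741675283615235606119426760686561860317630485681891016375701804582061703755567894669706690573,
   77271702443546400572145022333174234356141653906966072223209633345820388529412334369507770865703233482303490688071024648,
   51575763505412042763664747469550734280277172938617984251287183663408418718396300572949036319824740428,
   4605659488643319361081678017498499677916397751948976760553050125118871988097884178083305266592899828699468484685,
   118311237082469080607557936553734710862874478040141359900488065165152401,
   48739032470525681231676263644172377647309262933,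
   5009982807857270951999621530600007261519583618735373142242452563094064062439491420560057950044172,
   4074974784133129175528723458180526831472861474647309590386803246030241847939728187783693778957,
   865297724695215010447241078650635920768475235611735518363290635286910145969246012556428937963286432875483212,
   4046472197107241583865135309737825671118018701224531460180930511560599658450805410841334239281,
   48796965948910125736311922918563956538183008285,
   133004989998871864274566996518881967807462940926094262492365463175268328976737060958589010,
   55948831358155837762226974357529036713006711586002020243643351143,
   157854423960170804094929199022182,
   4637044454423152407232998703907820371340722534721271116669652446717157781355654567786016636656848273031284740104,
   12281622305082044300988842869600622901431388885205247653574464776539447153567838078819915013789810973603966366807670849501506701755433045,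
   575431689677780856800842830869446927168171441550275128545126312501252531662295650514403362624388485443954091555160404896268297,
   409787430333918699922799027329242771440450385079291244687,
   648832154586527948544270457136901735474674569946139848395950328483659824938976384879797008076497091047836663952,
   4362264991652410620611466848880011576797026647215260789408277350814895090211393499820395516316531542633002152012,
   3880734627528715341111627002037905640303797660080832360553285374992845628573691660715604082833,
   5240216584448292323791913768802840920311552668119197186147036461336626154497407692374723783776248066714274415630610741894053998626,
   34840277011099152693503645358354512326758040012040061918236052799424025297208628283879195560621654043,
   23651010060236379936389623513950328864188114152442884612118226066782822733112741098313319277047825008506380362151116835,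
   164545210059358274225865629682380143687074448994317,
   796219827390638648168209967382371863389599478510106065327488298607579395872985343518504507912365302847146917215063316858843140,
   11550009671704380139694015953223580922859691,
   147464528564732863610762029848363122827509526939066623055978923576776217564927956003217438,
   3372005785503828163736293443751411885676371436337893112675794596376034451553,
   211073225015000668852055465450713526031446203689127525172005775694388277062382939230243,
   1099656640337544318795295763053729308567604359097097276441491185609096639954897998786445429,
   741611062528944611488440182410565435944795600714854516,
   106590473956247994509444241068823447573415169657451120772200377409638,
   131640596795316946271226376188432089196573770141838,
   202241787675729866638292570930759365091085255364613,
   1985438245956989690042728527556491843076646803387450793401092651893685078868130,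
   176507860962432177869759461950302239696442653466655,
   4325446104767955250888899721983289662852011536722476777436359072328427982660458830274226503716,
   6113987446167153114703168565716999037563994142, 1494470361890092002392783674997522487607306,
   702296060761633124344894659368377572361683649971821171644678737874574008436,
   50705243745570994339850870618255090831482646904776043600585981955,
   281165320837194670034724037781450548438864804614672391120183021671736065874905002288394271,
   60177039580074072082897534205252723549276250876197220686312520175627,
   155900772145935167663090470130824036186430283090283015656551997661221,
   420453808415687047348683374174957316408279306595934970018,
   2966090303666652866410662275405338887448617301998847027205371956884459844690753081238863846977504548113357034488644427617764750996037244781854760962,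
   16669953716037849757344675846885351412459630908766952654231881105539887004656230410,
   4069812918954553163414227499436029221661334693530373536805999308747226646982659,
   156968686783505027940171522472402301943307469049865,
   54472992181882704266813284897374965841967169388577,
   24503595578352972060412911079895653799115683841653166736485660944131068097029479306385345429924596375657443325314386255935076307193532468,
   364473652553415800071158356872242881975664199521428827320223690800242385612444493405818185595674993734266653277895546246774792,
   628318383341699173143972137282066144003537367354123867132002749665698771780111146730499930885753112346085609478013860453171257,
   42470481852737043326427948791421390839055941796,
   20397727619377913716094315588749371643486620922795529132502574887807117489435240569445139750347701244468665102491750592886494825427016,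
   13354787701146814412245205258048866663621205039286727231612018851,
   50138201713883238025085761960972102389401148565469811115045744742,
   25128891722864711918208717487369577763610994704386, 9681306438483769718258074582154533201395715,
   164856187078119756532640927229858382385679788512712352037323332526116,
   2974462069424703071899552205796357421055938147889584667125787045801633468449,
   10050986400926399086334103, 3548805272161139003325055159361189485570488010784507039273057,
   4959303559745685879130204896989029558964262968538525378604249137361478812563580649558409625608194,
   63272019210276426863552619571339194825698922267900137787561158548401944891153850436203732236308639906,
   2832400603699084133159651505707904519138929410084361399001269239810740234467360288767432257539,
   206638763452319147884887851764753411003774503549883588559094751109577540706253772991767387743673936847208564,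
   62772999418340289370239586286840075657538515994932018089999055798320,
   125633565456206083922747495006852629238268377470064687069433358431701365978612698405961949860267884220493,
   735394746082566958467323987543650167096684932311072776,
   18798073178855774465093023714050870788018464543557929738194217427940246502974579185298139023169025355500977490903124,
   5717626365047720536888710061297729083745867390856031199996154791062417398066760755762562085584144830636171062460425,
   201035924195151119599994075271711948315566051841455881490379992663934907661381576244400306361521054302284,
   19108349348776579217958919224326530470217667068560053350427687607303696677321458515670498524906395730545371381399716,
   4288697981465005242016194084365270736878394780712362522547727152532779866434645307279256519376898994576508383400,
   62595211126135844709514649517251354107996087778504692268065825538213,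
   910880206009244333337311509226559400572108965021418045448,
   60626689056779078580599262446044156880059168616402433022869455542834659366504768163855,
   18624154298356836166038760873184370954530332028340735851912378292706155274194066398288850935410805,
   37138615383384663482514125020524811967003160585,
   2552057119236013485870674170112161766316384324823378743439,
   920722026037142343647986755773073327264986475781374291149326664607711499243525100173148173,
   189827270349525135897739202845521717662104758637276606599971564995540706027652841369636,
   81887722853562123310930141414561141793852589888583478726329601697418137251602504499303,
   41860107228853018979713647604283327888391928117854593647282600960037,
   606166140867579716298689269579254601254406390299521744998, 624421637966664825991465552482615307,
   23226637479847909050440368945964907860564004872,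
   37942493551459978134545676856943500269278426447875,
   168354595054086432544334985366189399092460379590758,
   7076934352194512585326483710629743971485040805,
   541164924696105243754812547725078565103268067006255207,
   1406963030515460399521041356209925543780032966005608628233, 2614311874109559722100,
   558494753346057971528010407939099886985465855536865099778,
   54774523132715113540846187813300509465468151127019901021842561340923283373653550771648484833926975071429011525230751888,
   136081675494813065278513214181765530139410306177368259634778090285719488942349300071754518214483531013108000995125484309870291581877991929426797744153332170788,
   3572784346031404354832472919380784412775945624017018645149232747007947002616974613738158316314638,
   1191623412564407558234728015716270394153738622473757332722088601345724137475,
   12322526139346829252611565475126356573249249702338749855293442,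
   740633860126572869022939846251937895, 656058533623303003954507928342035931091063589052735503,
   9409899739212085050990569994228804646182619027520553199157278,
   13478725659591272488730325807450991750987012224136000967463850361851108884739164152701793683669024,
   3666416776838159630956408693119785941427365164357450411136676733594720537700413151730718585794513612033032339470,
   176693542895455656905198678271990740933297620205583,
   13220249648897275099891565416692276348119751497492034908262537745253268103492345863842590367973379,
   49903235667730828190315465521820740197039902678117713096220295783520352901064740872,
   44521987112434573583042941044836482498697371663,
   7660658952064388192239472248896091459154412196677360910045588264077528134540642018888850708897826,
   650346904647536115353065804774496192816918319528878111,
   20642742192667555273794819699727991171595376317972527613896300140017562528005702534801813820494525082796002680355814720903004596149604354,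
   15530807668164623443460778196687259650849248792176647575659162934355286124360402971844566016544735405,
   866999935039569129270169269238078826799917628127506226783678377057698808173682157267324335633602890042695844,
   13033505034119622801545208206374365701482115049698485433500486841955771752042915715789474983669792,
   165879189817733789632386332730820013798621840006344855,
   88892996752217771137104441728812273150108712759367193438172047840020991909742122175545904837966321455100708323024472199072033562017943258598786271255664803853127128245080179850801859285090573774585943185789710369,
   270678587990479033849083603781355776916510572229977577336140340764425754540699921260789886092061740995265748939647821836300,
   317040683974513090803380506167141997054550935503235725543074740720804265868745921308695599262386019230081160977203344310525939702061156832563873949572536192199471327765205463539074996944522178883699,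
   535109493662104613981156354607958378452368043433533884667002502607306225814856618491809055938951318126574711962455492415053927,
   11575108114018834873112996902499537979158436543402440282427482144,
   7790966578845957405013423563749967624354697246,
   38170826465483159749356514864187472784613352124403690044284771524635,
   214013921828493244379959342865162346,
   243683205497135944494064393400286001931820218000203158753231311692878970349719860302341947133212650583195280782785027642086974115985402922745114565571268613451913,
   12218223160746100992488148014580268841021375954045563941014467527019232147035291784,
   1264496399865324739339046625788865522511387363289502300990107285556483009526447098532640331883533595052451663033748527659103612080054356511068193,
   679249073957284004786187464419046180663096690163814463,
   389504185639607996737941142111044003483850168158192796524187084007572102778818348524385033309166113889000118474181375971856441,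
   5716974045385360992272679036, 54751632633038701700651956580425, 5829671859563613611450941492,
   5871717086403977367133405204, 56336175813250276766848228249695, 1457136031794608514564188,
   57762341489606843570993454419983, 57841569652125694542919645081649, 1522699212240449891147826,
   60297662018710470524963752923149, 60535288482380574308123575750781,
   6761486490776370160014409850, 62912172043589292555160520904717,
   63149836135000603471894349393995, 1688532469651120222077098, 7166262058608094705273692306,
   7419140047533261996174221438, 66952808331816775171695587250189, 1829179171624498367971378,
   70042764712482983199532596301887, 70280429861932659689534095822919,
   70359677352861233839195606274155, 70993483305446789702580068094005,
   7958486345082614230636896284, 7980083640873681697464909896, 1324422039433841448378378,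
   73528803863109404557321294688363, 1253586542753471946309638, 73766429453156764549335436456059,
   1338589139445537944117262, 73924925313786748571203662065727, 2027518540260028226609296,
   74558673261618623397898897150045, 74717148920127334240723058880567,
   8362744477128568529962491954, 2055852734655020894044214, 2074946307100546228076598,
   76143313859530696335776423194717, 76301770213014436189408265146461, 2122427560095555703701670,
   8732198830446786540887720030, 8790672664122041562265018394, 2188616265482488110112874,
   78757785222294811894379989635083, 2198547567910108199944314, 9021236034879962487921778794,
   79550144195117274145689954201683, 80104644212451919657607790718981, 2250493999768125298573434,
   9273745658513596836684791900, 80659280460774023025505282871345,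
   80738527952114132160217314807863, 9313314415678251488890134554, 26810357645006467726137495629,
   26868395328406994871749521413, 82877707692257172099151749001245,
   83115392165429899405369855201373, 26887724177401153620350611541,
   84699878039944421871106398744669, 2406331657696572770099322, 9871483900007070347976712246,
   85571445855781285706645811916893, 85650615999559236745281168625667,
   86442896864260187015508060795005, 10086457552670755486681038952, 10262535664384276899637526690,
   102050883593436126004450481467521, 102526195267560872782809367318543,
   12427119963841368704342597738, 3118589268286793964404858, 3176077911468086231965716,
   88978217530311276941722083455025, 89136732516716912254623876288585,
   89612024115829980605999424827469, 89691232420650202515163442098273,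
   91275815538071963891068213809167, 26926419013132867979650265217, 2623118972297638899597372,
   92781189320646452255601107095721, 11015483867434287108312350814, 2703354211547520329326692,
   11094276091031237746118312060, 26945747889764497793059442697, 26965104874532310982796013617,
   96188038994473699445925550051475, 96980300818733674518564751888477,
   26984452406610163623036334245, 27003776329075302175835803719, 11536856859987225539858645076,
   2835720477035460844363922, 98485596597466116837190760968321, 27023123866848521832375078915,
   27042461955333098853079101453, 2906555474939147958083730, 27061814215485455657680785531,
   27081157026293160702686883969, 101337850210544061675329516957773, 1300810207019355783340046,
   27119833207788432921236869131, 6625780007403045875896403, 27158518837475148965387284627,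
   27177880536595864401381175465, 6639942452939990891892841, 3052745925672741485838432,
   104506898763547846318530000138325, 3076466140586524373442726, 105061534520693076519871622844561,
   3081080124565835181883476, 105457714661180934720008306774031, 3105241934314330135232568,
   3156701431626424746672178, 108389098201862294061703827083357, 6663557731738765165121585,
   27332613596704041789783969937, 5753667306769720742460637312, 1633762410374600216581,
   27429327563128163285621870663, 6701334367323914116288583, 6527951346055639714052219046,
   6798361352334658945188929682, 6971952965166295873743388756, 27545393988064558662785060927,
   6734394372326567836848235, 27642107852998643226809544709, 8016464873282938108826517600,
   72657216694598533736808491053119, 1967152092140428820127914, 8190602016307893576392974442,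
   2004930942659317071200384, 75747095685151651714330792644733, 2103550256982181246476416,
   27719469727592153717464576071, 27738807786013788154106269791, 6776895692629229030477909,
   2184033433459387913551954, 6786336964015567730159701, 80500784382857509378846881763399,
   27816188522444210324033818731, 6798132522788092591505530, 81609979711207201436841659773057,
   6805227628483027277402145, 1662586000490119958613, 83986824015095040915330754981983,
   2387095155075921127981170, 27932245394165775326255935595, 6824117094397739983310925,
   10047767095714363689575022688, 28009616623576189825441796243, 2457931161507198675796082,
   6849636944629073910538300, 87472863746665959247955196457055, 87710567563021982481622088978445,
   2486170330231115109097638, 1263031274030773760434182, 28086978588118404077613125695,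
   6861894873619980286775373, 10415025524376859370798358696, 28164349840556851435652837505,
   10666482094856701138484764732, 6885507858111819332284587, 10841398670465412453527789622,
   6890232531011370227896383, 11208912073480990621629464630, 2779051610303712023158810,
   96901053124525433247727417462911, 28319097067885509612231348239, 6918565507734754491043947,
   2812455212940734327455906, 6923287880978520296607793, 413785945541136417,
   11732589461012027025838973044, 28473844189050821059921055759, 28570558203890320803486527537,
   28609243988046841319207760021, 12369478894604086016127344734, 28705962664165439759712309343,
   28744643677540095723864911997, 7022456416873846321860679, 7027179971743652638003347,
   7038973213420629250310200, 7041345918271446543544469, 108468345603251502316209733578823,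
   28899381350595014390889123969, 7064957727041894377181255, 53642476457783374106514627293233,
   1727149036715660447755, 1728756821575315095656, 55543951980428633299555069399167,
   7085709192444767839592504, 5908981768487801446120079372, 55940092755126483561877107404927,
   7088569587049589098205213, 1465760999854299780038738, 1476025959345324449628288,
   7098016610649615272194125, 1584639913881078910820378, 6546906879025788081267785894,
   7107461343614942212329579, 29131495218639242981365837949, 62199099247357280074218982772811,
   7116906122179628467515421, 29208866472202464894654844977, 7135794392412966667931655,
   1754082460740991868108896, 7149960317540550861435005, 1816036364410561170227326,
   7533777506918259524706369702, 7649834460567610890150944908, 1872704681137454841405512,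
   7178296886191402132754577, 1919486350596534742327442, 7187740440042933883793557,
   429548685853085705, 7216075818327864255336457, 8250883100547228712661852322,
   7234964131609965242724401, 8287575824702243505812390016, 75509448839575920658309060227179,
   2061112390143445393555578, 2089933620695038857609378, 8635484767169941131770888274,
   2136594171748990931517534, 7253854749903434886950961, 8829744087836337582463246482,
   7263299451622015352787037, 2259452292177903068020842, 81689265902174636694471971131467,
   1776725223950149251157, 29827845934273966612041404479, 7296356005186338029908045,
   9427435107984893383989641308, 7305798450882021006413837, 9466122724157337827820339252,
   2434319344291948093587618, 2467159803592207713861798, 30098635765939439687885189249,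
   10222426500618483425903984724, 30137330839200844520962461803, 1579354916073500087271450,
   7367191545787595641335973, 1802577856755323248784, 30253383100430967873164841085,
   440526072522952717, 30292064006605312986037063729, 2608843494858832006463582,
   10956622400763375537065959452, 30311411386442354212725059599, 30330749504876156412655358023,
   7414412904759469258321993, 7423859943294028157563025, 7428582266143740490993749,
   95078786686293262811463633924149, 2755439746368703233089650, 7447471775704253114372245,
   7452191772444480919359537, 1821688599955411873941, 12270828628787460962548973660,
   7466358871892814876676247, 97297212826495830467499419635819, 7475804778044885022789769,
   11691908918556719900872720484, 2859332327748431369642084, 2897458289264786183159930,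
   30678920134009328888071639089, 7494693135248079137599657, 100941670202115347676080160051203,
   2963020996270953481748562, 30717610617462074597718962205, 101575533725045313905500331831323,
   101654742988708879791176116539395, 1833791461071042101370, 12312873853265678465426399352,
   7513582563187583292133387, 7527750852986859115991055, 3057455599883349014118528,
   30872348398867422416640118837, 7546639102109984835522689, 3143020827894351854559354,
   12912501060962661463006789684, 1277198375168094949621772, 3180800259664152589893760,
   13046479319285103350906495010, 31007747956899472577946865793, 31046433716936120588973609037,
   7584418063801040977268887, 56098568356855001507528110534749, 1470956563492454361808992,
   1499290261918093777780898, 31085128497333796554880143467, 7598585197595509261348989,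
   7603309869632490769625233, 31181842595140296109369716829, 7628782453748458043457586,
   31259204661188285705343963189, 31278556681489067699645788307, 7641086431758992621490227,
   7655254748030386850828291, 31413946880147133569004277889, 7685590992299626234150944,
   68458123505105408476334254247987, 1891247198756304568524966, 7767312771560277762340536360,
   1305532574628125436026894, 1880923890943351324764, 71706516712150097938385429794845,
   72974129344646367719680324628483, 31588037207609947638359683121, 31626722599795673485137064065,
   74241818630399338989481214660777, 31665408460041067709446778929, 8713687056956440249222250646,
   2150977366574233299779748, 1892017379220626878549, 9042515041310201139874439314,
   1296087839410861276962818, 2283550657470906336002120, 1905272602053583552564,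
   7815816361646811672228009, 7825261094336573510553705, 1912190125033575137444,
   1915075804503105474567, 7848870621188974176120977, 1918534572863505387597,
   87552149167783906687662755631211, 87631378095471421043814374101041, 2509876722464320926376032,
   7879207381400884703625360, 1925451551036323942517, 2538008012816809923575836,
   10608895538047797067950735386, 2599601659189540814405716, 7938595584354289025601589,
   2618288205306984705146962, 7943319040153151286046769, 7948042559557526712545375,
   2651547715263482789519510, 93731926690077214431864242270271, 7964070497116310529785996,
   1946204689936544714859, 95633422509259970658637841461417, 11266940512852901739823792182,
   7981099188554255991214107, 96584140124999453756255174193227, 7990543921509277694062739,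
   32748601037999472020249841735, 2821458348821611475796018, 1348033872974227053780998,
   8009431017994160590311453, 8014153384470567886991431, 32845315336459352397569872009,
   3014954345443220124713042, 3062741116160689388036212, 32942029402028522731915505769,
   105695379371298368280948480462897, 106249996286169048906300611653801,
   106963048691072658157799057944671, 107359151460199634610077625962665, 8056654712088006605426817,
   109339875276689878310765086429237, 33038752912322774068183126165, 33058095559421544959037198431,
   8080267731487280966193297, 1489846058972484445970578, 1484907578540304689086558,
   1612974605925206905618484, 6624091917352484038099648612, 8136937282213938903789711,
   1987709875234712145997, 1655475904391773027999844, 1697976710030977210515548,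
   7107657414468499887649849426, 8184158577298761865810065, 8188883248495027215216733,
   8209633531144035744817302, 68141211015615740330043567706125, 8212492840649073695019157,
   8217216296158905863065605, 8221937509161716746375173, 8231383424875412167503997,
   8245549406024490165522601, 33793113038411195480098992179, 33831803269369643339761741951,
   8264438807496548503736369, 72815691408538283672716960149611, 8094141070002275973442707556,
   74479483199009553138512633557121, 75113309070631475553405302272075, 2051604246495092481138836,
   8283330643457913284317351, 8521682529117225103940632648, 8578287464310853924744011946,
   34005884124442320522073657373, 2141392631616039096025202, 77014784295675419923504120754305,
   8908538746895250021394448480, 8316386055628013676220419, 2039591342942019768397,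
   8363610873385087119544329, 34296035763639997639107514431, 34315373854354697738288074825,
   8382499123055906464493617, 9641310954562701613791821918, 2050421640299005690018,
   1329144407042748439388166, 2052272900876781269121, 2429393565691047642857512,
   2443547961607435166679122, 8420278118255404566220943, 8425001637934522037866501,
   34547482890540088054318649489, 10357826254665197581949870230, 1721241478731667755024418,
   2063115043268909637778, 8453334632126396548313217, 8458055864819265252610171,
   10764025283927601223011770514, 91988906595319226790209797714047, 2642102949649396791550098,
   92226571872157577382598963368007, 2666061851404703210405972, 8472224086238124627873899,
   8481667730165773201887281, 8486392402227699778596927, 2693833382949787227242578,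
   8491113615498313717526653, 94048820573466023273291805896779, 1310254938296245347737612,
   8498184456058214914687100, 11401766784133985285712404586, 2076923639927199088724,
   8528891330538487263834257, 2883291174339590356467808, 8573395290981751673389110,
   2939409149215372089139368, 2958502008692618018816148, 8595006785719431921193037,
   35282519044492872656588796011, 35321204679943348505241055325, 3095450138202004372668510,
   2109919538780052197543, 8656397526915651478089805, 2114531223974248599627,
   2117989994673895125075, 8686637521668039674249300, 8727233047239917614575761,
   6200544910973684029109714956, 1537069206730684796395666, 59901520261480191359080980312157,
   8750844879653990962737297, 1626699623590692064329812, 8774456700809340153606291,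
   2146813036411194757195, 8798068563064848891564181, 2164595210574484799652,
   1938375805263928141185130, 9119886286869965351273496630, 9031811868629631649693728,
   9893598652318466864354468006, 10589939965903094621854081190, 2240772757145396953140,
   9210914730141730576933004, 2830997648932255004229716, 2991905137601343302172724,
   9348210422974750952734842, 2286889621728723992668, 9380919934219576064762002,
   2293807150480480518184, 1391022888080262361129076,
   69282321619164873165031236405124802761560426096485913543070871694,
   58866424919830600560752855300746878969016594576, 3208322652610634027604129429570334195739,
   879474489988389796148593326549098662, 3602975571142339195151861571505386836030,
   803661451676328901775014683573031077, 628778992647802669758276188067963025,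
   19225783196417070045161274359507288911550295025369204814909651496766151583727672,
   10920341843337383458177166,
   4681475845121022750934207711642079289082917836476445609053190149113720733722,
   19515422440493242513320540361656488739318242529032498301821213695374445311942758,
   67580505260634422998712829478958170049408827081694404500294938761,
   244588320175671798337364028624210170561880156930184,
   51051138761416063602688148469562216998497608135331339143781711997,
   19678306549454129100646645790914152832079105425649076243485384635057705014162595513559457919533219,
   11893113231939579906376891550573244136112092914301988182724640, 46319787906323074351869968436,
   10152277421467230270167558167747508945977509,
   3415335224713288667724323466721912063824501958590679197385763624377443386783692198063412510844,
   288512166557907200881012996044449657154982408768640442831549344940128,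
   3446175332697524778110066679802417430677,
   18761528050386806884748462040199858103658960159625939637746954603561905429725352,
   107946130862512455708302994025598651468809748184095593969701280018084927409110970494485259139785883306784117568534253672,
   13565665752286273302887721008337340686987401, 3620290230839522115066285486938903867554,
   908547340743786726770284068786442383, 2478435376373631229820138556691541168230,
   843954524726269395908618382162645001, 967790817019008012429651076161434628156215711704260638,
   967790825961471102867163897169321357670153913851420789,
   71222829855675369181917738196768403861771041318041825116990973779671458256564349091844,
   3784723569274570430362828216155320432215726825494259671045,
   1035113065762366295835071654926494196654360352279080970,
   65161385679052373291058370379577175307940423763914737983579915318488669488502348454485377612083507368,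
   3772478955288847158971203265304598346576865698234377998371,
   11859122855198906337551263061160321291558179191859727627323652248696780600352905,
   706810465759572380209280620949064137304290094832285613990197438838186018,
   12423672719648106409597283908498582695681047225613815382253187186912261281206440,
   224857268052633783914946049201286592021196345679885, 812152657439050066254477486631559290,
   14241053141161381650760514780400749094387848, 55386909512699142585805562312786572624240066562,
   2738952952963423412227, 46569879720966575680829542516,
   222796151782391416898155715610427286920106344828692653541229345624075,
   3686788661002948538425847475768290988047,
   239852810390657792718733811073509422120988055367515612342064864680578174780043308965900,
   3260036427063004635138, 796205276532457634,
   251938823272642693209104085148820818958452445304592835724197241409563,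
   1172680105343772345962341598072111786102686084771193028927794443953852509,
   2815063056729581813852, 58309561426943232858449225431502939055186231353,
   16192759143088560347946342785578805934228003933844488698589329,
   359850470492950720157047820477798754312081374501487540010114109145773335281886054079521525119810730586236,
   40921440089509052752509296737,
   376059029244193493208037503731987851497533935085823861232313288624710609520976867708854995312195810643979,
   3579153631319305063595284312339047903401,
   2939890748543304113956692149042094613342330927171038863485,
   89341943879285856537541603007805083545680347700244298429120327468408710780376021836112923629268889693,
   1358047329034111226578515383718559377183490102298613656375410788931167209609137328042825191323105097301389343,
   52334696281719907099622137886, 3764867482587955217561916995149878399127,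
   6227336456558642286911043204307437332713227758593788226033739175614457860990598758044859248589698071480313630725,
   16127325744524574958110283054647273265565772478533741294615435158525502391436697859767034243538094780786680433215926278,
   331914718102033009678014458868641088926896571527247213247941487197057035,
   309625389419699713149278340817059779281228033315264830360525099725172888109882865887887638480115157544784691725556072898710,
   1395153848994244251824205608142701444476560974123684136179496328846599678680873304371023189709304223389315214,
   22674599204095933637961713561296804660041905477968458173370604087853944123856563831343376658657431,
   18185572208608099468800751604100092605605367514289276335643915428407324652820647324834333604015426114826697349476520,
   148899297684674475306325267124362201628466731345520447892929439435318377843370091842095985165643397303938090794747836272671,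
   84669913513402510497761054665486697798882934847269000025517946901211877610785030248671624442411573417,
   49005715975675900260862558310, 3928696585354839799376382845141779018521821766747907748008,
   253318888198450379905821723443336184351021745754153058543638321598607,
   84470065273280194229213694897330625153101180153214466754224207571294560889293159939616878530916941988,
   6340375194199846017437820973709181002718557538801568451256066705513064873994332236858362224823551576451835335127531903503921459351,
   2649074033797828834268535056772276726541094093254914683045,
   5530051892427499449772975232128998382615635542595423858699909065956266615229769355680197815592902146300208795785,
   14578049600647036847107905721856876855406605, 3476800792462185991386294701461187117192,
   290621252450028259991392482976276675037735530583848225646577159723027682297426045714485,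
   44787556557541285863518060668,
   280513110588230700707369898700254040386009361458881158517192749695101,
   74983552946463172524599163482369087394095116941244007907536089869423334293594763380,
   3285001499414301910264000942230934507605, 790333974725601338838903185428590317697,
   669468381951627820256043952290365081857231808180849872845806007962914251499797558191955882127,
   38620467017252357851358646287, 2846492113989576367359734760760234658083243078358388568098,
   57162312736444133499800965652157946543347866213589233669928808931809057500585393725485906659880947723,
   12754877998107762149342759582502385755861109,
   945755810661614664953769767784114110382137104011143694764538356214168694940998480628825957991724227037844940042497011447115927,
   1875137164054473918845432747819288140493603135809194409160333338962969051937464896172061790646045673459936737188841115311648778,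
   5886481837381186568730501542290200708777103912148080661999948671150603582839396641466049261746947586756792541189,
   1184252329547429905282460374553788507109355874770800637025033722569904159,
   5507470546289543381494330887018376138910845106854483509982072145960480281674365779986714117342120638505704988616285068999593759404182,
   1035945913949771190230737279851039102893624898665190540473197871720185913,
   55209407728323609612574148655221466828254900388,
   181207858553027812195925842939253032551447551504780829304795550478439,
   7491110331264492060270419608255133803144885901478882936120016355073793210581810947182646433653458379419954497995404404075647791108,
   63451560722234105476226231585997163587309613543287931293878156390413241256991051145541104995844730895,
   4110722653616907027338397872223739032950395633364093542042791213608445792420,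
   52486582199400395590508060079303911562059337895,
   4264783330989454309827537591339182614073403781656522865451254897886922333494980704076522717307,
   3476486997039557915454124126980131528736,
   47128645106422948734427381608443445433369778365125535097094398607750342336770472705704897696230051008677,
   6355420808385358497973395558,
   829451195686360695213946109437690411194109607287974683633833227074686042229,
   17886764006320414912897478157589981144761905940447250990001193483103676844335197,
   18821672528348657587171442610562967039326364787343905926476023490847909778751873638880375823235735897718184290611230,
   980103602825001885401718679982804967792852163113566379,
   269870540648014983654194776633817081616595228856863576280581734200767353219762919535865999,
   193821888780091444112868777503477254624099891572188599445351494184971,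
   22640201785292323699680991338886820336644563584771524793345882082963850033335719840701707905462303,
   89624269388303287643599871251863453115938033301915776870546725229794298639067917610242313164284817418,
   6445511248266205945480058422172472571581901413955726964374288239801237070104231455775947052578478485488307073073,
   1276430909393749304028382062703471954987851420684094519278465865670027424961946792243691596,
   59329454075235669723019931962207602286111008159762259005444822487172756491978457103,
   225582706420586915505070011695036298203469571096740,
   260084218367623371878190902416026475796142918145964537926467184738469,
   1065311505381740744507956648076640132517221838596417909257779408587989004,
   247968887404127415605063236516395401702150516923235740617829360386212,
   215906373388934802200935510869730434193673769033790,
   47427066499878667699432955592968758987923135763372594549976543295,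
   5432052648273100474112789420757048938645905746859333314828560006569178370617563300073748762700,
   12694583886800687897381329108201538414751793, 54536323208265538872948131617249759828973236301,
   910477553450866631386678279965520790963926328140263574,
   1040305206650412971501746497900611230347891036092275192875564487059484820,
   283456623767333260120823753853591541957270658423629680951567496455897567295577310371851,
   257654044457559972979726179482516158032135096779686865148571969323078,
   329589306799195108694397875970582630366117417213408444734460082722076331244022705443599167832085215399984,
   1005496081636720124333587235430652626928135758772637767,
   1170523842963896283453114995220353185081355024408017211622196495184986261,
   89455684810282372972232415557664302624007553153952272047040871526130465356196393281183237970225029284,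
   74676831331969668962775022554594742631560962658096853386384789509,
   19717982479562417533360276163945777995273017748556366092084770063937088981766214,
   54583335800334771094600655955155628591103402149,
   90142137034947823896978156974907309523462537917620280509681230708456624252873926194473599127800938545,
   655306607422067626870990664503727056316195600382982221909,
   1259381946857080568402663574333452516848400481269123497984755325498720327,
   206477490129498332087919377972004099072678921183403724274660035678379,
   1011563260396821293733137143186183702457294714315567269,
   4963270805395904181971477741579094083991980170654678189965071005329834447634596655747870015656,
   825769833630234157161415898403868687, 751525385526494985111258436374257966639722335662252201,
   3050604357912843448138804891304281114158831320875592204290,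
   12874234656499974948664424025939110638178381,
   758700181386687754961365037314964142214105548311372768029545830036809774416216419500961936,
   21152503048229816507816837740895474910238751924737706274043869232470136841814125484658587401769105,
   13839477213550804912898190, 60673138660112334223165944411028697558888353805,
   882910370420647230720506376871276596, 208578944966884728896711769432207,
   5417656115071205891797116752364046660942605581490756841860311694846501257787809917160816517196,
   709232908807022488673755683565294534488933765136744482,
   42273575842169539615371154125675078627941822541, 150185254687581825461352350638084,
   5613317026076086980814197273224572225907853129371233635833221771411538341697627578964635684920,
   4299761430884359862792512871338485218925353939473841374813247966951726141537,
   2996932983997851807570984395125153922878226647764930007045,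
   1178949485428611482668439770478695547273013055738349410708770583246491461772567516635336710,
   1326671129993036381249321875335788136872932011919949229909755759033507530840889623014686753,
   826291303934460026, 59713265148081123861152078535181676347239497871,
   65446265319996976799883059296122625244093675183069147251782365309,
   10320887263554805544743759327845099602407477,
   5428129784909659713781355939873047394947854258303290819565927384659606194432661412803927801932,
   4451986200811889993287636748003615145912496096974139199264817396374605798630374517590973511729999601300106772565,
   1937287374022578664575614188572507504688,
   76438914928925807042031452574227643449611938991890787943327930807089017967920873549,
   59666335228742044164581233635151807684418707980992828810612379792,
   3853706819972553355990468135573789729051296354506918346848,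
   1001814306657242450884859560759824421317047719918469169,
   3558949404161117424225616530757789040785,
   3065073027578424907039611532563506595752744411392878252045491481184899254641877243926189391997,
   4594946202660251799140964342874621683031497661843155807515115389122766736463350923950580020150099354291854387920981,
   61162485765306065132266674520851228230632357972,
   82623945667553292279797282813522727885304725405856005699810704881574570840605220429050303150471397380,
   207468846883490318729025508158884751559467723848712350729985900934495953014394659423110162671071422021668,
   39019155469, 40747208709, 12128419,
   73781353979127998145494822445281219241694955942435026843516279218183,
   271005228097350001143132750761790303840366342341756104717640900636742,
   4546045003468626837991117545211743980169527212015504978034,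
   296458980878554632314590883431261796139386518195424221957244245270051337515887833276447,
   1110640548583987116388608933528491120678561205535191142,
   3186948618442823497182938012073001906232,
   24602357975716798004235657826040203091418963243674732481348821786467932263036329770755208727797907,
   961061074682595330071769983120231166521757655887370617822504254295235307690048887653457994,
   3806210164219642053150570964464355823631,
   1334001744305620803352232002610761266838247330392482935277912813374181150021169283132944461,
   820825445503831982791285704541466635,
   128034742124517209395205534567664314059012125560558169901229198452443860541599266308885790459944461709414,
   4750470130104263663464529042482935452535708363608242362209894978265941520526,
   14190931940795916058177845843381563731513487, 16211496888881016370987166755786739491078176,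
   15791670508816788490864659449317166548303886, 651511935508544407840446645488816143,
   1066064687791765469938862233913775622443190767811737835667143652496593060,
   38832731358568651454144991247,
   4667317445277956138887359302132898541468276461654262076200956144170109034549,
   869296435292692949156566200821899275,
   51617621320066952967469938459442412041629325057104536324393799822,
   975183186856222966570422079018401139426407618833633313,
   13783576764276197665899299069276329536258133, 48969772696258259046801473658,
   15008731308039920856212260736463067339255865,
   87406458083188679968919807696277687068944362111289974909305275925333037074688311399,
   19196237639971281396754595264534019088170671489080529048390475134266724462514324,
   1412022502144643641089341395697440484825993744531437106358261458436134962105289295742142399642224331621646501,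
   4892263899934685822821215045646857204729063509844319781203254142197385937787322998513412997244,
   85665424508074134940042391453671817278658667280268433434738398312072719872309520645920101137918591008,
   1246621994114391638815535732684385827068322273549016112556237091697838636504460946527641635,
   3116361968281903970525791005134924865638, 3984343284390248110039036115219965870205,
   3325231479414387608462021150248882286607,
   1008563882018495351249492975087896903428659225007906830,
   981971949848594567296106806816472835741004939401580559,
   73206092473805483678041151693139383631139648387701353326132550078361720275006259344,
   80997381380553602878131749887592400333448513367699503450027090986595786232707833870,
   2668568529765795966075699125524495396989,
   263453059262948409105861441563412149570187802335523636291323323433056,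
   55788355312664260293263523509329433472496963599,
   45832595602638029234965615392604476722770831079907736004193554465,
   66068726492153647372010894946839314638240272493965279333485604917,
   22332741660173924217618239593944318260360944610313589270300952537722830559089120393204057969737742,
   58347082753288496408799727940188998435741310987,
   5229575885499379108131563476353661832719326875059951373511846686348624204980868444239811585232265840319971844960372,
   3959079505010411490426407793394641403919, 16216389705691882911318906387401149832626319,
   17308031373872328044648324430487213787166394337443489487336295308716778736070688,
   272728267702655006106740701601397615579395139371133,
   76528038767494555810281167707358527675525606503441502714425753188901121064093888656,
   4104930973466704027683346963599363048884286488453068701699, 146490894618638,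
   3029558995972177825802, 2843938633730475462662, 12361869, 12365925, 12369981, 171985837281416,
   557523982903738483, 3471143709679692877921, 3056092530832752578710, 2875084694843475964053,
   677995272952688769, 3042257458072576147550, 2916589306124548526172, 2734410543099534995573,
   486877748522741831, 2172937770149858865225, 184287630295210, 773419756974604456,
   2849719863049239498858, 2983441869500955074686, 703333106097963041, 535291513236475989,
   2768955117962182656048, 2861231907919412203573, 711776323634073627, 2808218910804452184093,
   48951303592445925673632927799, 13523639802840841977733244, 2204084101536024506430,
   6940664406445341368270970, 2709069068851899945104, 46804662211516827347040758759]

/-- The six-element sublists of `[1, …, 8]`. -/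
def sixSubsets : List (List ℕ) :=
  [[1, 2, 3, 4, 5, 6], [1, 2, 3, 4, 5, 7], [1, 2, 3, 4, 5, 8], [1, 2, 3, 4, 6, 7],
   [1, 2, 3, 4, 6, 8], [1, 2, 3, 4, 7, 8], [1, 2, 3, 5, 6, 7], [1, 2, 3, 5, 6, 8],
   [1, 2, 3, 5, 7, 8], [1, 2, 3, 6, 7, 8], [1, 2, 4, 5, 6, 7], [1, 2, 4, 5, 6, 8],
   [1, 2, 4, 5, 7, 8], [1, 2, 4, 6, 7, 8], [1, 2, 5, 6, 7, 8], [1, 3, 4, 5, 6, 7],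
   [1, 3, 4, 5, 6, 8], [1, 3, 4, 5, 7, 8], [1, 3, 4, 6, 7, 8], [1, 3, 5, 6, 7, 8],
   [1, 4, 5, 6, 7, 8], [2, 3, 4, 5, 6, 7], [2, 3, 4, 5, 6, 8], [2, 3, 4, 5, 7, 8],
   [2, 3, 4, 6, 7, 8], [2, 3, 5, 6, 7, 8], [2, 4, 5, 6, 7, 8], [3, 4, 5, 6, 7, 8]]

set_option maxRecDepth 100000 in
theorem check_nine : check 9 [0] ([[12], [32], [34], [54], [56], [76], [78]] ++ sixSubsets)
    nineFours ninePaths nineSteps = true := by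
  decide +kernel

/-- The four-vertex clauses of the certificate on ten vertices. -/
def tenFours : List ℕ :=
  [828142412824128421, 9552512925129521, 8168612616128621, 9369634636349643, 949389834839349843,
   8368634636348643, 737132312713127321, 979389837839379873, 9793733932299732, 977975745954479754,
   9794897978479874, 9897898578599875, 9893898449389843, 9493894948349843, 8378733732278732,
   535132312513125321, 956964565449469654, 9376696337369763, 959354534935349543, 9795756959569765,
   5351312515125321, 989189812918129821, 9493494234299432, 734742343227247432, 9594695449469654,
   929149412419129421, 969489868468489864, 9386696338369863, 7573533732277532, 989289833832289832,
   989589855449489854, 989789827828279872, 8381312818128321, 979289787228279872, 9795755954499754,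
   8148412414128421, 968981686119189861, 9291892928129821, 9693634939349643, 9895898358399853,
   858268625628258652, 979589857859579875, 8583534838348543, 766461474117147641,
   989189844119189841, 767161601610077610, 979189817819179871, 7157511510057510, 7671611710077610,
   9793897978379873, 7671615717157651, 9892898229289862, 979589787558579875, 7571511710077510,
   979379734947349743, 828148412418128421, 9796897669689876, 8281482824128421, 9775745449479754,
   979576756957569765, 8382683228268632, 938982383229289832, 9896898268299862, 7671612717127621,
   989189817978179871, 9889848248289842, 979176696119179761, 939149413419139431,
   929189292819189821, 9774734947349743, 959169615619169651, 844842412418128421,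
   934942343229249432, 9491412919129421, 8281782827128721, 9896898368399863, 979171701710099710,
   989289812818129821, 979172712917129721, 9795897978579875, 8382483228248432, 9891898229189821,
   868368634846348643, 5451413515135431, 989189822919129821, 9392493229249432, 7663623227267632,
   858478755854478754, 989389834948349843, 9664634946349643, 9896918969199861, 9389833832289832,
   838132312813128321, 7571512717127521, 9897898478499874, 9892898128199821, 9589857858579875,
   8281682826128621, 9784787449479874, 9895898258299852, 9589856858569865, 978985787559589875,
   5351311510055310, 9591512919129521, 6261562625126521, 9593534939349543, 9189817818179871,
   856864565448468654, 989689856858569865, 8681612818128621, 9663623229269632, 979276696229279762,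
   7372473227247432, 989589856968569865, 988982812819129821, 8148411410048410, 858354534835348543,
   9896898168199861, 8178711710078710, 8262422826248642, 978986787669689876, 979374734937349743,
   8581512818128521, 8683686036088630, 8481412818128421, 8148413414138431, 8578755754478754,
   7157512515127521, 9886826229289862, 8483484234288432, 9589855853389853, 969589856859569865,
   9389837838379873, 978984787449489874, 939149413419149431, 9392893229289832, 989689866229289862,
   9795797669579765, 989189812819129821, 9794797559479754, 989389833229289832, 9891811910099810,
   8378734737348743, 8683634838348643, 858378735738358753, 7573534737347543, 969369634946349643,
   989695896958569865, 9689866862289862, 9553523229259532, 7271472724127421, 858378575337358753,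
   857874575448478754, 958984585449489854, 848378734738348743, 9169612616129621, 9149411410049410,
   7371311710077310, 989289826829269862, 848368634638348643, 858254484228258542,
   989189812928129821, 8553523228258532, 989289866862289862, 9897898178199871, 868378766863378763,
   8581511810088510, 4134311310034310, 9892918929199821, 7471412717127421, 5451411510055410,
   9591695119169651, 9189812818129821, 6362563226256532, 989493894938349843, 9773723229279732,
   979489847849479874, 989189866119189861, 969289868268289862, 979489797849489874,
   545240252405025420, 9897898278299872, 834842343228248432, 989189811009089810,
   979589787559579875, 8583685856358653, 949149412924129421, 8584685448468654, 9691612919129621,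
   9772712927129721, 815118151008058510, 939132312913129321, 8382783228278732, 8563565338358653,
   9891898669189861, 959269565226259652, 646142412614126421, 9391312919129321, 8662612826128621,
   6356533532256532, 9391311910099310, 8584785448478754, 9169611610069610, 959489855954489854,
   8483684846348643, 979579755339379753, 8483784847348743, 979389787338379873, 7371312717127321,
   858154514815148541, 9891898119189821, 989189817819179871, 9695696456499654, 9149412414129421,
   9695896968569865, 7553523227257532, 9689866864489864, 989291892918129821, 989389823229289832,
   837872373228278732, 6156512515126521, 9791712919129721, 9389834838349843, 9589855854489854,
   989795897875599875, 9889868268289862, 949369634639349643, 9593533932299532, 979379733229279732,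
   9664614119169641, 9249422420049420, 978982787229289872, 9594895449489854, 9369633632269632,
   9159511510059510, 959254524925249542, 9890898669089860, 8368635636358653, 966461494119149641,
   9392693229269632, 8168615616158651, 979679766449479764, 9389836838369863, 9442412924129421,
   969364634936349643, 9186696118169861, 9189811810089810, 9793734939349743, 8168611610068610,
   989691896861199861, 979579755449479754, 929189812819129821, 9796766964499764, 9897898378399873,
   9785787559579875, 9795897559589875]

/-- The hamiltonian paths of the certificate on ten vertices. -/
def tenPaths : List ℕ :=
  [698457321, 286351947, 324795861, 857691342, 865791324, 768912345, 498576321, 287654319,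
   913654287, 564982371, 892654713, 819234567, 782456913, 758432196, 543291687, 321689475,
   321657498, 716432958, 245381967, 275693814, 538946721, 243185967, 317685294, 835674291,
   684793521, 517834692, 852674931, 574832196, 296834571, 972861345, 295137486, 765134298,
   894675321, 314729865, 324876159, 543926781, 342876591, 564928317, 945673821, 286354971,
   349526781, 642759813, 547138296, 543876291, 287654931, 891234567, 543729861, 682791345,
   974658321, 758924631, 267394851, 698134572, 475381692, 835496721, 769354281, 324985761,
   823456971, 617584329, 498673521, 283456971, 765432819, 542873961, 967824315, 687493521,
   517849623, 328591764, 564873921, 765849321, 342986751, 574986321, 294683715, 937654281,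
   328657491, 543278619, 764983521, 284791536, 537689421, 765439281, 487695321, 839576421,
   845673921, 287691345, 913578624, 548293617, 839456721, 647385921, 268593714, 287396541,
   475693821, 892456731, 329148765, 867195342, 782941536, 265483917, 823741965, 245683917,
   259376481, 923871645, 475389621, 784132965, 342968751, 687453921, 485673921, 243195867,
   287193564, 321685974, 574968321, 765429813, 764985321, 637589241, 913428765, 294173568,
   784156923, 248395761, 428391567, 645793821, 319754286, 579134682, 247391865, 697854321,
   687394521, 769381542, 319675284, 284675931, 562473891, 948376521, 546873921, 713426598,
   638497251, 816457923, 923456781, 425193687, 958674321, 498675321, 859234617, 913284567,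
   784956321, 859674321, 735649821, 892574316, 546197328, 768924531, 784213965, 568927314,
   958137246, 892431567, 318957246, 329184567, 423195867, 975684321, 765389241, 894657321,
   694853721, 543276891, 765429831, 284193567, 275683914, 319528764, 275389641, 765981342,
   958671342, 531289467, 784659321, 896457321, 765394281, 536948721, 839754621, 498573621,
   758964321, 342578691, 698354721, 896234571, 479653821, 259431687, 915678243, 498657321,
   973456821, 687594321, 813427965, 786912345, 314875296, 839657421, 279451638, 619742358,
   287659413, 574986123, 975432861, 765489123, 294876531, 567849321, 614792358, 765982341,
   765432198, 298576413, 542983761, 465983721, 687234519, 923876541, 316925784, 738954621,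
   547869321, 857692341, 487659321, 475683921, 647395821, 762594831, 284657913, 542863971,
   345689271, 735429861, 687591342, 938526741, 567384921, 495678321, 567389421, 479386521,
   685432971, 572431896, 847625931, 314986752, 917658243, 857691324, 768924513, 382946751,
   913248765, 275384691, 839724561, 572863914, 768942351, 467593821, 894756321, 782654319,
   321749865, 275134896, 568149273, 342861957, 682431975, 275391684, 687954321, 267391845,
   785431692, 687532914, 782594316, 569132487, 745689321, 296384571, 975864321, 296874531,
   574832691, 867354291, 517832496, 324986571, 329185764, 759134286, 782946531, 869574321,
   694238751, 682475913, 819754326, 564983721, 786954321, 492586713, 567134892, 546983721,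
   937654821, 479356821, 279654318, 692871345, 782654931, 569134287, 298134567, 567842931,
   619758243, 958234617, 347869251, 574829631, 342589617, 935678421, 468573921, 539678241,
   321847965, 897654321, 687495321, 637485291, 837654921, 267391548, 287654391, 294138567,
   342986571, 273149865, 372456891, 975648321, 286195743, 923154687, 859371624, 479581623,
   319654287, 284796531, 935674821, 913674582, 285791346, 765432891, 487532961, 852964317,
   943156782, 917654328, 682453971, 813469275, 746985321, 957681342, 782954631, 648593721,
   349156782, 738964521, 475689123, 569748321, 245673891, 487693521, 465791382, 957846321,
   317829465, 314876592, 917862345, 567832419, 496875321, 543178296, 642793851, 247653918,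
   716982345, 298356471, 345928761, 467581923, 296351748, 698357421, 735849621, 913276548,
   913856742, 579134286, 267483951, 957864321, 542873916, 286431975, 574289631, 257641938,
   285673914, 895674321, 321756894, 692571348, 851247936, 938456721, 642795813, 318927564,
   473285916, 467832951, 937658241, 385674291, 487692351, 765984321, 817654329, 865791342,
   245391768, 547389621, 945678321, 283197465, 967584321, 768924315, 835746921, 736459821,
   329651487, 568947123, 684795321, 514792386, 543876921, 345678291, 623847951, 327654819,
   467582931, 965478321, 687532491, 314857296, 243197568, 694875321, 765432918, 287651943,
   957648321, 563178294, 867234519, 423196758, 786432195, 316875294, 543169287, 765489321,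
   287693514, 682794315, 987654321, 782963541, 935478621, 567834291, 245376891, 753291486,
   298376541, 635149287, 564732918, 294183765, 913456782, 259361784, 284657931, 938654721,
   698574321, 913578246, 823456791, 345679281, 465192387, 784653921, 342875961, 975468321,
   294135786, 685794321, 287394561, 684753921, 498653721, 923578416, 913247568, 865397241,
   465793821, 258394761, 765834291, 298657413, 947653821, 745389621, 917654823, 519732486,
   682431957, 345926781, 319678245, 542981736, 419376582, 736429851, 915678423, 517689423,
   283195764, 569734281, 483297561, 467825931, 324956781, 692734581, 537689241, 867594321,
   498356721, 543271698, 325678419, 287653941, 782453961, 568924371, 635482971, 865432971,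
   913457286, 768954321, 918234567, 935428761, 639457281, 293456781, 294173865, 819237465,
   865794321, 937658421, 275483916, 549378621, 259378461, 923578614, 579428613, 859374621,
   937864521, 259134687, 571234698, 298456731, 895463721, 859476321, 738654291, 692754318,
   564791382, 342876951, 958476321, 835697421, 916875324, 852673914, 265483971, 957684321,
   975846321, 813456972, 542963781, 298456713, 765493821, 243189567, 682794513, 284796513,
   843295761, 965728413, 479586321, 849756321, 958134762, 243196758, 839756421, 713456298,
   315478296, 843157296, 692458731, 295678413, 487653921, 342981765, 869754321, 419675328,
   328597461, 245693781, 896134257, 314876952, 895647321, 342956781, 935876421, 786391542,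
   543278691, 937456821, 769584321, 967842351, 857694321, 418396275, 574869321, 542876931,
   567832194, 537864921, 837654291, 835647921, 567832491, 328946751, 642857913, 684957321,
   543268791, 571238496, 765431892, 643197258, 967854321, 283197564, 694758321, 316924785,
   523871694, 568947321, 546378291, 796854321, 286457931, 682435971, 574962381]

/-- The derivations of the certificate on ten vertices. -/
def tenSteps : List ℕ :=
  [246979459997497792186363262558973955, 255741460597632390353253602131939333,
   275861610885882581045791390773522435, 180453153595323873404698496854544399,
   204467526566047428123723985072623625, 234323233502641604129450878426247175,
   198626192445491092564781407792197639, 203169454866489478489779477802037251,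
   255092423529492409163428452806864899, 297279833067251129519812958445277199,
   318698057221756583882297636248989707, 181751230247425888405759108482969607,
   199275231487533159819048164748603395, 292412056348844336063317344990425091,
   189215155550211088126679623932719107, 313505763032699901970823204856901635,
   331029763266773125800316467413168131, 333950430404488685705319314255933443,
   223938642300222554790145710075949067, 231402567138884194119706345530896387,
   310585093612352967781815454582296589, 191811303979478478868441031963799555,
   342063396296759688343493190355251203, 350500877492388346385169720244137987,
   265801534987538973001172643389632515, 188890640303984650098535730751434771,
   202520336635131081343282521565212675, 224912119275276378164636744315056143,
   269046642572869689707493894824046595, 316101831576602604286462368649277443,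
   319347015139596480107013378304266245, 321618649541848847974818187929972739,
   348878287257796852031927278333325315, 227832784981132650770843224160595971,
   233998716226024374259200229213130767, 295981681404258141970278184151855107,
   240813526353728976385429489335119875, 244383231101721687459657392159191043,
   256065979190089803167355139021459465, 258986643425958461400626078390423565, 1077405,
   315777312519775925044732261241958403, 246330341533770616018316670726909955,
   260933757882171854596076324763627523, 334923985136763382582264691681333257,
   1937483481179006699651086, 207712714540572376154288137330528269,
   248926488956985157358277557085442053, 270344715394254108474070566321917969,
   293061014963195537279962329786314755, 321943168095119906934760345367621635,
   342712434738655141816637586868973571, 232700641663059477768057197595160579,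
   280729390989895646226678073717338115, 307664350226118095299384575017693187,
   344335024082901009735400010562547715, 197977080598035488729632741112541195,
   205116485180474219465626140861968387, 273914496816893695585091120261648399,
   278133160566188432762060738151141381, 291113901938633481252021871401152515,
   300200501830055731570006148113412099, 337844573781550951536929002133925903,
   188241522711893098240504592446173187, 195056410017025202782365659777118211,
   197652637945320712894837431359483907, 212580412959186594612034890522275847,
   220044342246430580788083461863387139, 303445606397227551741132236462182417,
   309287020674779351810522096526331913, 336871097464785801776455090185056259,
   340440722210818365351753213247180817, 10121670257676091171832832056,
   276510570583185772007634957754847237, 6446535766050997142955712626,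
   264503461972395792860266775886278667, 8226074572520352900838727776,
   349851760112113687038467235962908675, 352447909585968516116934105852776453,
   324539393857133648173455137443393539, 302796650104561677203802454770831369,
   8845044566795391137504288842, 180128639355764462237974990732554259,
   303770206577774616883424752619483147, 185320853407272447094601554856734723,
   211282337854764528092055742701932559, 289491310834267217052049565668200457,
   347255612882308454267948313983758339, 263529824877657803941816690565885955,
   9889556468018703905994276918, 354395098588448849745970920923320329,
   206090121771760655416860309222404099, 249251007742785608773203039571243015,
   272940941774926084823938733307514895, 283974493874290013736186576751448081,
   337520056117680900534606429407064067, 342387836976252640995261777686147079,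
   345633022512373994153293786617884675, 246005904026678588469881359634354181,
   292736494706916209374823403948945411, 302147615531332911491549858539859975,
   306690796073570665576532875223461891, 187917002880862754490503345233219601,
   197328040937240540720216399256121363, 209335305257874607784572712410001419,
   262880788775978217843344689402187781, 298577911440740711686944053975494659,
   2154712348964735416934438, 311558651014672466678015644070998031,
   312856726312777602906645038853967885, 320645091985457173443334236843544585,
   6543249831617915676983975970, 185969968852812447885677996553244677,
   195380929769975798438038313311547395, 1880815089016546540011554,
   355044136469695348247758545317752835, 209010708366162978970758841895628803,
   238541897251860746593122165199138823, 242760716903889260839118318938009603,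
   252171676466942405016987226026979331, 270669315826465519010475523158274051,
   286895159967125371653358010348425221, 353096949246763471051199196784930819,
   256715015485121764231186879880007695, 265476938250522574687200285530009615,
   294683606144999137081058021406707729, 299551383714678703642399478160453651,
   324214877180105928924066215786524675, 209984344492815739757563560560439307,
   231077970517622463767273820719296515, 190837672417304461600046170860302339,
   178830483108024230445152821431324677, 235296791755950506502929832055320579,
   268397606741592868384698075349069827, 330056207218809280995144093510258697,
   1611640202871226508107850, 217772710475745463405425085135450115,
   240489009618823808983390323621343239, 7974618002040510307445022856,
   304419242098952391624479751445041167, 203818411352753480121950262874255363,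
   1729699356497067022442520, 280404789784028430276766147063541763,
   282351979444107697558903584585003019, 286570641413466806543343204140716049,
   304094722307099086171855933059878921, 346282137106934061536736135564578821,
   194082855284523827696921936010833923, 249900046746463232986282094701424647,
   300525021041294264736646829162852355, 182400265923383965419750943890264079,
   190188632137785183824725706128142339, 216474716030995867894484130127327235,
   276835084803751880527247942426529809, 287544198738245193086521659359653891,
   306366353188713710559870338491133955, 316750868064590496734962132826894339,
   237243504228735805883404678857183249, 238866497568034214006788963136958467,
   229779896071092295203773280422285317, 235945830507680457228230477083947019,
   255416861925966479042045801792909323, 294034572383733903040176411338059795,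
   214852041248524336651486695350874127, 2286938602038772684259382,
   266450175721844366053840401392087055, 289166791119775548653388095547559953,
   304743684654905952027451701384622083, 297928476471469335845001773986263043,
   326161909196390572430168066808262659, 7607104552877662900861755508,
   221991532700349213901195118989455363, 326811025608967150051144311010471939,
   334274873037766145742876572899258371, 335248425971338672959040934169923593,
   258662047694664494467154125488091139, 1824146695163860252000354,
   247952619208080997763643898291875843, 339466850875473183876933595139584003,
   283001020788227890472704212761489411, 296306199919618254916273130698829835,
   343036870678762142866784619185319947, 217123672865090396034835433495285765,
   221342096724646871842122329445511183, 289815831186930114085009519850729475,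
   237892543619024101683668518386708487, 243409757319596897865880615388360707,
   264827979984172071227160272656658435, 220368935888851718026595261873836047,
   318373464005066156022726145973301251, 2575002965940133840969806,
   203493892412182108896895714797465603, 211931057237203305743944738033717257,
   6891420469972771888513540130, 259635288860765762047000056150102025,
   265152497880240859127551685798023183, 287868799092773635792771806407077891,
   293710053830519558637115481415397379, 310909220281727406701046740074328067,
   201871300650235807412644393546592259, 239839973923825115723946641760530435,
   248277216564237261787441530149801997, 1833591426439650036105330,
   314478924448382770407808423841370125, 324863594840732057271406917921075203,
   301823017691922711258723657579646993, 179479522943357751461496537127170059, 1056833,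
   326486110857331868818846410410045455, 338817895105171852462753843635531779,
   329407170730707977948316012745240579, 197003285357109121558812380195516419,
   199923954215900708483368595946369027, 210308547952313176853140229394427907,
   307988945840948896316915194675220495, 321293812257495259222153785806139395,
   2320187694047557767684146, 331353968467000717136738334095888399,
   348553370416547592451543079189655555, 214203087412546787945922641327796231,
   239515134104297557779658465442484241, 8593587994004636098560917598,
   298902113082561332992985122883727363, 323565523082418223205910299842203665,
   199599673269575784803695167833026563, 2353051733362035646652484,
   345957620274814326953871536071815171, 354719222549144801872249976223084547,
   210633381677815595648068603693150211, 2003596618697057289683018,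
   281378428019605101255985260660961283, 285272571435390931363231213358919687,
   349202726603424265845791704899899401, 306041836299075678993658078082445315,
   317724105497340007897396289456492557, 2329439901510775014293598, 9986270568189601100384002166,
   346606340392978809353381242387263491, 267748569634313784637371158074929155,
   347580133835132141435811322646654979, 1069169, 7336305141611053730436137054,
   252820795356353177581859199915290643, 262231833373757213306938929568722947,
   275537014884280641404469973430792195, 284947815294587074505550483805417475,
   2480748171355411349536820, 184996333886303366406454603361800201,
   208686110197353616311443185354289167, 241786768429854001538552987570745347,
   1843036160530601669435486, 1975262415294314773397598, 332976716055036808404232162689904643,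
   6099153709837362891155791920, 1512663032234584339423286, 233674040067313636784115631928815619,
   271318036001411775261828854281990147, 10064430453539479589728002102,
   344659227890786016517668741249970191, 6253107637219625384022343734,
   208361357363382205915503245155414027, 212255577880008390266675767493701635,
   218421749439641773229073713699401731, 249575530532907323025482202078187529,
   322916723679720455423917350174502915, 180777517929215096413428096434761731,
   181426317372010656681787089406504975, 186943210580677031383463668493119491,
   2050820277894053976383556, 295332567448643860055924578290151427, 9057815536418033210333995102,
   2513842776389613944700958, 349527320670560944316284376113655811,
   351798637251513636981348788796616707, 356341815704349856958388794292842499,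
   182724387407944900355983504514314251, 5788880120179512971941437514,
   183698260793817196520655575044370447, 211606939041288930927005367869640713,
   212904933969561856629302258512867331, 251847160408610851996259502260645891,
   258013090744522541586059011509448707, 290464629352419804792797153831817233,
   7840162785849466890473742472, 2452413973587391584460858, 206739002299581603289043100571529219,
   221017897811305875994336738553278467, 1060933, 343685911093435417920075793168568337,
   352772189719810214967036181683326993, 353745668087669442455795112941367299,
   220693379277316015735200307606630403, 222315972045608147063836165888192515,
   228157226840886633066769323531726863, 256390499407466273722437459385651213,
   8632275022190486907661967436, 305068282514258761269483296344100873,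
   336221665532279328782134134314283011, 186294409842120805371203195320397827,
   7240757502868431296182747228, 251198040571808369594983466901417987,
   274563380013635418511507727338090499, 278457759238109404916314868226977795,
   305717319622029100306377090688790531, 2234992579173519385575482, 1781837931893864484020272,
   283325222525487342372176229112221709, 8574245180895868581312766022,
   353421386676795758584098150760845321, 5944411158812080460202614808,
   207063283188402341772746496236228619, 246654784398991837460316946054688771,
   247303821506308690942036940352040963, 247628337874625916862194037330980867,
   308313309516976753908274615038398481, 344984064613593435293147391387406341,
   200897747541992257292794133115187203, 228806422403876678619916497563684873,
   230753136328515790345752595593867267, 178505646326565038461674592957607939,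
   6002817484341265679260196934, 189539360519009812798120675435573251,
   210957743497008908331987139607834627, 233349285957056621965111752116465667,
   272291750061033060530614407033696259, 322592201488748970253049974904664067,
   2579725331858403795361906, 266774776288926637143180842610618371,
   184671582193954470117925164501479439, 6215210646191781731448963128,
   6699158761050981538963267678, 1706372304137645426352222, 7047330679148703739883528240,
   236270344592469006196558827751215117, 1810172130790671179366456,
   273589584482812558339946049437913095, 281702946630857417373004190584410123,
   287219443003314529097794513734914061, 314154642148495437200206896675598339,
   9426273454264639740300181554, 328758057683412387667881373848481795,
   346931013939710916955578777242611715, 192459948196397165437460285716017167,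
   225560840708246806075944689402753039, 243085159460409366829481053544329219,
   301498578346777098752463666180960259, 323889962466750339490614672984535059,
   332003164011677665267982643774091267, 347904652311419290327791646011469827,
   261582479333403692188419469659557901, 308962188226625224319539632736456709,
   335897465826057503742657744991334403, 216799234197231242300115243745062915,
   224263001779285007322967522358185993, 1073305, 198301676638795389255931961689681923,
   206414481559968012804719368852385795, 217448189252164930855981742924926985,
   6834180654303567009387094072, 253144917768178976469143580301627403,
   254118549253557826144928714327535631, 1048597, 257688256690536908075100178487824427,
   269371241534890343421777686496194603, 271967231468632332248449394441736375,
   2343891772007934918525020, 343361154856361538578201741845966891,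
   192135825841579742447324749652881471, 213228973575569678581978695121326163,
   218746347124710865134496751932387371, 234647597837113673602761938417823787,
   243734117300358658683445323325747243, 262556271344911396627692208986894343,
   274238861344326349620758322230882367, 337195460870212492896513139432075271,
   340765164843888156600691562897412139, 1663778764191250067456052,
   239190857665736036366635518562906155, 9212558041329268694347898994,
   9734813997706379707421974562, 1427467910039447783727198, 189864034936711490447048366576775183,
   213878408990632422711356865542393873, 269695201912135905978182752130535607,
   2017956256037348086882360, 2206850917601321798574134, 314803442963261031324966964014125073,
   351474039430582146745260829951209515, 184347301208660652061506387893776427,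
   1446357688969588101128246, 222964770268838298077241091901493261,
   260284722090482825215318414275670079, 9020296337017477438248460364,
   312207373801866578431586183491924091, 323241163063235422469895674705178667,
   345308424634637196657500778639470635, 354070579570496825174593924835749899,
   179804041497002071040744789490790443, 229455380264783968985355980139483141,
   250548769378631523156059079161057291, 258337214530509761031810677268549815,
   264178786238849101570290822435459089, 270993675923893431390232580132089871,
   311233818102234203351219437870665891, 341414355977808620473764382008676365,
   350825002439713999267820245273227367, 319995977526684291274551814116282375,
   193433741522493444700144637296930859, 204143012326931981682156939885522955,
   237568423353759379288434756039061511, 288193314416021769667337959422169101,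
   293385614582994714105350016907784295, 2117303500957508698226696, 1065069,
   327459745765808011176007217982451875, 329731692475958948774596759479914619,
   183373507901713399364600431584432145, 214527526698960473807745608462053499,
   270020199472092107105856767144472619, 303121091887218476158326752711700499,
   9348746359103114582994034712, 1052697, 394645788708311219, 1470199792686332929155190,
   198950319326630609356537086974889993, 250224567601774726234557251693523047,
   1933201540284484199940134, 281053748514549920735331576619618309,
   286245730916612955490812138797928501, 307339513405387659800680910918701069,
   313180929366132712561081123634540643, 313829807978042132162815388830462011,
   9697889784195228108396290076, 186618614191340267526567265697533965,
   6158197511033535973980405856, 241462645920279912343997801507745811, 1786730093085899958214708,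
   6293598294648728978322587702, 202844858864797778170899703561605283, 1564856954620514501345358,
   213553733489733390567116886963277835, 226534713281843822960512414758817875,
   240164492535516851751530406211244049, 248601974833151946225441002739789887,
   259310770288694839975512893897142415, 8189194210388205908431241334,
   279106481290049965472378601073168389, 320969533129597938384144913316597923,
   462939258230165633634701006288916584080459248075280575,
   2795355173651409698427767178444048772470090482641353313079483,
   542559380693413116845174536458362581232497675609706646,
   160571657028580982930065007902344239946479222001188961,
   9814616968918688213729461584543415978523066309434746424847088076795743260283038,
   4849286988529688133864455479113981799323317352923536773727042122767728425135200123591379502931232033957030417123202989702607406824267113980966037206181615712985720810236326182882522902603,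
   100608028282112501361320694954135794954354450791926717872042122977426,
   20000979057804002638615500413006825552819173508981924136977875225235104175905302399965283690290943038526132726636672787716613831849541442284398721033343588244779522010363085404617553058672695,
   23058951306459794803660328468489909752828699405301641986380393195668255207586044876181101500978595811182884043735985040050992582150852625099619838866387271580099035061780189576732731962244604987632235716456563,
   1817188735962308542620416380512468803658,
   772580831921426200505159270498303499836986134440938406094794192213355675688456973899944788269468071666361883481979056866375778358,
   18609986576646768029269789285654550560495744473594357703682937126416503865812102379573267699308237349498383461117530047974231642538614898226941320871865997234773076757622933,
   94438067691329636288062262210984583316876233847719528115237193581096335471199795748840826299348883227788059732838354486369790691738231523029002716042962815728275686393479379884148313799678583576378629513668112461,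
   1365212217074063636792135515887915000437846580003863895617642414093756345577624720504020420891404328306964397519230853097499357070457920478117292692401292861344222119159209011173325483336785703864094891,
   7569609546624738432200214705395362624303218, 503044589927772643890934731403599988,
   1465649919219696108257330117176154813830133805472186802271,
   514357662875684319005777011602288584449787528002969577858051336820356668163494123641177408630343013046304926846508690722653451508967410352469908942696613717576656324051649925776951723295461347991426089305914979840022506837741327333690279259845068894323,
   1699972632700335894324600511694367356931865872124385891458190260775310683341146597516973268162330103300732954647260216837329239017261483247594954867442006169290764365,
   220443056257571535419461583202221358998830241073799567345975451238735261091080159300439200578905888717520694733726316945159935179345816500002901,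
   4234519093705749358066994441398270038347491195905045343576701851440556448586969680110009590564704853069157960308221761252533056048309844110130038658055638108229528346686,
   5244657275173531508807002859950142381003568313720663305918120217720345660250069759992642744845156854254633018142667827383744481969629167900030636716855955752477233334,
   88248269474421276572111542395449731280697797126841660277612165353891179855259876079988663622706043964602814494380843642588965000535876241299419983374633439417,
   125687837321336997609252018985841204297448743829114308038176265307058359,
   103141105948057184457847485361955420682288079500652742684681204119058586695361806850393756709460357432757834200626120679509,
   244147126009322105295414232567552476071571871146060337479318925905323392566815786693770754582484678172627236866771052434958709490758023695869622718273853390856,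
   1488305578525933040721474773827184571993815238110703223411228502495307378721,
   91934258916509287986665198125076798533380412188246494604853549528013887321453220686710933515163405867699704844201568052498543910644701257737,
   160338893645399013964392259734003744,
   1247307393559490258478335358171446205829229447944811543339231996750544411645739125590766885292259328705758814225,
   14294492420812925696141316860601102189955462474963958437620113253605295689497186357,
   37465629031379725451869797168351259391527199975274829106740598589250895204898609351751344746810700173502056422075094802132122161141701624609719115496967988156140668083939582717872096747225098,
   89566318244291931217295571761128326796313579495445457639552547295066156970922472895790863861149259741447639059046796835509715340699085484851721527667163008653745175461662734,
   33078888704573427018451576688254969546358788131,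
   9529189200573128000431564314705786621539987230525739653111842,
   830315663483439016858891925585067321052068614592230060509490084599211923337484019078632622986499675765923962,
   9310955847480088833041745899712201163571436145541737150644347,
   466891674361385284548292582409229721709705607121999277082697983466825568593997460290824703034690233871116579511171806804957514123256117971930810528776000665014347,
   42539436852704058516985423792627039945227787386266325224420049186274881685804668338365,
   3291423937974752748738666387698444105490967842782247798947990,
   196115364879781142290959209510653205848550988927561887, 34019586254379531125692293484732,
   2434196050816881594826329200206421332692875440620355457196,
   28873674925704989181068055036440937088991567005675992043123645251428049833110449536029606984534347727394585194212119209379473193489924559789926771978281768170361165890285666,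
   6533815244404206366737720396848978111210106846460413348791138840735355093688985907296158318873536682274261823429032680337516923052399002228819674906690202330673304329603769487634526093537857747280850834445457630028326723642,
   45932442844006547742729990637864668138710273087898013698050142621755,
   143900090353210746013531204881423744695745815541550273869494322061632084640443570826613955269541244625310881329324300966821067448844745486429,
   26767070984398617176261522345000030193862143655230043674022220857102342095525169022480796256818600254045846637940185667563515234740712429400028437994802776855875977484101446784660558943769442252420852493334592718424439460851787,
   433769331077776169502114093195175220007433571651887178,
   95062673375585187588519427160009700444381226950201992699209023262021704970050481176295250707084164474343524890611890536032651982469566957881161631591611607561316857090577833597550419590233412256961259714665607265,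
   1573018161670222739113875237783409178017927982810054511418467459078741019117092644245113613788397736300096436017839825911789623286723726327396789739279464060892884791118145283957548797196285059777756724364365086069452894,
   6533148722798016370797727795774220640875026724055525488379963156131973565394096286360117360282992262411532032878020966129389492744367932687231441185042711510484106656121223829457137176707746656412311889439744671525704024215,
   558882412243478214364618064247867028709014489455826455151654524292388622524,
   5590680098372301231661438405659865910989393373388388803752390008734262219354919352028117919972741675628582348888518450483645652582305359588359738887094308377235590721998483157622495766129833293387001098406,
   70562179819207577811809122919055863482167159054853780085930224799008319702825716377726274230761967793491441155274537977659936074494827388414405098593328831327727398813419573343,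
   333202258546962997580701067174435809440369757019379071038524922114221479702257405067035740990238664346684842855172722836878689305746161788821879591660755014719038318020888376708483111564549959163960,
   4293174406541928717696195937853201279211635570510284758495522498318818091260454715337283688009540778788907847457655871045971518968503978698434340500254537751859977941006,
   19425102747240663482241189842701043088180785885295510084612863850897795729565047625822343973803990738461117980438735147762339184415909585304124117442618,
   2099970597414665524383156006481444735845788009530273099815,
   1285600108687438518655836168726598352999924560363370726553037123506900850357063207073182093327,
   498577871332146853698504499255455465838841596953431799875171966055449218658830448402796657562607174741003379811479163039322124379445558491790402961686468866084302007531241806192697,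
   262087371858843486103184045787918549757930883719277651203462289669008452271824998737423888707657703681774944246519411175976665299267300003695652317081728388712751474826055353024222200914978173110,
   3231560437991316736597667439014929115211754010640070253099740252179535554277462036375420983270145308158131927838263494875308706107559,
   43968046158409803744489534360014964638783437825524047541294833466702638823739383991,
   1388987657201157649347401529160882784502562606160380115642709000068480828562649339470773029281150181128748683744865352233650141759576528013713765874336688863382069574659231398554702844974676098591101005,
   224357663961248663577774102521737774198667169572391422878785755534820802707411388661850209,
   5688758137609831414451464115260776031389194162267666637393441264992841471555402456202532861415683663158135294343757874200262008864652552869046818777334161661410090493932086227677375273167742140803789185190,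
   3997538937703258623792692587719688545876788427478956018950931321151513183225810263265035739205782,
   10300335114846790386853350537957369314914866880093005274084298896199431963934887,
   4847710148112428197558636828423067100197562415813921413543056874418698632294461746386551660877872886026094011038455535419019274605496727307997666589903785142377727884780222366995169280092,
   23301309962064723252359355168455928508049076041266830868780706880689982774874097627940917149561238149132885351455815002992892511094243401720021111725844565577524444335147628593061825806118420085126602739286202,
   571274982439872090537071685944764480820264874902042744282738094081052768,
   254221527271458942099143394440320446434108696707927838516302966770541962851794197850715294976400146809273984417554429653820563626894807394413049694772176041545894,
   4206784426368809942948130045896311428015753184171203252626536308015844189993082398127067697573922457338813525359994271593172430946968632820833534711618632630882766950454,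
   17472519403146339190474522690856892927948855388101946422328359085761282266047011930770015851139826414029924263505372604527666854281904382532783386703430548708913824559550657,
   8583781884912577899992224999990977439691794361381318145471019496447861450174561,
   23059108056775309170624000142305141514711797055327080871368967262976803265401783162527175206755765303338486712122137580188277500770806874931791482241183563342721949394856626377294582693424700938392898428776637,
   67001660050853561042072508843689984344192000491484557802555088485848958958638726579329179333739641454573004803236199194634,
   2780969932346724961440382160954568502244229803670784150332477511544968585572363,
   98527552565998823263158830762903885138443754971418199376459168200023843833920817567427726769654739218156969051414330224110219691297718390686642730556715147449,
   196748140116515817076126347707078528796712290472911478530416830370883244435752008866125068089683382068112726686179491459130,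
   5666583147494547691321226571267833192957460032127960144290811425417209398209094133775047523337005071095626679348082517380345224390712220260323161289487643714063016815360811347931265687625699063060748820619,
   218562817749040260378396084869821239054274157514572974992021089409565961212397595113278241605351782346942,
   22890231401914345209334571645879961470438604289428554800866833778509229138020783187649699578302294583898796575315824879854998611286698920569099159223178064119853211584310762598201867857715941473475269367505025,
   449249788383372398270430137890424020090610483012943980859277305345639372592801785774109146645197806351689915197593988784979144621259819452289377076491479714825805841745671906952692030575785500960610589719552585262270778192614512119954,
   40339837298471737247405538977957765308050530451098785398679731930666050959235462593427302523966451901,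
   4916782342020061509838028166320009876915437207005699919466774555148169867768153606267119283713581108229970987574219318565598812107331850372829219378896931182450969774525495686459831218323,
   4880325160189661054420020927577392909218900288777680049832755442916532505348376792107362020410581782798685021831978083328816506357679433760454494659289849775418197807521200275213452406943,
   11924570911377963910492132448553781942652542476957930116576787267749366464345516989084974669648023,
   11926190069114305839915159466892420533448643733058201002482288250347063136170474216271410125988031,
   241009625817210223148174458645401087232283575124938843781112755776996745425958324301149037467625011556835929444567132917889,
   13408518411451590830147517044743566782691520936515836348947170051484951902065894774255000360042496189,
   46433079605185102645818106032566236912660534263927,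
   31396251130882673741191893519240534453310533827439632101317263478,
   2848437423677357765613226475111115309771997529503493582872583475122945614433502143378019131488,
   10087448733472814832940136108162249565029065999354781191262040183,
   140775482775380157383242816664775594791775164385454785772270931973628022,
   831166045726236744153320775688826265876478142335796502622,
   16311534583529238577218063219010417241168580148663048064386381394547437319837035623392431784233554078,
   601258760282825343345396585091224066064443571696541495435,
   892882766301277313643908132026978676667885173620889661056677588842653547720951030258640302175,
   1045863643024117641287977119940362984052523317966150489004112050061153586279571724921011631330788795291271639178,
   5629516834578874848153568540208014549423873356079532025832017793835589907632087558087538401032809103088200863277985371383748330184977927044697936116051135024904236320653791621325758694017512501784009470067,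
   40027814872643236963007938487301279672821376490340271192962470922412717608314208375,
   613626662315234621319905514290301395055026615425425504,
   7120497068638402667849500168300498239166342340904512916283510,
   2368064356674691989788473509418781405431998339565877365322287191193683746931,
   511628184419127162443357860299914401617440553937425082712651877625647294,
   5629516834578874848153568540208015092873778949204581505552984105503804428060298022115308271066216937187039096594241976125007409193786974801003396360482214869303013436162736944706614985671310105176013820010,
   903038389776436711587061717535880189325869273199785558280866505690038865811496436236711002814027547048605668212519510076854707211542132667403317333,
   778504840943462698882872601454698605722077870943956824614595864123844895104352580836531263207884781421316894297802322193065593314142697112265494601772498832841525909827853110735847880448131432960907552438559810232485,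
   4950701157948652616901995397675439179724622188744873088398834622959572545813050759014061393290764877144874067068625142394865709341290425348898508812586430422754751012654616987393543168010,
   19427647283027775006088713212476787530986766774110860057873739072021513498901168334452561862241526495462202628649042443549525379938770757369390390513675,
   7687617920974825266675948146022861826329895019531801190313218178803642854354838402395457516905410397310465585199790020266678193073025449912493488946251518275095834889633007254605287104596,
   26772811190327572499724179205224651423538918450216382442886499252209881941831327894613822046358932087734830510038349610691036891211584680122277055317981715096011674622647807855064839876404768839124695263822978455101330315563066,
   4849145793605387445330550994008598602801688496500138380695069502313788260437963541854161994496177617326377818193694302535863069837346621352052676965188860402348086134238117421691206410279,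
   1388875627316944434794780359592755667049362797266539538623951737528720414730801742139853341764858343625794864825476157643658831672493444943575826552915528174291080780699735929013738732555535392813670410,
   66863406465326644996927285065531753075647864975581527878516472559645896510186361692979389783623203700818744534646609538558537050360494805003,
   732718424236033802093975635946757692483928362654582878225645074607171797263189289535042371735104820078391340632827998254157909,
   77645649270517436289630205315305750125225348102799575097646104722585908960723409741068686834423566584940153244678117896747529647962942664735,
   811176255516688018612772758497397430322908935038936838770957334834485151079343083511642496231671327812971011498986205101182991,
   65053103028840052016159267712705781440178370185157284688788807700849060108113219226678619408637699062750594029448917006554686345791113382059609050361647115,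
   57775575410766068546561173053425260211840789396000262514228256978953972108887294678918585935522485234527943383070656440690189285244472714659645959627886620,
   226223894277638264647366543616642924281029117195271207454353716247949346078669910519490329891587697823210093459716036459985927897463145056763717066838903252105864785896177804682468857211723991628271072052341657639,
   4294682187635278115408365344305456954999260661145080371870037615752291186493894567958276720479519941935268343933034186434521311959663455641010358451982680714818145145029,
   517181883129073043277993863107003955357754991686344866,
   42428387778497876350455172543516381845841222886131409656870205873373362491526348848,
   2682262161688805562748542680086964999991837744023423545409663548663045229804529032842389011796448689635446689959,
   499143769663798976031942109783605414,
   203301334441032056174681372861220303704880647371232891472919341143438377683379195896001,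
   1971673903366964754083600890249481965751,
   2689409577268832232625570690143351660521495199100985116151002008208754188105593284567525277122598,
   834823274383020173536249836047190013980274513921553206779936300384490397849367550570041809055592184860619660985569777929182470307,
   33226484332563623339675717068256531417895006977517521554232713274,
   16027170987184351635670533713749207278378893868011277161351408236130667946724321740506405988365342882095602668333005816925457343987749,
   1918822587266861505276850361091409036507144711172308738084,
   3506016374148098578463668117241175585878895685236072539517915084957992055455816235376567482349416612787626955878986510765547664674924163403931635796,
   4390281490676996202516354275370838845782158673079472231745817093826890990307118957185546227673756644309911527177714967802981670172886462605610536999,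
   2442322415181387019776155207253132258955230743071539231331456116428506255533,
   8055688447574296647969394189851343116784473589627764777078382073779514090598564,
   160301302507158624434858334466290723342738705985757734886932939216522635279866958767612067,
   7192722658038589658635635723486406178906277,
   132809935814191479081000757494731595899611211823396125373416268259490, 116095499489318,
   16259975088877487346540776649017974817756352121890980892694227037144666464694326307471345194276119522716318358862464982420495695728802,
   2687291133050660459973898997105189800124917180366211178957261988885036834355993721697405921939485,
   656076936779946401360815184840134228546314246615379018675470012325222596309067290740947378339,
   245650237596411325645175445663488850572890066430151873924272573152169203427244956539949191855253836243316988631062667680822657058389363559911596,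
   272794297764882173345597597617768489943109155508556757385378919388178608044848216480893552100237389778906575346876638562879166152448818704549,
   12466743609450737739781387400814550314361710016305096297194458095293150517984571412057257305018191902218432120130549112633689974194215,
   28343664802, 22554948203542735795180408891, 28410777782, 115271057158309,
   1618019332360686420162, 474683456147308716, 6479387052431301296148533,
   6126868215119690905309241, 6971529, 8712158936013003220536946872, 9872727722843047221560770746,
   104001046230698]

set_option maxRecDepth 100000 in
theorem check_ten : check 10 [0] ([[1], [21], [23], [43], [45], [65], [67], [87]] ++ sixSubsets)
    tenFours tenPaths tenSteps = true := by
  decide +kernel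

end AntiPathSearch

/-! ### Anti-directed paths in oriented graphs all of whose four-vertex subgraphs have one -/

theorem Oriented.flip {A : V → V → Prop} (hA : Oriented A) : Oriented (flip A) :=
  fun _ _ h h' => hA _ _ h h'

theorem altPath_flip {A : V → V → Prop} :
    ∀ {b : Bool} {l : List V}, AltPath (flip A) b l ↔ AltPath A (!b) l
  | _, [] => Iff.rfl
  | _, [_] => Iff.rfl
  | b, x :: y :: l => by
    rw [AltPath, AltPath, altPath_flip (l := y :: l)]
    cases b <;> exact Iff.rfl

theorem exists_eq_of_length_eq_eight {l : List V} (h : l.length = 8) :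
    ∃ a b c d x y z w, l = [a, b, c, d, x, y, z, w] := by
  match l, h with
  | [a, b, c, d, x, y, z, w], _ => exact ⟨a, b, c, d, x, y, z, w, rfl⟩

section

variable [DecidableEq V]

/-- Every four vertices of `X` induce a subdigraph with a hamiltonian anti-directed path. -/
def FourTraceable (A : V → V → Prop) (X : Finset V) : Prop :=
  ∀ S ⊆ X, S.card = 4 → AntiTraceableOn A S

variable {A : V → V → Prop} {X Y : Finset V}

theorem FourTraceable.mono (h : FourTraceable A X) (hYX : Y ⊆ X) : FourTraceable A Y :=
  fun S hS => h S (hS.trans hYX)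

theorem FourTraceable.flip (h : FourTraceable A X) : FourTraceable (flip A) X := by
  intro S hS hc
  obtain ⟨l, h1, h2, b, h3⟩ := h S hS hc
  exact ⟨l, h1, h2, !b, by rwa [altPath_flip, Bool.not_not]⟩

theorem FourTraceable.exists_path (h : FourTraceable A X) {S : Finset V} (hS : S ⊆ X)
    (hc : S.card = 4) :
    ∃ w x y z, [w, x, y, z].Nodup ∧ [w, x, y, z].toFinset = S ∧ A w x ∧ A y x ∧ A y z := by
  obtain ⟨l, h1, h2, b, h3⟩ := h S hS hc
  rw [← h2, List.toFinset_card_of_nodup h1] at hc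
  match l, hc with
  | [w, x, y, z], _ =>
    cases b
    · refine ⟨z, y, x, w, ?_, ?_, ?_⟩
      · exact (List.reverse_perm [w, x, y, z]).nodup_iff.2 h1
      · rw [← h2]
        exact List.toFinset_eq_of_perm _ _ (List.reverse_perm [w, x, y, z])
      · simp only [AltPath] at h3
        simpa using And.intro h3.2.2.1 (And.intro h3.2.1 h3.1)
    · refine ⟨w, x, y, z, h1, h2, ?_⟩
      simp only [AltPath] at h3
      simpa using And.intro h3.1 (And.intro h3.2.1 h3.2.2.1)

theorem AntiPathSearch.mem_orders_of_perm {a b c d w x y z : ℕ}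
    (h : [w, x, y, z].Perm [a, b, c, d]) : (w, x, y, z) ∈ orders a b c d := by
  have hp : [a, b, c, d].permutations' =
      (orders a b c d).map fun (w, x, y, z) => [w, x, y, z] := rfl
  rw [← List.mem_permutations', hp, List.mem_map] at h
  obtain ⟨⟨w', x', y', z'⟩, hq, hqe⟩ := h
  simp only [List.cons.injEq, and_true] at hqe
  obtain ⟨rfl, rfl, rfl, rfl⟩ := hqe
  exact hq

theorem AntiPathSearch.exists_path_of_check {n : ℕ} {pre : List ℕ} {inits : List (List ℕ)}
    {fours paths steps : List ℕ} (hcheck : check n pre inits fours paths steps = true)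
    (hn : n ≤ 10) (hpre : pre.length ≤ n) (hA : Oriented A) {L : List V} (hL : L.Nodup)
    (hlen : L.length = n) (hX : FourTraceable A L.toFinset) {x₀ : V}
    (hinit : ∀ l ∈ inits, ∃ e ∈ l, e < 100 ∧ A (L.getD (e / 10) x₀) (L.getD (e % 10) x₀)) :
    ∃ l : List V, l.Nodup ∧ l.toFinset = L.toFinset ∧
      pre.map (fun i => L.getD i x₀) <+: l ∧ AltPath A true l := by
  have hmem {i : ℕ} (hi : i < n) : L.getD i x₀ ∈ L := by
    rw [List.getD_eq_getElem _ _ (hlen ▸ hi)]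
    exact List.getElem_mem _
  have hinj {i j : ℕ} (hi : i < n) (hj : j < n) (h : L.getD i x₀ = L.getD j x₀) : i = j := by
    rw [List.getD_eq_getElem _ _ (hlen ▸ hi), List.getD_eq_getElem _ _ (hlen ▸ hj)] at h
    exact (hL.getElem_inj_iff).1 h
  have hmap {p : List ℕ} (hp : p.Nodup) (hlt : ∀ x ∈ p, x < n) :
      (p.map fun i => L.getD i x₀).Nodup :=
    hp.map_on fun i hi j hj => hinj (hlt i hi) (hlt j hj)
  have hsub {p : List ℕ} (hlt : ∀ x ∈ p, x < n) :
      (p.map fun i => L.getD i x₀).toFinset ⊆ L.toFinset := by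
    intro x hx
    obtain ⟨i, hi, rfl⟩ := List.mem_map.1 (List.mem_toFinset.1 hx)
    exact List.mem_toFinset.2 (hmem (hlt i hi))
  obtain ⟨p, hp, hpn, hlt, hpp, h⟩ := check_sound hcheck hn hpre hA (f := fun i => L.getD i x₀)
    (fun a b c d hab hbc hcd hd => by
      have hnd : [a, b, c, d].Nodup := by simp; lia
      have hlt : ∀ x ∈ [a, b, c, d], x < n := by simp; lia
      obtain ⟨w, x, y, z, h1, h2, h3⟩ := hX.exists_path (hsub hlt)
        (by rw [List.toFinset_card_of_nodup (hmap hnd hlt)]; simp)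
      have hperm := List.perm_of_nodup_nodup_toFinset_eq h1 (hmap hnd hlt) h2
      obtain ⟨q, hq, hqp⟩ : ∃ q : List ℕ, [w, x, y, z] = q.map (fun i => L.getD i x₀) ∧
          q.Perm [a, b, c, d] := by
        have := congrFun₂ (List.eq_map_comp_perm fun i => L.getD i x₀) [w, x, y, z] [a, b, c, d]
        exact this.mpr hperm
      match q, hqp.length_eq with
      | [i, j, k, l], _ =>
        simp only [List.map_cons, List.map_nil, List.cons.injEq, and_true] at hq
        obtain ⟨rfl, rfl, rfl, rfl⟩ := hq
        exact ⟨_, mem_orders_of_perm hqp, h3⟩) hinit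
  refine ⟨_, hmap hp hlt, ?_, hpp.map _, h⟩
  refine Finset.eq_of_subset_of_card_le (hsub hlt) ?_
  rw [List.toFinset_card_of_nodup hL, List.toFinset_card_of_nodup (hmap hp hlt), List.length_map,
    hlen, hpn]

theorem FourTraceable.exists_path_six (hA : Oriented A) {a b c d x y : V}
    (hL : [a, b, c, d, x, y].Nodup) (hX : FourTraceable A [a, b, c, d, x, y].toFinset)
    (hp : AltPath A true [a, b, c, d]) :
    ∃ l : List V, l.Nodup ∧ l.toFinset = [a, b, c, d, x, y].toFinset ∧ AltPath A true l := by
  simp only [AltPath] at hp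
  obtain ⟨l, h1, h2, -, h3⟩ := AntiPathSearch.exists_path_of_check AntiPathSearch.check_six
    (by norm_num) (by simp) hA hL rfl hX (x₀ := a) (by simpa using hp)
  exact ⟨l, h1, h2, h3⟩

theorem FourTraceable.exists_path_eight (hA : Oriented A) {a b c d x y z w : V}
    (hL : [a, b, c, d, x, y, z, w].Nodup)
    (hX : FourTraceable A [a, b, c, d, x, y, z, w].toFinset)
    (hp : AltPath A true [a, b, c, d, x, y]) :
    ∃ l : List V, l.Nodup ∧ l.toFinset = [a, b, c, d, x, y, z, w].toFinset ∧
      AltPath A true l := by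
  simp only [AltPath] at hp
  obtain ⟨l, h1, h2, -, h3⟩ := AntiPathSearch.exists_path_of_check AntiPathSearch.check_eight
    (by norm_num) (by simp) hA hL rfl hX (x₀ := a) (by simpa using hp)
  exact ⟨l, h1, h2, h3⟩

theorem AntiPathSearch.exists_arc_of_mem_sixSubsets {f : ℕ → V} {T : Finset V} (hT : T.card = 3)
    (hTf : ∀ x ∈ T, A (f 0) x ∧ ∃ i, 1 ≤ i ∧ i ≤ 8 ∧ f i = x) :
    ∀ l ∈ sixSubsets, ∃ e ∈ l, e < 100 ∧ A (f (e / 10)) (f (e % 10)) := by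
  have key : ∀ l ∈ sixSubsets, (∀ e ∈ l, e < 10) ∧ ∃ i < 9, ∃ j < 9, ∀ e < 9, 1 ≤ e →
      e ∈ l ∨ e = i ∨ e = j := by decide +kernel
  intro l hl
  obtain ⟨hlt, i, -, j, -, hij⟩ := key l hl
  by_contra! hno
  have hsub : T ⊆ {f i, f j} := by
    intro x hx
    obtain ⟨hAx, e, he1, he2, rfl⟩ := hTf x hx
    rcases hij e (by lia) he1 with he | rfl | rfl
    · have := hno e he (by lia)
      rw [Nat.div_eq_of_lt (hlt e he), Nat.mod_eq_of_lt (hlt e he)] at this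
      exact absurd hAx this
    · simp
    · simp
  have := (Finset.card_le_card hsub).trans Finset.card_le_two
  lia

theorem FourTraceable.exists_path_nine (hA : Oriented A) {v a b c d x y z w : V}
    (hL : [v, a, b, c, d, x, y, z, w].Nodup)
    (hX : FourTraceable A [v, a, b, c, d, x, y, z, w].toFinset)
    (hp : AltPath A true [a, b, c, d, x, y, z, w]) {T : Finset V} (hT : T.card = 3)
    (hTX : T ⊆ [a, b, c, d, x, y, z, w].toFinset) (hvT : ∀ t ∈ T, A v t) :
    ∃ l : List V, (v :: l).Nodup ∧ (v :: l).toFinset = [v, a, b, c, d, x, y, z, w].toFinset ∧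
      AltPath A true (v :: l) := by
  simp only [AltPath] at hp
  obtain ⟨l, h1, h2, ⟨l', rfl⟩, h3⟩ := AntiPathSearch.exists_path_of_check
    AntiPathSearch.check_nine (by norm_num) (by simp) hA hL rfl hX (x₀ := v) (by
      intro l hl
      rw [List.mem_append] at hl
      rcases hl with hl | hl
      · revert l
        simpa using hp
      · refine AntiPathSearch.exists_arc_of_mem_sixSubsets
          (f := fun i => [v, a, b, c, d, x, y, z, w].getD i v) hT (fun t ht => ⟨hvT t ht, ?_⟩) l hl
        have := hTX ht
        simp only [List.mem_toFinset, List.mem_cons, List.not_mem_nil, or_false] at this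
        rcases this with rfl | rfl | rfl | rfl | rfl | rfl | rfl | rfl
        exacts [⟨1, by simp⟩, ⟨2, by simp⟩, ⟨3, by simp⟩, ⟨4, by simp⟩, ⟨5, by simp⟩,
          ⟨6, by simp⟩, ⟨7, by simp⟩, ⟨8, by simp⟩])
  exact ⟨l', h1, h2, h3⟩

theorem FourTraceable.exists_path_ten (hA : Oriented A) {v u : V} {l : List V}
    (hlen : l.length = 8) (hL : (v :: (l ++ [u])).Nodup)
    (hX : FourTraceable A (v :: (l ++ [u])).toFinset) (hp : AltPath A true (v :: l))
    {T : Finset V} (hT : T.card = 3) (hTl : T ⊆ l.toFinset) (hvT : ∀ t ∈ T, A v t) :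
    ∃ l' : List V, (v :: l').Nodup ∧ (v :: l').toFinset = (v :: (l ++ [u])).toFinset ∧
      AltPath A true (v :: l') := by
  obtain ⟨a, b, c, d, x, y, z, w, rfl⟩ := exists_eq_of_length_eq_eight hlen
  simp only [AltPath] at hp
  obtain ⟨l, h1, h2, ⟨l', rfl⟩, h3⟩ := AntiPathSearch.exists_path_of_check
    AntiPathSearch.check_ten (by norm_num) (by simp) hA hL rfl hX (x₀ := v) (by
      intro l hl
      rw [List.mem_append] at hl
      rcases hl with hl | hl
      · revert l
        simpa using hp
      · refine AntiPathSearch.exists_arc_of_mem_sixSubsets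
          (f := fun i => [v, a, b, c, d, x, y, z, w, u].getD i v) hT
          (fun t ht => ⟨hvT t ht, ?_⟩) l hl
        have := hTl ht
        simp only [List.mem_toFinset, List.mem_cons, List.not_mem_nil, or_false] at this
        rcases this with rfl | rfl | rfl | rfl | rfl | rfl | rfl | rfl
        exacts [⟨1, by simp⟩, ⟨2, by simp⟩, ⟨3, by simp⟩, ⟨4, by simp⟩, ⟨5, by simp⟩,
          ⟨6, by simp⟩, ⟨7, by simp⟩, ⟨8, by simp⟩])
  exact ⟨l', h1, h2, h3⟩

theorem FourTraceable.exists_path_of_card_eq_eight (hA : Oriented A) (hX : FourTraceable A X)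
    (hc : X.card = 8) : ∃ l : List V, l.Nodup ∧ l.toFinset = X ∧ AltPath A true l := by
  obtain ⟨S, hS, hSc⟩ := Finset.exists_subset_card_eq (show 4 ≤ X.card by lia)
  obtain ⟨a, b, c, d, h1, rfl, h2, h3, h4⟩ := hX.exists_path hS hSc
  have hdiff : (X \ [a, b, c, d].toFinset).card = 4 := by
    rw [Finset.card_sdiff_of_subset hS]; lia
  obtain ⟨l, hl1, hl2⟩ : ∃ l : List V, l.Nodup ∧ l.toFinset = X \ [a, b, c, d].toFinset :=
    ⟨_, Finset.nodup_toList _, Finset.toList_toFinset _⟩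
  rw [← hl2, List.toFinset_card_of_nodup hl1] at hdiff
  match l, hdiff with
  | [x, y, z, w], _ =>
  have hXe : X = [a, b, c, d, x, y, z, w].toFinset := by
    rw [← Finset.union_sdiff_of_subset hS, ← hl2, ← List.toFinset_append]
    rfl
  have hnd : [a, b, c, d, x, y, z, w].Nodup := by
    refine List.Nodup.append h1 hl1 (l₁ := [a, b, c, d]) fun u hu hu' => ?_
    have : u ∈ X \ [a, b, c, d].toFinset := hl2 ▸ List.mem_toFinset.2 hu'
    exact (Finset.mem_sdiff.1 this).2 (List.mem_toFinset.2 hu)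
  have hpre : [a, b, c, d, x, y] <+: [a, b, c, d, x, y, z, w] := ⟨[z, w], rfl⟩
  subst hXe
  obtain ⟨p, p1, p2, p3⟩ := FourTraceable.exists_path_six hA
    (hnd.sublist hpre.sublist) (hX.mono fun u hu => by
      rw [List.mem_toFinset] at hu ⊢
      exact hpre.subset hu) (by simpa [AltPath] using ⟨h2, h3, h4⟩)
  have hp := List.perm_of_nodup_nodup_toFinset_eq p1 (hnd.sublist hpre.sublist) p2
  have hp' : (p ++ [z, w]).Perm [a, b, c, d, x, y, z, w] := hp.append_right [z, w]
  match p, hp.length_eq with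
  | [a', b', c', d', x', y'], _ =>
  rw [← List.toFinset_eq_of_perm _ _ hp'] at hX ⊢
  exact FourTraceable.exists_path_eight hA (hp'.nodup_iff.2 hnd) hX p3

/-- A vertex with enough other vertices around has three out-neighbours or three in-neighbours
among them. -/
theorem FourTraceable.exists_three (hX : FourTraceable A X) {v : V} (hv : v ∈ X)
    (hY : Y ⊆ X.erase v) (hc : 7 ≤ Y.card) :
    (∃ T ⊆ Y, T.card = 3 ∧ ∀ t ∈ T, A v t) ∨ ∃ T ⊆ Y, T.card = 3 ∧ ∀ t ∈ T, A t v := by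
  classical
  by_contra! hno
  have hout : (Y.filter (A v)).card ≤ 2 := by
    by_contra! h
    obtain ⟨T, hT, hTc⟩ := Finset.exists_subset_card_eq h
    obtain ⟨t, ht, ht'⟩ := hno.1 T (hT.trans (Finset.filter_subset _ _)) hTc
    exact ht' (Finset.mem_filter.1 (hT ht)).2
  have hin : (Y.filter fun u => A u v).card ≤ 2 := by
    by_contra! h
    obtain ⟨T, hT, hTc⟩ := Finset.exists_subset_card_eq h
    obtain ⟨t, ht, ht'⟩ := hno.2 T (hT.trans (Finset.filter_subset _ _)) hTc
    exact ht' (Finset.mem_filter.1 (hT ht)).2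
  have hnon : 3 ≤ (Y \ (Y.filter (A v) ∪ Y.filter fun u => A u v)).card := by
    have := Finset.le_card_sdiff (Y.filter (A v) ∪ Y.filter fun u => A u v) Y
    have := Finset.card_union_le (Y.filter (A v)) (Y.filter fun u => A u v)
    lia
  obtain ⟨T, hT, hTc⟩ := Finset.exists_subset_card_eq hnon
  have hTY : T ⊆ Y := hT.trans Finset.sdiff_subset
  have hvT : v ∉ T := fun h => by simpa using hY (hTY h)
  have hT' : ∀ t ∈ T, ¬ A v t ∧ ¬ A t v := by
    intro t ht
    have := hT ht
    simp only [Finset.mem_sdiff, Finset.mem_union, Finset.mem_filter, not_or, not_and] at this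
    exact ⟨this.2.1 this.1, this.2.2 this.1⟩
  obtain ⟨w, x, y, z, h1, h2, h3, h4, h5⟩ := hX.exists_path (S := insert v T)
    (Finset.insert_subset hv ((hTY.trans hY).trans (Finset.erase_subset _ _)))
    (by rw [Finset.card_insert_of_notMem hvT, hTc])
  have hmem : ∀ u ∈ [w, x, y, z], u ≠ v → u ∈ T := fun u hu huv =>
    (Finset.mem_insert.1 (h2 ▸ List.mem_toFinset.2 hu)).resolve_left huv
  have hv' : v ∈ [w, x, y, z] := List.mem_toFinset.1 (h2 ▸ Finset.mem_insert_self v T)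
  have hne : w ≠ x ∧ y ≠ x ∧ y ≠ z := by
    simp only [List.nodup_cons, List.mem_cons, not_or] at h1
    exact ⟨h1.1.1, fun h => h1.2.1.1 h.symm, h1.2.2.1.1⟩
  simp only [List.mem_cons, List.not_mem_nil, or_false] at hv'
  rcases hv' with rfl | rfl | rfl | rfl
  · exact (hT' x (hmem x (by simp) hne.1.symm)).1 h3
  · exact (hT' w (hmem w (by simp) hne.1)).2 h3
  · exact (hT' x (hmem x (by simp) hne.2.1.symm)).1 h4
  · exact (hT' y (hmem y (by simp) hne.2.2)).2 h5

theorem FourTraceable.exists_path_of_card_eq_nine (hA : Oriented A) (hX : FourTraceable A X)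
    (hc : X.card = 9) {v : V} (hv : v ∈ X) {T : Finset V} (hT : T.card = 3) (hTX : T ⊆ X)
    (hvT : ∀ t ∈ T, A v t) :
    ∃ l : List V, (v :: l).Nodup ∧ (v :: l).toFinset = X ∧ AltPath A true (v :: l) := by
  obtain ⟨l, h1, h2, h3⟩ := (hX.mono (Finset.erase_subset v X)).exists_path_of_card_eq_eight hA
    (by rw [Finset.card_erase_of_mem hv, hc])
  have hlen : l.length = 8 := by
    rw [← List.toFinset_card_of_nodup h1, h2, Finset.card_erase_of_mem hv, hc]
  have hvl : v ∉ l := by simp [← List.mem_toFinset, h2]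
  have hXe : (v :: l).toFinset = X := by
    rw [List.toFinset_cons, h2, Finset.insert_erase hv]
  have hTl : T ⊆ l.toFinset := by
    rw [h2, Finset.subset_erase]
    exact ⟨hTX, fun h => hA _ _ (hvT v h) (hvT v h)⟩
  rw [← hXe] at hX ⊢
  match l, hlen with
  | [a, b, c, d, x, y, z, w], _ =>
  exact hX.exists_path_nine hA (List.nodup_cons.2 ⟨hvl, h1⟩) h3 hT hTl hvT

theorem FourTraceable.exists_path_of_card_eq_ten (hA : Oriented A) (hX : FourTraceable A X)
    (hc : X.card = 10) {v : V} (hv : v ∈ X) {T : Finset V} (hT : T.card = 3) (hTX : T ⊆ X)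
    (hvT : ∀ t ∈ T, A v t) :
    ∃ l : List V, (v :: l).Nodup ∧ (v :: l).toFinset = X ∧ AltPath A true (v :: l) := by
  obtain ⟨u, hu, huT⟩ : ∃ u ∈ X, u ∉ insert v T := by
    refine Finset.exists_mem_notMem_of_card_lt_card ?_
    have := Finset.card_insert_le v T
    lia
  rw [Finset.mem_insert, not_or] at huT
  have hcu : (X.erase u).card = 9 := by rw [Finset.card_erase_of_mem hu, hc]
  obtain ⟨l, h1, h2, h3⟩ := (hX.mono (Finset.erase_subset u X)).exists_path_of_card_eq_nine hA
    hcu (Finset.mem_erase.2 ⟨Ne.symm huT.1, hv⟩) hT (Finset.subset_erase.2 ⟨hTX, huT.2⟩) hvT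
  have hlen : l.length = 8 := by
    have := List.toFinset_card_of_nodup h1
    rw [h2, hcu, List.length_cons] at this
    lia
  have hul : u ∉ v :: l := by rw [← List.mem_toFinset, h2]; exact Finset.notMem_erase u X
  have hXe : (v :: (l ++ [u])).toFinset = X := by
    rw [← List.cons_append, List.toFinset_append, h2]
    ext x
    by_cases hx : x = u <;> simp [hx, hu]
  have hTl : T ⊆ l.toFinset := by
    intro t ht
    have : t ∈ (v :: l).toFinset := by
      rw [h2]
      exact Finset.mem_erase.2 ⟨fun h => huT.2 (h ▸ ht), hTX ht⟩
    rw [List.toFinset_cons, Finset.mem_insert] at this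
    refine this.resolve_left ?_
    rintro rfl
    exact hA _ _ (hvT t ht) (hvT t ht)
  have hnd : (v :: (l ++ [u])).Nodup := by
    rw [← List.cons_append]
    exact h1.append (List.nodup_singleton u) (by simpa using hul)
  rw [← hXe] at hX ⊢
  exact hX.exists_path_ten hA hlen hnd h3 hT hTl hvT

/-- A vertex with three out-neighbours is the start of a hamiltonian anti-directed path whose
first arc is directed forwards. -/
theorem FourTraceable.exists_path_from (n : ℕ) (hn : 9 ≤ n) {A : V → V → Prop} (hA : Oriented A)
    {X : Finset V} (hX : FourTraceable A X) (hc : X.card = n) {v : V} (hv : v ∈ X)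
    {T : Finset V} (hT : T.card = 3) (hTX : T ⊆ X) (hvT : ∀ t ∈ T, A v t) :
    ∃ l : List V, (v :: l).Nodup ∧ (v :: l).toFinset = X ∧ AltPath A true (v :: l) := by
  induction n using Nat.strong_induction_on generalizing A X v T with
  | _ n ih =>
  obtain rfl | rfl | hn : n = 9 ∨ n = 10 ∨ 11 ≤ n := by lia
  · exact hX.exists_path_of_card_eq_nine hA hc hv hT hTX hvT
  · exact hX.exists_path_of_card_eq_ten hA hc hv hT hTX hvT
  have hv' : v ∉ T := fun h => hA _ _ (hvT v h) (hvT v h)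
  have hTv : T ⊆ X.erase v := Finset.subset_erase.2 ⟨hTX, hv'⟩
  have hcv : (X.erase v).card = n - 1 := by rw [Finset.card_erase_of_mem hv, hc]
  by_cases hcase : ∃ u ∈ T, ∃ U ⊆ X.erase v, U.card = 3 ∧ ∀ t ∈ U, A t u
  · obtain ⟨u, hu, U, hU, hUc, hUu⟩ := hcase
    obtain ⟨l, h1, h2, h3⟩ := ih (n - 1) (by lia) (by lia) hA.flip
      (hX.mono (Finset.erase_subset v X)).flip hcv (hTv hu) hUc hU hUu
    refine ⟨u :: l, List.nodup_cons.2 ⟨?_, h1⟩, ?_, ?_⟩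
    · rw [← List.mem_toFinset, h2]
      exact Finset.notMem_erase v X
    · rw [List.toFinset_cons, h2, Finset.insert_erase hv]
    · exact ⟨hvT u hu, altPath_flip.1 h3⟩
  · obtain ⟨p, hp, q, hq, hpq⟩ : ∃ p ∈ T, ∃ q ∈ T, A p q := by
      obtain ⟨w, x, y, z, h1, h2, h3, h4, h5⟩ := hX.exists_path (S := insert v T)
        (Finset.insert_subset hv hTX) (by rw [Finset.card_insert_of_notMem hv', hT])
      have hmem : ∀ u ∈ [w, x, y, z], u ≠ v → u ∈ T := fun u hu huv =>
        (Finset.mem_insert.1 (h2 ▸ List.mem_toFinset.2 hu)).resolve_left huv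
      by_cases hvwx : w ≠ v ∧ x ≠ v
      · exact ⟨w, hmem w (by simp) hvwx.1, x, hmem x (by simp) hvwx.2, h3⟩
      · refine ⟨y, hmem y (by simp) ?_, z, hmem z (by simp) ?_, h5⟩ <;>
        · rintro rfl
          simp only [List.nodup_cons, List.mem_cons, not_or] at h1
          tauto
    have hqv := Finset.mem_erase.1 (hTv hq)
    have hpv := Finset.mem_erase.1 (hTv hp)
    have hpq' : p ≠ q := by
      rintro rfl
      exact hA _ _ hpq hpq
    have hpY : p ∈ (X.erase v).erase q := Finset.mem_erase.2 ⟨hpq', hTv hp⟩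
    have hcq : ((X.erase v).erase q).card = n - 2 := by
      rw [Finset.card_erase_of_mem (hTv hq), hcv]
      lia
    have hY : FourTraceable A ((X.erase v).erase q) :=
      hX.mono ((Finset.erase_subset _ _).trans (Finset.erase_subset _ _))
    rcases hY.exists_three hpY subset_rfl (by rw [Finset.card_erase_of_mem hpY, hcq]; lia) with
      ⟨U, hU, hUc, hpU⟩ | ⟨U, hU, hUc, hpU⟩
    · obtain ⟨l, h1, h2, h3⟩ := ih (n - 2) (by lia) (by lia) hA hY hcq hpY hUc
        (hU.trans (Finset.erase_subset _ _)) hpU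
      have hql : q ∉ p :: l := by
        rw [← List.mem_toFinset, h2]
        exact Finset.notMem_erase q _
      have hqe : (q :: p :: l).toFinset = X.erase v := by
        rw [List.toFinset_cons, h2, Finset.insert_erase (hTv hq)]
      have hvl : v ∉ q :: p :: l := by
        rw [← List.mem_toFinset, hqe]
        exact Finset.notMem_erase v X
      refine ⟨q :: p :: l, List.nodup_cons.2 ⟨hvl, List.nodup_cons.2 ⟨hql, h1⟩⟩, ?_, ?_⟩
      · rw [List.toFinset_cons, hqe, Finset.insert_erase hv]
      · exact ⟨hvT q hq, hpq, h3⟩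
    · exact absurd ⟨p, hp, U, (hU.trans (Finset.erase_subset _ _)).trans (Finset.erase_subset _ _),
        hUc, hpU⟩ hcase

end

theorem stmt12 [Fintype V] [DecidableEq V] (A : V → V → Prop)
    (hA : Oriented A) (hcard : 8 ≤ Fintype.card V)
    (h4 : KAntiTraceable 4 A) : AntiTraceable A := by
  have hX : FourTraceable A Finset.univ := fun S _ hS => h4.2 S hS
  rw [← Finset.card_univ] at hcard
  obtain hc | hc := hcard.eq_or_lt
  · obtain ⟨l, h1, h2, h3⟩ := hX.exists_path_of_card_eq_eight hA hc.symm
    exact ⟨l, h1, h2, true, h3⟩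
  · obtain ⟨v, hv⟩ := Finset.card_pos.1 (show 0 < (Finset.univ : Finset V).card by lia)
    rcases hX.exists_three hv subset_rfl (by rw [Finset.card_erase_of_mem hv]; lia) with
      ⟨T, hT, hTc, hvT⟩ | ⟨T, hT, hTc, hvT⟩
    · obtain ⟨l, h1, h2, h3⟩ := hX.exists_path_from _ hc hA rfl hv hTc
        (Finset.subset_univ _) hvT
      exact ⟨_, h1, h2, true, h3⟩
    · obtain ⟨l, h1, h2, h3⟩ := hX.flip.exists_path_from _ hc hA.flip rfl hv hTc
        (Finset.subset_univ _) hvT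
      exact ⟨_, h1, h2, false, altPath_flip.1 h3⟩
end
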